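/- Let f be a transcendental meromorphic function in the plane such that f has finitely many multiple points and the inverse function f⁻¹ has finitely many transcendental singularities. Then the Schwarzian derivative S_f of f is a rational function. -/

import Mathlib

open Filter Set Topology Bornology MeasureTheory

noncomputable section

/-! ### The extended plane and the chordal metric

ℂ∞ is modelled as `Option ℂ`, with `none` denoting the point ∞. -/

/-- The chordal metric χ on the extended complex plane ℂ∞ (`none` = ∞). -/
def chordal : Option ℂ → Option ℂ → ℝ
  | Option.none, Option.none => 0
  | Option.none, Option.some w => 1 / Real.sqrt (1 + norm w ^ 2)
  | Option.some z, Option.none => 1 / Real.sqrt (1 + norm z ^ 2)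
  | Option.some z, Option.some w =>
      norm (z - w) / Real.sqrt ((1 + norm z ^ 2) * (1 + norm w ^ 2))

/-! ### Meromorphic functions in the plane -/

/-- `f` is meromorphic on the plane with pole set `P`: poles form a discrete closed set,
`f` is analytic off `P`, and `|f| → ∞` at each point of `P`. -/
def MeroPlane (f : ℂ → ℂ) (P : Set ℂ) : Prop :=
  (∀ K : Set ℂ, IsCompact K → (P ∩ K).Finite) ∧
  (∀ z ∉ P, AnalyticAt ℂ f z) ∧
  ∀ p ∈ P, Tendsto (fun z => norm (f z)) (nhdsWithin p Pᶜ) atTop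

/-- `f` coincides with a rational function away from its poles. -/
def RationalFn (f : ℂ → ℂ) (P : Set ℂ) : Prop :=
  ∃ p q : Polynomial ℂ, q ≠ 0 ∧ ∀ z ∉ P, q.eval z ≠ 0 → f z = p.eval z / q.eval z

/-- `f` is a transcendental meromorphic function in the plane, with pole set `P`. -/
def TranscMeroPlane (f : ℂ → ℂ) (P : Set ℂ) : Prop :=
  MeroPlane f P ∧ ¬ RationalFn f P

/-- `f` has a pole of order `m` at `z₀`. -/
def PoleOrder (f : ℂ → ℂ) (z₀ : ℂ) (m : ℕ) : Prop :=
  0 < m ∧ ∃ g : ℂ → ℂ, AnalyticAt ℂ g z₀ ∧ g z₀ ≠ 0 ∧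
    ∀ᶠ z in nhdsWithin z₀ {z₀}ᶜ, f z = g z / (z - z₀) ^ m

/-- `f` has a zero of order `m` at `z₀`. -/
def ZeroOrder (f : ℂ → ℂ) (z₀ : ℂ) (m : ℕ) : Prop :=
  0 < m ∧ ∃ g : ℂ → ℂ, AnalyticAt ℂ g z₀ ∧ g z₀ ≠ 0 ∧
    ∀ᶠ z in nhds z₀, f z = (z - z₀) ^ m * g z

/-- `z₀` is a multiple point of `f` of multiplicity `μ`: either a pole of `f` of order `μ ≥ 2`,
or a point of analyticity where `f'` has a zero of order `μ - 1`. -/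
def MultiplePointWithMult (f : ℂ → ℂ) (z₀ : ℂ) (μ : ℕ) : Prop :=
  2 ≤ μ ∧ (PoleOrder f z₀ μ ∨ (AnalyticAt ℂ f z₀ ∧ ZeroOrder (deriv f) z₀ (μ - 1)))

/-- `z₀` is a multiple point of `f`. -/
def MultiplePoint (f : ℂ → ℂ) (z₀ : ℂ) : Prop :=
  ∃ μ, MultiplePointWithMult f z₀ μ

open scoped Classical in
/-- The value of `f` at `z` as an element of ℂ∞, given the pole set `P`. -/
def valueAt (f : ℂ → ℂ) (P : Set ℂ) (z : ℂ) : Option ℂ :=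
  if z ∈ P then none else some (f z)

/-- The set of critical values of `f` in ℂ∞ (values at multiple points). -/
def CriticalValues (f : ℂ → ℂ) (P : Set ℂ) : Set (Option ℂ) :=
  {w | ∃ z, MultiplePoint f z ∧ w = valueAt f P z}

/-! ### Transcendental singularities of the inverse function -/

/-- A path tending to infinity on which `f → a`; such a path determines a transcendental
singularity of `f⁻¹` over `a`. -/
def AsymptoticPath (f : ℂ → ℂ) (P : Set ℂ) (a : Option ℂ) (γ : ℝ → ℂ) : Prop :=
  ContinuousOn γ (Ici 0) ∧
  Tendsto (fun t => norm (γ t)) atTop atTop ∧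
  Tendsto (fun t => chordal (valueAt f P (γ t)) a) atTop (nhds 0)

/-- `C` is a connected component of the set `S`. -/
def IsComponentOf (C S : Set ℂ) : Prop :=
  ∃ x ∈ S, C = connectedComponentIn S x

/-- The paths `γ₁`, `γ₂`, with asymptotic values `a₁`, `a₂` respectively, determine
distinct transcendental singularities of `f⁻¹`. -/
def DistinctSingularities (f : ℂ → ℂ) (P : Set ℂ) (a₁ a₂ : Option ℂ) (γ₁ γ₂ : ℝ → ℂ) : Prop :=
  a₁ ≠ a₂ ∨ ∃ t : ℝ, 0 < t ∧ ∃ C₁ C₂ : Set ℂ,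
    IsComponentOf C₁ {z | chordal (valueAt f P z) a₁ < t} ∧
    IsComponentOf C₂ {z | chordal (valueAt f P z) a₂ < t} ∧
    Disjoint C₁ C₂ ∧
    IsBounded (γ₁ '' Ici 0 \ C₁) ∧ IsBounded (γ₂ '' Ici 0 \ C₂)

/-- The inverse function of `f` has finitely many transcendental singularities: there is a
bound `n` on the size of any family of pairwise distinct transcendental singularities. -/
def FinitelyManyTranscSing (f : ℂ → ℂ) (P : Set ℂ) : Prop :=
  ∃ n : ℕ, ∀ m : ℕ, ∀ a : Fin m → Option ℂ, ∀ γ : Fin m → ℝ → ℂ,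
    (∀ i, AsymptoticPath f P (a i) (γ i)) →
    (∀ i j, i ≠ j → DistinctSingularities f P (a i) (a j) (γ i) (γ j)) →
    m ≤ n

/-- The Schwarzian derivative `S_f = f'''/f' - (3/2)(f''/f')²`. -/
def schwarzian (f : ℂ → ℂ) (z : ℂ) : ℂ :=
  deriv (deriv (deriv f)) z / deriv f z - (3 / 2) * (deriv (deriv f) z / deriv f z) ^ 2

/-- `w` is a singular value of `f⁻¹`: a critical value or an asymptotic value of `f`. -/
def SingularValue (f : ℂ → ℂ) (P : Set ℂ) (w : Option ℂ) : Prop :=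
  w ∈ CriticalValues f P ∨ ∃ γ : ℝ → ℂ, AsymptoticPath f P w γ

/-! ### Nevanlinna theory -/

open scoped Classical in
/-- The order of the pole of `f` at `z` (junk value `0` if there is no pole). -/
def poleOrderAt (f : ℂ → ℂ) (z : ℂ) : ℕ :=
  if h : ∃ m, PoleOrder f z m then h.choose else 0

/-- `n(t, f)`: the number of poles of `f` of modulus at most `t`, counted with multiplicity. -/
def nCount (f : ℂ → ℂ) (t : ℝ) : ℕ :=
  ∑ᶠ z ∈ {w : ℂ | norm w ≤ t}, poleOrderAt f z

/-- `N(r, f)`: the integrated counting function of the poles of `f`. -/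
def nevN (f : ℂ → ℂ) (r : ℝ) : ℝ :=
  (nCount f 0 : ℝ) * Real.log r + ∫ t in (0:ℝ)..r, ((nCount f t : ℝ) - (nCount f 0 : ℝ)) / t

/-- `m(r, f)`: the Nevanlinna proximity function. -/
def nevm (f : ℂ → ℂ) (r : ℝ) : ℝ :=
  (1 / (2 * Real.pi)) * ∫ θ in (0:ℝ)..(2 * Real.pi),
    Real.log (max 1 (norm (f (r * Complex.exp (θ * Complex.I)))))

/-- `T(r, f)`: the Nevanlinna characteristic. -/
def nevT (f : ℂ → ℂ) (r : ℝ) : ℝ := nevm f r + nevN f r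

/-- The order of growth `ρ(f) = limsup_{r→∞} log T(r,f)/log r`, as an extended real. -/
def growthOrder (f : ℂ → ℂ) : EReal :=
  Filter.limsup (fun r : ℝ => ((Real.log (nevT f r) / Real.log r : ℝ) : EReal)) atTop

/-- ∞ is a Borel exceptional value of `f`. -/
def BorelExceptionalInfty (f : ℂ → ℂ) : Prop :=
  Filter.limsup (fun r : ℝ => ((Real.log (nevN f r) / Real.log r : ℝ) : EReal)) atTop <
  Filter.limsup (fun r : ℝ => ((Real.log (nevT f r) / Real.log r : ℝ) : EReal)) atTop

/-! ### Meromorphic functions near infinity and the Wiman-Valiron property -/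

/-- `A` is meromorphic in `R ≤ |z| < ∞` with pole set `P`. -/
def MeroAnnulus (A : ℂ → ℂ) (R : ℝ) (P : Set ℂ) : Prop :=
  P ⊆ {z : ℂ | R ≤ norm z} ∧
  (∀ K : Set ℂ, IsCompact K → (P ∩ K).Finite) ∧
  (∀ z : ℂ, R < norm z → z ∉ P → AnalyticAt ℂ A z) ∧
  ∀ p ∈ P, Tendsto (fun z => norm (A z)) (nhdsWithin p Pᶜ) atTop

/-- `A` (meromorphic near ∞ with pole set `P`) has an essential singularity at infinity:
it is not the case that the poles are bounded and `A(z) ~ c zⁿ` as `z → ∞`. -/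
def EssSingAtInfty (A : ℂ → ℂ) (P : Set ℂ) : Prop :=
  ¬ (IsBounded P ∧ ∃ (n : ℤ) (c : ℂ), c ≠ 0 ∧
      Tendsto (fun z : ℂ => A z / z ^ n)
        (Filter.comap (fun z : ℂ => norm z) atTop ⊓ Filter.principal Pᶜ) (nhds c))

/-- The logarithmic rectangle `D(z_r, L)` of Definition 2.1. -/
def WVDisk (z₀ : ℂ) (Nr phir L : ℝ) : Set ℂ :=
  {z : ℂ | ∃ τ : ℂ, z = z₀ * Complex.exp τ ∧
    |τ.re| ≤ L * phir / Nr ∧ |τ.im| ≤ L * phir / Nr}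

/-- Data witnessing the Wiman-Valiron property for `A`, meromorphic in `R ≤ |z| < ∞`:
an unbounded set `F1 ⊆ [R,∞)`, functions `N : F1 → [2,∞)`, `phi : F1 → [1,∞)` and points
`zr r` with `|zr r| = r`, such that `N(r) → ∞`, `phi(r)/N(r) → 0`, `phi(r)/log N(r) → ∞`,
`phi(r) = o(log⁺ |A(zr r)|)`, and `A(z) ~ (z/zr r)^{N(r)} A(zr r)` on `D(zr r, 8)`,
uniformly as `r → ∞` in `F1`.  (For `z = zr r · e^τ` one has `(z/zr r)^{N(r)} = e^{N(r)τ}`.) -/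
structure WVData (A : ℂ → ℂ) (R : ℝ) where
  F1 : Set ℝ
  N : ℝ → ℝ
  phi : ℝ → ℝ
  zr : ℝ → ℂ
  F1_sub : F1 ⊆ Ici R
  F1_unbounded : ∀ c : ℝ, ∃ r ∈ F1, c < r
  N_ge : ∀ r ∈ F1, 2 ≤ N r
  phi_ge : ∀ r ∈ F1, 1 ≤ phi r
  N_tendsto : Tendsto N (atTop ⊓ Filter.principal F1) atTop
  phi_over_N : Tendsto (fun r => phi r / N r) (atTop ⊓ Filter.principal F1) (nhds 0)
  phi_over_logN : Tendsto (fun r => phi r / Real.log (N r)) (atTop ⊓ Filter.principal F1) atTop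
  zr_abs : ∀ r ∈ F1, norm (zr r) = r
  phi_small : Tendsto (fun r => phi r / Real.log (max 1 (norm (A (zr r)))))
      (atTop ⊓ Filter.principal F1) (nhds 0)
  approx : ∀ ε : ℝ, 0 < ε → ∀ᶠ r in atTop ⊓ Filter.principal F1, ∀ τ : ℂ,
      |τ.re| ≤ 8 * phi r / N r → |τ.im| ≤ 8 * phi r / N r →
      norm (A (zr r * Complex.exp τ) - Complex.exp ((N r : ℂ) * τ) * A (zr r))
        ≤ ε * norm (Complex.exp ((N r : ℂ) * τ) * A (zr r))

/-- `A` has the Wiman-Valiron property (Definition 2.1). -/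
def HasWVProp (A : ℂ → ℂ) (R : ℝ) : Prop := Nonempty (WVData A R)

/-- The point `w_r = z_r exp(-4 phi(r)/N(r))`. -/
def WVwr {A : ℂ → ℂ} {R : ℝ} (W : WVData A R) (r : ℝ) : ℂ :=
  W.zr r * Complex.exp (((-(4 * W.phi r / W.N r) : ℝ) : ℂ))

/-- The quantity `Z_r = |2 z_r A(z_r)^{1/2} / (N(r)+2)|`. -/
def WVZr {A : ℂ → ℂ} {R : ℝ} (W : WVData A R) (r : ℝ) : ℝ :=
  2 * r * Real.sqrt (norm (A (W.zr r))) / (W.N r + 2)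

/-- The data of an analytic branch `sqA r` of `A^{1/2}` on `D(z_r, 4)` together with the
primitive `Z r` of `A^{1/2}` with `Z r (w_r) = 2 w_r A(w_r)^{1/2}/(N+2)`; this encodes
`Z(z) = 2 w_r A(w_r)^{1/2}/(N+2) + ∫_{w_r}^z A(t)^{1/2} dt`. -/
def IsZData {A : ℂ → ℂ} {R : ℝ} (W : WVData A R) (sqA Z : ℝ → ℂ → ℂ) (r : ℝ) : Prop :=
  (∀ z ∈ WVDisk (W.zr r) (W.N r) (W.phi r) 4,
      (sqA r z) ^ 2 = A z ∧ AnalyticAt ℂ (sqA r) z ∧ HasDerivAt (Z r) (sqA r z) z) ∧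
  Z r (WVwr W r) = 2 * WVwr W r * sqA r (WVwr W r) / ((W.N r : ℂ) + 2)

/-- The closed logarithmic rectangle `J₁ = {Z : |log|Z/Z_r|| ≤ phi(r), |arg Z| ≤ π/4}`. -/
def J1 (Zr phir : ℝ) : Set ℂ :=
  {w : ℂ | w ≠ 0 ∧ |Real.log (norm w / Zr)| ≤ phir ∧ |Complex.arg w| ≤ Real.pi / 4}

/-! ### ε-sets -/

/-- An ε-set: a countable union of discs `B(b_j, ρ_j)` with `|b_j| → ∞` and
`Σ ρ_j/|b_j| < ∞`. -/
def IsEpsilonSet (E : Set ℂ) : Prop :=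
  ∃ (b : ℕ → ℂ) (ρ : ℕ → ℝ), (∀ j, 0 ≤ ρ j) ∧
    Tendsto (fun j => norm (b j)) atTop atTop ∧
    Summable (fun j => ρ j / norm (b j)) ∧
    E = ⋃ j, Metric.ball (b j) (ρ j)


section PartA

lemma schw_congr {f g : ℂ → ℂ} {z : ℂ} (h : f =ᶠ[𝓝 z] g) : schwarzian f z = schwarzian g z := by
  unfold schwarzian
  rw [h.deriv.deriv.deriv_eq, h.deriv.deriv_eq, h.deriv_eq]

lemma schw_comp {f g : ℂ → ℂ} {z : ℂ} (hf : AnalyticAt ℂ f (g z)) (hg : AnalyticAt ℂ g z)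
    (hf' : deriv f (g z) ≠ 0) (hg' : deriv g z ≠ 0) :
    schwarzian (fun x => f (g x)) z = schwarzian f (g z) * deriv g z ^ 2 + schwarzian g z := by
  have e1 : deriv (fun x => f (g x)) =ᶠ[𝓝 z] fun x => deriv f (g x) * deriv g x := by
    filter_upwards [hg.continuousAt.eventually hf.eventually_analyticAt, hg.eventually_analyticAt]
      with x h1 h2
    exact (h1.differentiableAt.hasDerivAt.comp x h2.differentiableAt.hasDerivAt).deriv
  have e2 : deriv (deriv (fun x => f (g x))) =ᶠ[𝓝 z]
      fun x => deriv (deriv f) (g x) * deriv g x * deriv g x + deriv f (g x) * deriv (deriv g) x := by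
    refine e1.deriv.trans ?_
    filter_upwards [hg.continuousAt.eventually hf.eventually_analyticAt, hg.eventually_analyticAt]
      with x h1 h2
    exact ((h1.deriv.differentiableAt.hasDerivAt.comp x h2.differentiableAt.hasDerivAt).mul
      h2.deriv.differentiableAt.hasDerivAt).deriv
  have d1 := (hf.deriv.differentiableAt.hasDerivAt.comp z hg.differentiableAt.hasDerivAt)
  have d2 := (hf.deriv.deriv.differentiableAt.hasDerivAt.comp z hg.differentiableAt.hasDerivAt)
  have d3 := hg.deriv.differentiableAt.hasDerivAt
  have d4 := hg.deriv.deriv.differentiableAt.hasDerivAt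
  have e3 : deriv (deriv (deriv (fun x => f (g x)))) z = _ :=
    e2.deriv_eq.trans (((d2.mul d3).mul d3).add (d1.mul d4)).deriv
  unfold schwarzian
  rw [e3, e2.eq_of_nhds, e1.eq_of_nhds]
  simp only [Function.comp, Pi.mul_apply]
  field_simp
  ring

lemma schw_inv {w : ℂ} (hw : w ≠ 0) : schwarzian (fun x => x⁻¹) w = 0 := by
  have h1 : deriv (fun x : ℂ => x⁻¹) = fun x => -(x ^ 2)⁻¹ := by
    funext x; rw [deriv_inv]
  have h2 : deriv (fun x : ℂ => -(x ^ 2)⁻¹) =ᶠ[𝓝 w] fun x => 2 * (x ^ 3)⁻¹ := by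
    filter_upwards [isOpen_ne.mem_nhds hw] with x hx
    have := ((hasDerivAt_pow 2 x).fun_inv (pow_ne_zero 2 hx)).fun_neg.deriv
    rw [this]; have : x ≠ 0 := hx; field_simp; ring
  have h3 : deriv (fun x : ℂ => 2 * (x ^ 3)⁻¹) w = -6 * (w ^ 4)⁻¹ := by
    have := (((hasDerivAt_pow 3 w).fun_inv (pow_ne_zero 3 hw)).const_mul (2:ℂ)).deriv
    rw [this]; field_simp; ring
  unfold schwarzian
  rw [h1, h2.deriv_eq, h2.eq_of_nhds, h3]
  field_simp; ring

lemma schw_exp (a w : ℂ) : schwarzian (fun x => a + Complex.exp x) w = -1 / 2 := by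
  have h1 : deriv (fun x : ℂ => a + Complex.exp x) = Complex.exp := by
    funext x; simp
  unfold schwarzian
  rw [h1, Complex.deriv_exp, Complex.deriv_exp]
  have := Complex.exp_ne_zero w
  field_simp; ring

lemma schw_affine (a b w : ℂ) : schwarzian (fun x => a + b * x) w = 0 := by
  have h1 : deriv (fun x : ℂ => a + b * x) = fun _ => b := by
    funext x; simp
  unfold schwarzian
  rw [h1]; simp

lemma schw_id (w : ℂ) : schwarzian (fun x => x) w = 0 := by
  have := schw_affine 0 1 w
  simpa using this

lemma schw_inv_comp {f : ℂ → ℂ} {z : ℂ} (hf : AnalyticAt ℂ f z) (h0 : f z ≠ 0)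
    (hf' : deriv f z ≠ 0) : schwarzian (fun x => (f x)⁻¹) z = schwarzian f z := by
  have := schw_comp (f := fun x => x⁻¹) (g := f) (z := z) (analyticAt_inv h0) hf
    (by rw [deriv_inv]; simpa using h0) hf'
  rw [this, schw_inv h0]; ring

lemma schw_affine_comp {f : ℂ → ℂ} {z a b : ℂ} (hf : AnalyticAt ℂ f z) (hb : b ≠ 0)
    (hf' : deriv f z ≠ 0) : schwarzian (fun x => a + b * f x) z = schwarzian f z := by
  have := schw_comp (f := fun x => a + b * x) (g := f) (z := z) (by fun_prop) hf
    (by simpa using hb) hf'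
  rw [this, schw_affine]; ring

lemma schw_comp_affine {f : ℂ → ℂ} {z a b : ℂ} (hf : AnalyticAt ℂ f (a + b * z)) (hb : b ≠ 0)
    (hf' : deriv f (a + b * z) ≠ 0) :
    schwarzian (fun x => f (a + b * x)) z = b ^ 2 * schwarzian f (a + b * z) := by
  have := schw_comp (f := f) (g := fun x => a + b * x) (z := z) hf (by fun_prop)
    hf' (by simpa using hb)
  rw [this, schw_affine]; simp; ring

end PartA

section PartB1

lemma circ_lower {k : ℂ → ℂ} (hk : DifferentiableOn ℂ k (Metric.ball 0 1)) {r : ℝ} (hr : 0 < r)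
    (hr1 : r < 1) :
    2 * Real.pi * ((r ^ 4)⁻¹ + ‖k 0‖ ^ 2) ≤
      ∫ θ in (-Real.pi)..Real.pi, ‖-(circleMap 0 r θ ^ 2)⁻¹ + k (circleMap 0 r θ)‖ ^ 2 := by
  set c := k 0 with hc
  have hmem : ∀ θ, circleMap 0 r θ ∈ Metric.ball (0:ℂ) 1 := fun θ => by
    simp [abs_of_pos hr, hr1]
  have hne : ∀ θ, circleMap 0 r θ ≠ 0 := fun θ => circleMap_ne_center hr.ne'
  have hcont : Continuous fun θ => k (circleMap 0 r θ) :=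
    hk.continuousOn.comp_continuous (continuous_circleMap 0 r) hmem
  let h : ℂ → ℂ := fun z => 2 * k z * (starRingEnd ℂ c - z ^ 2 / r ^ 4)
  have hd : DiffContOnCl ℂ h (Metric.ball 0 |r|) := by
    apply DifferentiableOn.diffContOnCl
    rw [closure_ball _ (abs_pos.2 hr.ne').ne']
    have : DifferentiableOn ℂ k (Metric.closedBall 0 |r|) :=
      hk.mono (Metric.closedBall_subset_ball (by rw [abs_of_pos hr]; exact hr1))
    fun_prop
  have hav := hd.circleAverage
  have hint : ∫ θ in (-Real.pi)..Real.pi, h (circleMap 0 r θ) = 2 * Real.pi * h 0 := by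
    rw [← hav, Real.circleAverage_def]
    have hp : Function.Periodic (fun θ => h (circleMap 0 r θ)) (2 * Real.pi) := fun x => by
      simp [periodic_circleMap 0 r x]
    have := hp.intervalIntegral_add_eq (-Real.pi) 0
    rw [show -Real.pi + 2 * Real.pi = Real.pi by ring, zero_add] at this
    rw [this]
    have := Real.pi_ne_zero
    simp only [Complex.real_smul]
    push_cast
    field_simp
  have hch : Continuous fun θ => h (circleMap 0 r θ) := by
    exact (continuous_const.mul hcont).mul (continuous_const.sub
      (((continuous_circleMap 0 r).pow 2).div_const _))
  have hre : ∫ θ in (-Real.pi)..Real.pi, (h (circleMap 0 r θ)).re = 2 * Real.pi * (2 * ‖c‖ ^ 2) := by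
    have := intervalIntegral.intervalIntegral_re (𝕜 := ℂ) (μ := volume) (hch.intervalIntegrable (-Real.pi) Real.pi)
    simp only [RCLike.re_to_complex] at this
    rw [this, hint]
    have : h 0 = ((2 * ‖c‖ ^ 2 : ℝ) : ℂ) := by
      simp only [h, ← hc]
      simp [mul_assoc, Complex.mul_conj, Complex.normSq_eq_norm_sq]
    rw [this]
    norm_cast
  have hlow : ∀ θ, (r ^ 4)⁻¹ - ‖c‖ ^ 2 + (h (circleMap 0 r θ)).re ≤
      ‖-(circleMap 0 r θ ^ 2)⁻¹ + k (circleMap 0 r θ)‖ ^ 2 := by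
    intro θ
    set z := circleMap 0 r θ with hz
    have hzn : ‖z‖ = r := by simp [hz, abs_of_pos hr]
    have hinv : (z ^ 2)⁻¹ = (starRingEnd ℂ) (z ^ 2 / r ^ 4) := by
      have : z ≠ 0 := hne θ
      have h1 : z * (starRingEnd ℂ) z = (r ^ 2 : ℝ) := by
        rw [Complex.mul_conj, Complex.normSq_eq_norm_sq, hzn]
      have hr' : (r : ℂ) ≠ 0 := by exact_mod_cast hr.ne'
      simp only [map_div₀, map_pow, Complex.conj_ofReal]
      field_simp
      calc (r:ℂ) ^ 4 = (z * (starRingEnd ℂ) z) ^ 2 := by rw [h1]; push_cast; ring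
        _ = _ := by ring
    set b := z ^ 2 / (r:ℂ) ^ 4 with hb
    have hbn : ‖b‖ ^ 2 = (r ^ 4)⁻¹ := by
      rw [hb]; simp [hzn, abs_of_pos hr]; field_simp
    rw [hinv]
    have e1 : ‖-(starRingEnd ℂ) b + k z‖ ^ 2 = ‖b‖ ^ 2 - 2 * (k z * b).re + ‖k z‖ ^ 2 := by
      simp only [← Complex.normSq_eq_norm_sq, Complex.normSq_apply]
      simp
      ring
    have e2 : 0 ≤ ‖k z‖ ^ 2 - 2 * (k z * starRingEnd ℂ c).re + ‖c‖ ^ 2 := by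
      have : ‖k z - c‖ ^ 2 = ‖k z‖ ^ 2 - 2 * (k z * starRingEnd ℂ c).re + ‖c‖ ^ 2 := by
        simp only [← Complex.normSq_eq_norm_sq, Complex.normSq_apply]
        simp
        ring
      rw [← this]; positivity
    have e3 : (h z).re = 2 * (k z * starRingEnd ℂ c).re - 2 * (k z * b).re := by
      have : h z = ((2:ℝ):ℂ) * (k z * starRingEnd ℂ c) - ((2:ℝ):ℂ) * (k z * b) := by
        simp only [h, ← hb]; push_cast; ring
      rw [this, Complex.sub_re, Complex.re_ofReal_mul, Complex.re_ofReal_mul]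
    rw [e1, e3, hbn]; linarith
  have hcr : Continuous fun θ => (h (circleMap 0 r θ)).re := Complex.continuous_re.comp hch
  have hmain := intervalIntegral.integral_mono (μ := volume) (a := -Real.pi) (b := Real.pi)
    (f := fun θ => (r ^ 4)⁻¹ - ‖c‖ ^ 2 + (h (circleMap 0 r θ)).re)
    (g := fun θ => ‖-(circleMap 0 r θ ^ 2)⁻¹ + k (circleMap 0 r θ)‖ ^ 2)
    (by linarith [Real.pi_pos])
    (Continuous.intervalIntegrable (by fun_prop) _ _)
    (Continuous.intervalIntegrable (by
      have : Continuous fun θ => (circleMap 0 r θ ^ 2)⁻¹ :=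
        Continuous.inv₀ (by fun_prop) (fun θ => pow_ne_zero 2 (hne θ))
      exact (this.neg.add hcont).norm.pow 2) _ _) hlow
  rw [intervalIntegral.integral_add (by simp) (hcr.intervalIntegrable _ _), hre] at hmain
  simp only [intervalIntegral.integral_const, smul_eq_mul] at hmain
  refine le_trans (le_of_eq ?_) hmain
  ring

lemma area_lower {k : ℂ → ℂ} (hk : DifferentiableOn ℂ k (Metric.ball 0 1)) {s R : ℝ} (hs : 0 < s)
    (hsR : s < R) (hR : R < 1) :
    ENNReal.ofReal (Real.pi * ((s ^ 2)⁻¹ - (R ^ 2)⁻¹) + Real.pi * (R ^ 2 - s ^ 2) * ‖k 0‖ ^ 2) ≤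
      ∫⁻ z in {z : ℂ | s < ‖z‖ ∧ ‖z‖ < R}, ENNReal.ofReal (‖-(z ^ 2)⁻¹ + k z‖ ^ 2) := by
  have hA : MeasurableSet {z : ℂ | s < ‖z‖ ∧ ‖z‖ < R} :=
    ((isOpen_lt continuous_const continuous_norm).inter
      (isOpen_lt continuous_norm continuous_const)).measurableSet
  rw [← lintegral_indicator hA, ← Complex.lintegral_comp_polarCoord_symm]
  set D : Set (ℝ × ℝ) := Ioo s R ×ˢ Ioo (-Real.pi) Real.pi with hD
  have hsub : D ⊆ polarCoord.target := by
    rintro ⟨r, θ⟩ ⟨h1, h2⟩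
    exact ⟨hs.trans h1.1, h2⟩
  have hpc : ∀ p : ℝ × ℝ, Complex.polarCoord.symm p = circleMap 0 p.1 p.2 := by
    intro p; simp [circleMap, Complex.exp_mul_I]
  let G : ℝ × ℝ → ℝ := fun p => p.1 * ‖-(circleMap 0 p.1 p.2 ^ 2)⁻¹ + k (circleMap 0 p.1 p.2)‖ ^ 2
  have hcm : Continuous fun p : ℝ × ℝ => circleMap 0 p.1 p.2 := by
    unfold circleMap; fun_prop
  have hDm : MeasurableSet D := measurableSet_Ioo.prod measurableSet_Ioo
  have hGc : ContinuousOn G D := by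
    have h1 : ContinuousOn (fun p : ℝ × ℝ => (circleMap 0 p.1 p.2 ^ 2)⁻¹) D := by
      apply ContinuousOn.inv₀ (by fun_prop)
      rintro ⟨r, θ⟩ ⟨h1, h2⟩
      exact pow_ne_zero 2 (circleMap_ne_center (hs.trans h1.1).ne')
    have h2 : ContinuousOn (fun p : ℝ × ℝ => k (circleMap 0 p.1 p.2)) D := by
      apply hk.continuousOn.comp hcm.continuousOn
      rintro ⟨r, θ⟩ ⟨h1, h2⟩
      simp [abs_of_pos (hs.trans h1.1), h1.2.trans hR]
    exact continuous_fst.continuousOn.mul ((h1.neg.add h2).norm.pow 2)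
  have step1 : ∫⁻ p in D, ENNReal.ofReal (G p) ≤
      ∫⁻ p in polarCoord.target, ENNReal.ofReal p.1 •
        {z : ℂ | s < ‖z‖ ∧ ‖z‖ < R}.indicator (fun z => ENNReal.ofReal (‖-(z ^ 2)⁻¹ + k z‖ ^ 2))
          (Complex.polarCoord.symm p) := by
    refine le_trans (setLIntegral_mono' hDm ?_) (lintegral_mono_set hsub)
    rintro ⟨r, θ⟩ ⟨h1, h2⟩
    have hr : 0 < r := hs.trans h1.1
    rw [hpc, indicator_of_mem]
    · simp only [G, smul_eq_mul]
      rw [ENNReal.ofReal_mul hr.le]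
    · simpa [abs_of_pos hr] using h1
  refine le_trans ?_ step1
  rw [hD, Measure.volume_eq_prod, ← Measure.prod_restrict, lintegral_prod]
  swap
  · rw [Measure.prod_restrict, ← Measure.volume_eq_prod]
    exact (hGc.aemeasurable hDm).ennreal_ofReal
  have step2 : ∀ r ∈ Ioo s R, ENNReal.ofReal (2 * Real.pi * ((r ^ 3)⁻¹ + r * ‖k 0‖ ^ 2)) ≤
      ∫⁻ θ in Ioo (-Real.pi) Real.pi, ENNReal.ofReal (G (r, θ)) := by
    intro r hr
    have hr0 : 0 < r := hs.trans hr.1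
    have hci : Continuous fun θ => G (r, θ) := by
      have h1 : Continuous fun θ => (circleMap 0 r θ ^ 2)⁻¹ :=
        Continuous.inv₀ (by fun_prop) (fun θ => pow_ne_zero 2 (circleMap_ne_center hr0.ne'))
      have h2 : Continuous fun θ => k (circleMap 0 r θ) :=
        hk.continuousOn.comp_continuous (continuous_circleMap 0 r) (fun θ => by
          simp [abs_of_pos hr0, hr.2.trans hR])
      exact continuous_const.mul ((h1.neg.add h2).norm.pow 2)
    have hnn : ∀ θ, 0 ≤ G (r, θ) := fun θ => mul_nonneg hr0.le (by positivity)
    rw [← ofReal_integral_eq_lintegral_ofReal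
      ((hci.integrableOn_Icc (a := -Real.pi) (b := Real.pi)).mono_set Ioo_subset_Icc_self)
      (Eventually.of_forall hnn)]
    apply ENNReal.ofReal_le_ofReal
    rw [← integral_Ioc_eq_integral_Ioo, ← intervalIntegral.integral_of_le (by linarith [Real.pi_pos])]
    simp only [G]
    rw [intervalIntegral.integral_const_mul]
    refine le_trans (le_of_eq ?_)
      (mul_le_mul_of_nonneg_left (circ_lower hk hr0 (hr.2.trans hR)) hr0.le)
    field_simp
  refine le_trans ?_ (setLIntegral_mono' measurableSet_Ioo step2)
  have hc : ContinuousOn (fun r : ℝ => 2 * Real.pi * ((r ^ 3)⁻¹ + r * ‖k 0‖ ^ 2)) (Icc s R) := by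
    have : ContinuousOn (fun r : ℝ => (r ^ 3)⁻¹) (Icc s R) :=
      ContinuousOn.inv₀ (by fun_prop) (fun r hr => pow_ne_zero 3 (hs.trans_le hr.1).ne')
    fun_prop
  rw [← ofReal_integral_eq_lintegral_ofReal (hc.integrableOn_Icc.mono_set Ioo_subset_Icc_self)]
  swap
  · refine (ae_restrict_iff' measurableSet_Ioo).2 (Eventually.of_forall fun r hr => ?_)
    have : 0 < r := hs.trans hr.1
    have := Real.pi_pos
    simp only [Pi.zero_apply]
    positivity
  apply ENNReal.ofReal_le_ofReal
  rw [← integral_Ioc_eq_integral_Ioo, ← intervalIntegral.integral_of_le hsR.le]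
  have := intervalIntegral.integral_eq_sub_of_hasDerivAt_of_le (a := s) (b := R)
    (f := fun r => Real.pi * (-(r ^ 2)⁻¹ + r ^ 2 * ‖k 0‖ ^ 2)) hsR.le
    (f' := fun r : ℝ => 2 * Real.pi * ((r ^ 3)⁻¹ + r * ‖k 0‖ ^ 2))
    (by
      have : ContinuousOn (fun r : ℝ => (r ^ 2)⁻¹) (Icc s R) :=
        ContinuousOn.inv₀ (by fun_prop) (fun r hr => pow_ne_zero 2 (hs.trans_le hr.1).ne')
      fun_prop)
    (by
      intro r hr
      have hr0 : r ≠ 0 := (hs.trans hr.1).ne'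
      have h1 := ((hasDerivAt_pow 2 r).fun_inv (pow_ne_zero 2 hr0)).fun_neg
      have h2 := (hasDerivAt_pow 2 r).mul_const (‖k 0‖ ^ 2)
      refine ((h1.add h2).const_mul Real.pi).congr_deriv ?_
      have e : (r ^ 3)⁻¹ = r / (r ^ 2) ^ 2 := by field_simp
      rw [e]; push_cast; ring)
    (by
      apply ContinuousOn.intervalIntegrable
      rwa [uIcc_of_le hsR.le])
  rw [this]
  apply le_of_eq
  ring

end PartB1

section PartB2

lemma koebe_aux_ball {ψ : ℂ → ℂ} {s r : ℝ} (hs : 0 < s)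
    (hψ : DifferentiableOn ℂ ψ (Metric.ball 0 s)) (hc : ContinuousOn ψ (Metric.closedBall 0 s))
    (h0 : ψ 0 = 0) (hr : 0 < r) (hb : ∀ z, ‖z‖ = s → r ≤ ‖ψ z‖) :
    Metric.ball 0 r ⊆ ψ '' Metric.ball 0 s := by
  have hopen : IsOpen (ψ '' Metric.ball 0 s) := by
    have han : AnalyticOnNhd ℂ ψ (Metric.ball 0 s) := hψ.analyticOnNhd Metric.isOpen_ball
    rcases han.is_constant_or_isOpen (convex_ball 0 s).isPreconnected with ⟨w, hw⟩ | h
    · exfalso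
      have h1 : EqOn ψ (fun _ => w) (closure (Metric.ball 0 s)) := by
        apply Set.EqOn.of_subset_closure (s := Metric.ball 0 s) (fun z hz => hw z hz) _
          continuousOn_const subset_closure Subset.rfl
        rwa [closure_ball _ hs.ne']
      rw [closure_ball _ hs.ne'] at h1
      have h2 := h1 (show (s:ℂ) ∈ Metric.closedBall (0:ℂ) s by simp [abs_of_pos hs])
      have h3 := h1 (show (0:ℂ) ∈ Metric.closedBall (0:ℂ) s by simp [hs.le])
      have h4 := hb s (by simp [abs_of_pos hs])
      simp only at h2 h3
      rw [h2, ← h3, h0] at h4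
      simp at h4; linarith
    · exact h _ Subset.rfl Metric.isOpen_ball
  have hcl : IsClosed (ψ '' Metric.closedBall 0 s) :=
    ((isCompact_closedBall 0 s).image_of_continuousOn hc).isClosed
  have hpre : IsPreconnected (Metric.ball (0:ℂ) r) := (convex_ball 0 r).isPreconnected
  by_contra hcon
  rw [Set.not_subset] at hcon
  obtain ⟨v, hv, hv'⟩ := hcon
  have key : ∀ x ∈ Metric.ball (0:ℂ) r, x ∈ ψ '' Metric.closedBall 0 s → x ∈ ψ '' Metric.ball 0 s := by
    rintro x hx ⟨z, hz, rfl⟩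
    refine ⟨z, ?_, rfl⟩
    simp only [Metric.mem_closedBall, Metric.mem_ball, dist_zero_right] at *
    rcases hz.lt_or_eq with h | h
    · exact h
    · linarith [hb z h]
  obtain ⟨x, hx, hx1, hx2⟩ := hpre (ψ '' Metric.ball 0 s) (ψ '' Metric.closedBall 0 s)ᶜ hopen
    hcl.isOpen_compl (fun x hx => by
      by_cases h : x ∈ ψ '' Metric.closedBall 0 s
      · exact Or.inl (key x hx h)
      · exact Or.inr h)
    ⟨0, by simpa using hr, 0, by simpa using hs, h0⟩
    ⟨v, hv, fun h => hv' (key v hv h)⟩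
  exact hx2 (image_mono Metric.ball_subset_closedBall hx1)

lemma koebe_norm {φ : ℂ → ℂ} (hφ : DifferentiableOn ℂ φ (Metric.ball 0 1))
    (inj : InjOn φ (Metric.ball 0 1)) (h0 : φ 0 = 0) (h1 : deriv φ 0 = 1) :
    ‖schwarzian φ 0‖ ≤ 64 := by
  have hnb : Metric.ball (0:ℂ) 1 ∈ 𝓝 (0:ℂ) := Metric.ball_mem_nhds _ one_pos
  have hm0 : (0:ℂ) ∈ Metric.ball (0:ℂ) 1 := by simp
  set e := dslope φ 0 with he
  have hed : DifferentiableOn ℂ e (Metric.ball 0 1) := (Complex.differentiableOn_dslope hnb).2 hφ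
  have hφe : ∀ z, φ z = z * e z := fun z => by
    have := sub_smul_dslope φ 0 z
    simp only [sub_zero, h0, smul_eq_mul] at this; exact this.symm
  have he0 : e 0 = 1 := by rw [he, dslope_same, h1]
  have hne : ∀ z ∈ Metric.ball (0:ℂ) 1, e z ≠ 0 := by
    intro z hz h
    by_cases hz0 : z = 0
    · rw [hz0, he0] at h; exact one_ne_zero h
    · apply hz0; apply inj hz hm0
      rw [hφe, h, h0, mul_zero]
  set χ : ℂ → ℂ := fun z => (e z)⁻¹ with hχ
  have hχd : DifferentiableOn ℂ χ (Metric.ball 0 1) := hed.inv hne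
  have hχ0 : χ 0 = 1 := by simp [hχ, he0]
  set χ1 := dslope χ 0 with hχ1
  have hχ1d : DifferentiableOn ℂ χ1 (Metric.ball 0 1) := (Complex.differentiableOn_dslope hnb).2 hχd
  set κ := dslope χ1 0 with hκ
  have hκd : DifferentiableOn ℂ κ (Metric.ball 0 1) := (Complex.differentiableOn_dslope hnb).2 hχ1d
  set c1 := χ1 0 with hc1
  set c2 := κ 0 with hc2
  have hχe : ∀ z, χ z = 1 + c1 * z + z ^ 2 * κ z := fun z => by
    have a1 := sub_smul_dslope χ 0 z
    have a2 := sub_smul_dslope χ1 0 z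
    simp only [sub_zero, smul_eq_mul, ← hχ1, ← hκ, ← hc1, hχ0] at a1 a2
    linear_combination -a1 - z * a2
  -- Schwarzian
  have hS : schwarzian φ 0 = -6 * c2 := by
    have ha : AnalyticAt ℂ κ 0 := hκd.analyticAt hnb
    have hφa : AnalyticAt ℂ φ 0 := hφ.analyticAt hnb
    have hx : ∀ᶠ z in 𝓝 (0:ℂ), φ z = z * (χ z)⁻¹ := by
      filter_upwards [hnb] with z hz
      rw [hφe]; simp [hχ]
    -- product relation
    have hprod : (fun z => φ z * (1 + c1 * z + z ^ 2 * κ z)) =ᶠ[𝓝 0] fun z => z := by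
      filter_upwards [hnb] with z hz
      rw [← hχe, hφe]
      simp only [hχ]; field_simp [hne z hz]
    set X : ℂ → ℂ := fun z => 1 + c1 * z + z ^ 2 * κ z with hX
    have hXa : AnalyticAt ℂ X 0 := by simp only [hX]; fun_prop
    have d1 : deriv (fun z => φ z * X z) =ᶠ[𝓝 0] fun z => deriv φ z * X z + φ z * deriv X z := by
      filter_upwards [hφa.eventually_analyticAt, hXa.eventually_analyticAt] with z u1 u2
      exact (u1.differentiableAt.hasDerivAt.fun_mul u2.differentiableAt.hasDerivAt).deriv
    have d2 : deriv (deriv (fun z => φ z * X z)) =ᶠ[𝓝 0]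
        fun z => (deriv (deriv φ) z * X z + deriv φ z * deriv X z) +
          (deriv φ z * deriv X z + φ z * deriv (deriv X) z) := by
      refine d1.deriv.trans ?_
      filter_upwards [hφa.eventually_analyticAt, hXa.eventually_analyticAt] with z u1 u2
      exact ((u1.deriv.differentiableAt.hasDerivAt.fun_mul u2.differentiableAt.hasDerivAt).fun_add
        (u1.differentiableAt.hasDerivAt.fun_mul u2.deriv.differentiableAt.hasDerivAt)).deriv
    have p0 := hφa.differentiableAt.hasDerivAt
    have p1 := hφa.deriv.differentiableAt.hasDerivAt
    have p2 := hφa.deriv.deriv.differentiableAt.hasDerivAt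
    have x0 := hXa.differentiableAt.hasDerivAt
    have x1 := hXa.deriv.differentiableAt.hasDerivAt
    have x2 := hXa.deriv.deriv.differentiableAt.hasDerivAt
    have d3 : deriv (deriv (deriv (fun z => φ z * X z))) 0 = _ :=
      d2.deriv_eq.trans (((p2.fun_mul x0).fun_add (p1.fun_mul x1)).fun_add
        ((p1.fun_mul x1).fun_add (p0.fun_mul x2))).deriv
    have r1 := d2.eq_of_nhds
    rw [hprod.deriv.deriv.deriv_eq] at d3
    rw [hprod.deriv.deriv_eq] at r1
    have hX0 : X 0 = 1 := by simp [hX]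
    have dX : deriv X =ᶠ[𝓝 0] fun z => c1 + (2 * z * κ z + z ^ 2 * deriv κ z) := by
      filter_upwards [ha.eventually_analyticAt] with z u
      have := (((hasDerivAt_id z).const_mul c1).const_add 1).fun_add
        ((hasDerivAt_pow 2 z).fun_mul u.differentiableAt.hasDerivAt)
      rw [show X = fun z => (1 + c1 * id z) + z ^ 2 * κ z from rfl, this.deriv]
      simp
    have hX1 : deriv X 0 = c1 := by rw [dX.eq_of_nhds]; simp
    have hX2 : deriv (deriv X) 0 = 2 * c2 := by
      rw [dX.deriv_eq]
      have := ((((hasDerivAt_id (0:ℂ)).const_mul (2:ℂ)).fun_mul ha.differentiableAt.hasDerivAt).fun_add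
        ((hasDerivAt_pow 2 (0:ℂ)).fun_mul ha.deriv.differentiableAt.hasDerivAt)).const_add c1
      rw [show (fun z => c1 + (2 * z * κ z + z ^ 2 * deriv κ z)) =
        fun z => c1 + (2 * id z * κ z + z ^ 2 * deriv κ z) from rfl, this.deriv]
      simp [hc2]
    have hid1 : deriv (fun z : ℂ => z) = fun _ => 1 := by funext z; simp
    rw [hid1] at d3 r1
    simp [hX0, hX1, hX2, h0, h1] at d3 r1
    unfold schwarzian
    rw [h1]
    have hφ2 : deriv (deriv φ) 0 = -2 * c1 := by linear_combination -r1
    rw [hφ2] at d3 ⊢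
    linear_combination -d3
  -- area
  set k : ℂ → ℂ := deriv (fun z => z * κ z) with hk
  have hkd : DifferentiableOn ℂ k (Metric.ball 0 1) :=
    (differentiableOn_id.mul hκd).deriv Metric.isOpen_ball
  have hk0 : k 0 = c2 := by
    have := ((hasDerivAt_id (0:ℂ)).fun_mul (hκd.differentiableAt hnb).hasDerivAt).deriv
    simp only [id] at this
    rw [hk, this]; simp [hc2]
  set G : ℂ → ℂ := fun z => (φ z)⁻¹ with hG
  have hGe : ∀ z ∈ Metric.ball (0:ℂ) 1, z ≠ 0 → G z = z⁻¹ + c1 + z * κ z := by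
    intro z hz hz0
    have : G z = z⁻¹ * χ z := by simp [hG, hφe z, hχ, mul_comm]
    rw [this, hχe]; field_simp
  have hGd : ∀ z ∈ Metric.ball (0:ℂ) 1, z ≠ 0 → HasDerivAt G (-(z ^ 2)⁻¹ + k z) z := by
    intro z hz hz0
    have u1 := (hasDerivAt_inv hz0).add_const c1
    have u2 : HasDerivAt (fun z => z * κ z) (k z) z :=
      ((differentiableAt_id.mul (hκd.differentiableAt (Metric.isOpen_ball.mem_nhds hz)))).hasDerivAt
    refine (u1.fun_add u2).congr_of_eventuallyEq ?_
    filter_upwards [Metric.isOpen_ball.mem_nhds hz, isOpen_ne.mem_nhds hz0] with y hy hy0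
    exact hGe y hy hy0
  set c := ‖c2‖ with hc
  have hcnn : 0 ≤ c := norm_nonneg _
  -- choose s
  have hκc : ∀ᶠ z in 𝓝 (0:ℂ), ‖κ z‖ < c + 1 :=
    (hκd.continuousOn.continuousAt hnb).norm.eventually (gt_mem_nhds (by simp [hc, hc2]))
  obtain ⟨s0, hs0, hs0'⟩ := Metric.eventually_nhds_iff.1 hκc
  obtain ⟨s, hs, hs1, hs2, hs3⟩ : ∃ s : ℝ, 0 < s ∧ s < s0 ∧ s < 1 / 2 ∧
      s * (100 * (c ^ 2 + (c + 1) ^ 2)) < 1 := by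
    have hpos : 0 < 100 * (c ^ 2 + (c + 1) ^ 2) := by positivity
    refine ⟨min (s0 / 2) (min (1 / 4) (1 / (2 * (100 * (c ^ 2 + (c + 1) ^ 2))))), by positivity, ?_, ?_, ?_⟩
    · exact (min_le_left _ _).trans_lt (by linarith)
    · exact ((min_le_right _ _).trans (min_le_left _ _)).trans_lt (by norm_num)
    · calc _ ≤ (1 / (2 * (100 * (c ^ 2 + (c + 1) ^ 2)))) * (100 * (c ^ 2 + (c + 1) ^ 2)) := by
            gcongr
            exact (min_le_right _ _).trans (min_le_right _ _)
        _ < 1 := by field_simp; norm_num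
  have hκs : ∀ z, ‖z‖ ≤ s → ‖κ z‖ ≤ c + 1 := fun z hz =>
    (hs0' (by simpa using hz.trans_lt hs1)).le
  have hs4 : s ^ 2 * (c ^ 2 + (c + 1) ^ 2) < 1 / 100 := by nlinarith
  set m := s⁻¹ + s * (c + 1) with hm
  have hmpos : 0 < m := by positivity
  have hden : ∀ z, ‖z‖ ≤ s → 1 + z ^ 2 * κ z ≠ 0 := by
    intro z hz h
    have : ‖z ^ 2 * κ z‖ = 1 := by
      rw [show z ^ 2 * κ z = -1 by linear_combination h]; simp
    rw [norm_mul, norm_pow] at this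
    have h5 : ‖z‖ ^ 2 * ‖κ z‖ ≤ s ^ 2 * (c + 1) := by
      gcongr; exact hκs z hz
    nlinarith [sq_nonneg c, sq_nonneg s, mul_nonneg (sq_nonneg s) hcnn]
  set ψ : ℂ → ℂ := fun z => z / (1 + z ^ 2 * κ z) with hψ
  have hsub : Metric.closedBall (0:ℂ) s ⊆ Metric.ball 0 1 :=
    Metric.closedBall_subset_ball (by linarith)
  have hψd : DifferentiableOn ℂ ψ (Metric.closedBall 0 s) := by
    have := hκd.mono hsub
    apply DifferentiableOn.div differentiableOn_id (by fun_prop)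
    intro z hz; exact hden z (by simpa using hz)
  have hball := koebe_aux_ball (ψ := ψ) (s := s) (r := m⁻¹) hs
    (hψd.mono Metric.ball_subset_closedBall) hψd.continuousOn (by simp [hψ]) (by positivity) (by
      intro z hz
      simp only [hψ, norm_div, hz]
      have h5 : ‖1 + z ^ 2 * κ z‖ ≤ 1 + s ^ 2 * (c + 1) := by
        refine (norm_add_le _ _).trans ?_
        rw [norm_mul, norm_pow, hz, norm_one]
        have := hκs z hz.le
        gcongr
      rw [inv_eq_one_div, div_le_div_iff₀ hmpos (norm_pos_iff.2 (hden z hz.le))]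
      have : s * m = 1 + s ^ 2 * (c + 1) := by rw [hm]; field_simp
      rw [this]; linarith)
  set A := {z : ℂ | s < ‖z‖ ∧ ‖z‖ < 1 / 2} with hA
  have hAb : ∀ z ∈ A, z ∈ Metric.ball (0:ℂ) 1 ∧ z ≠ 0 := fun z hz =>
    ⟨by simpa using hz.2.trans (by norm_num), norm_pos_iff.1 (hs.trans hz.1)⟩
  have himg : G '' A ⊆ Metric.closedBall c1 m := by
    rintro _ ⟨z, hz, rfl⟩
    rw [Metric.mem_closedBall, dist_eq_norm]
    by_contra hlt
    push Not at hlt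
    have hne' : G z - c1 ≠ 0 := norm_pos_iff.1 (hmpos.trans hlt)
    obtain ⟨ξ, hξ, hξe⟩ := hball (show (G z - c1)⁻¹ ∈ Metric.ball 0 m⁻¹ by
      rw [mem_ball_zero_iff, norm_inv]
      exact inv_strictAnti₀ hmpos hlt)
    have hξs : ‖ξ‖ < s := by simpa using hξ
    have hξ0 : ξ ≠ 0 := by
      rintro rfl
      simp [hψ] at hξe
      exact hne' hξe.symm
    have hξ1 : ξ ∈ Metric.ball (0:ℂ) 1 := hsub (Metric.ball_subset_closedBall hξ)
    have : G ξ = G z := by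
      have hd := hden ξ hξs.le
      have h5 : G z - c1 = (ψ ξ)⁻¹ := by rw [hξe, inv_inv]
      rw [hGe ξ hξ1 hξ0]
      have h6 : (ψ ξ)⁻¹ = ξ⁻¹ + ξ * κ ξ := by simp only [hψ]; field_simp
      linear_combination -h5 - h6
    have h7 : ξ = z := inj hξ1 (hAb z hz).1 (inv_injective this)
    rw [h7] at hξs
    linarith [hz.1]
  have hAm : MeasurableSet A :=
    ((isOpen_lt continuous_const continuous_norm).inter
      (isOpen_lt continuous_norm continuous_const)).measurableSet
  have harea := lintegral_image_eq_lintegral_abs_det_fderiv_mul volume hAm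
    (f := G) (f' := fun z => (ContinuousLinearMap.toSpanSingleton ℂ (-(z ^ 2)⁻¹ + k z)).restrictScalars ℝ)
    (fun z hz => ((hGd z (hAb z hz).1 (hAb z hz).2).hasFDerivAt.restrictScalars ℝ).hasFDerivWithinAt)
    (fun x hx y hy hxy => inj (hAb x hx).1 (hAb y hy).1 (inv_injective hxy)) (fun _ => 1)
  have hdet : ∀ v : ℂ, |((ContinuousLinearMap.toSpanSingleton ℂ v).restrictScalars ℝ).det| = ‖v‖ ^ 2 := by
    intro v
    simp [ContinuousLinearMap.det, LinearMap.det_restrictScalars,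
      Algebra.norm_complex_eq, Complex.normSq_eq_norm_sq]
  simp only [hdet, mul_one, lintegral_one, Measure.restrict_apply_univ] at harea
  have hlow := area_lower hkd hs (R := 1 / 2) hs2 (by norm_num)
  rw [← hA, ← harea, hk0] at hlow
  have hup := hlow.trans (measure_mono himg)
  rw [Complex.volume_closedBall] at hup
  have hup' : Real.pi * ((s ^ 2)⁻¹ - ((1 / 2 : ℝ) ^ 2)⁻¹) + Real.pi * ((1 / 2) ^ 2 - s ^ 2) * c ^ 2 ≤
      m ^ 2 * Real.pi := by
    have e1 : ENNReal.ofReal m ^ 2 * (NNReal.pi : ENNReal) = ENNReal.ofReal (m ^ 2 * Real.pi) := by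
      rw [ENNReal.ofReal_mul (by positivity), ENNReal.ofReal_pow hmpos.le]
      congr 1
      rw [← NNReal.coe_real_pi, ENNReal.ofReal_coe_nnreal]
    rw [e1] at hup
    exact (ENNReal.ofReal_le_ofReal_iff (by positivity)).1 hup
  have hfin : (s ^ 2)⁻¹ - 4 + (1 / 4 - s ^ 2) * c ^ 2 ≤ m ^ 2 := by
    have hp := Real.pi_pos
    have : Real.pi * ((s ^ 2)⁻¹ - 4 + (1 / 4 - s ^ 2) * c ^ 2) ≤ Real.pi * m ^ 2 := by
      calc _ = _ := ?_
        _ ≤ _ := hup'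
        _ = _ := ?_
      · norm_num; ring
      · ring
    exact le_of_mul_le_mul_left this hp
  have hm2 : m ^ 2 = (s ^ 2)⁻¹ + 2 * (c + 1) + s ^ 2 * (c + 1) ^ 2 := by
    rw [hm]; field_simp; ring
  have hc64 : c ≤ 32 / 3 := by
    by_contra hcc
    push Not at hcc
    nlinarith
  rw [hS, norm_mul, norm_neg]
  simp only [← hc]
  norm_num
  linarith

theorem koebe_schw {φ : ℂ → ℂ} {w : ℂ} {u : ℝ} (hu : 0 < u)
    (hφ : DifferentiableOn ℂ φ (Metric.ball w u))
    (inj : InjOn φ (Metric.ball w u)) (hd : deriv φ w ≠ 0) :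
    ‖schwarzian φ w‖ ≤ 64 / u ^ 2 := by
  set ψ : ℂ → ℂ := fun z => -(φ w / (u * deriv φ w)) + (u * deriv φ w)⁻¹ * φ (w + u * z) with hψ
  have huC : (u : ℂ) ≠ 0 := by exact_mod_cast hu.ne'
  have hmaps : MapsTo (fun z : ℂ => w + u * z) (Metric.ball 0 1) (Metric.ball w u) := by
    intro z hz
    simp only [Metric.mem_ball, dist_zero_right, dist_self_add_left, norm_mul, Complex.norm_real,
      Real.norm_eq_abs, abs_of_pos hu] at *
    nlinarith
  have hcomp : DifferentiableOn ℂ (fun z => φ (w + u * z)) (Metric.ball 0 1) :=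
    hφ.comp (by fun_prop) hmaps
  have hψd : DifferentiableOn ℂ ψ (Metric.ball 0 1) := by
    simp only [hψ]; fun_prop
  have hφa : AnalyticAt ℂ φ w := hφ.analyticAt (Metric.ball_mem_nhds _ hu)
  have hφa' : AnalyticAt ℂ φ (w + u * 0) := by simpa using hφa
  have hcd : HasDerivAt (fun z : ℂ => φ (w + u * z)) (deriv φ w * u) 0 := by
    have h1 : HasDerivAt (fun z : ℂ => w + u * z) u 0 := by
      simpa using ((hasDerivAt_id (0:ℂ)).const_mul (u:ℂ)).const_add w
    have h2 : HasDerivAt φ (deriv φ w) (w + u * 0) := by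
      simpa using hφa.differentiableAt.hasDerivAt
    exact h2.comp 0 h1
  have key := koebe_norm (φ := ψ) hψd (by
      intro x hx y hy hxy
      simp only [hψ, add_right_inj] at hxy
      have h1 := mul_left_cancel₀ (inv_ne_zero (mul_ne_zero huC hd)) hxy
      have h2 := inj (hmaps hx) (hmaps hy) h1
      simpa [huC] using h2)
    (by simp only [hψ, mul_zero, add_zero]; field_simp; ring)
    (by
      have := ((hcd.const_mul ((u * deriv φ w)⁻¹)).const_add (-(φ w / (u * deriv φ w)))).deriv
      rw [hψ, this]; field_simp)
  have hcomp' : AnalyticAt ℂ (fun z => φ (w + u * z)) 0 :=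
    hcomp.analyticAt (Metric.ball_mem_nhds _ one_pos)
  have e1 := schw_affine_comp (f := fun z => φ (w + u * z)) (z := 0) (a := -(φ w / (u * deriv φ w)))
    (b := (u * deriv φ w)⁻¹) hcomp' (inv_ne_zero (mul_ne_zero huC hd)) (by
      rw [hcd.deriv]; exact mul_ne_zero hd huC)
  have e2 := schw_comp_affine (f := φ) (z := 0) (a := w) (b := u) hφa' huC (by simpa using hd)
  rw [hψ, e1, e2] at key
  simp only [mul_zero, add_zero, norm_mul, norm_pow, Complex.norm_real, Real.norm_eq_abs, sq_abs] at key
  rw [le_div_iff₀ (by positivity)]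
  linarith

end PartB2

section PartC

/-- lifting data -/
structure LiftData (f : ℂ → ℂ) (P S : Set ℂ) : Prop where
  clP : IsClosed P
  an : ∀ z ∉ P, AnalyticAt ℂ f z
  pole : ∀ p ∈ P, Tendsto (fun z => ‖f z‖) (𝓝[≠] p) atTop
  clS : IsClosed S
  crit : ∀ z ∉ P, deriv f z = 0 → f z ∈ S
  asy : ∀ (γ : ℝ → ℂ) (a : ℂ), ContinuousOn γ (Ici 0) → Tendsto (fun t => ‖γ t‖) atTop atTop →
    (∀ t, 0 ≤ t → γ t ∉ P) → Tendsto (fun t => f (γ t)) atTop (𝓝 a) → a ∈ S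

/-- regular points -/
def regE (f : ℂ → ℂ) (P S : Set ℂ) : Set ℂ := {z | z ∉ P ∧ f z ∉ S}

variable {f : ℂ → ℂ} {P S : Set ℂ}

lemma LiftData.open_reg (L : LiftData f P S) : IsOpen (regE f P S) := by
  rw [isOpen_iff_mem_nhds]
  rintro z ⟨h1, h2⟩
  filter_upwards [L.clP.isOpen_compl.mem_nhds h1,
    (L.an z h1).continuousAt.eventually (L.clS.isOpen_compl.mem_nhds h2)] with x a b
  exact ⟨a, b⟩

lemma LiftData.deriv_ne (L : LiftData f P S) {z : ℂ} (hz : z ∈ regE f P S) : deriv f z ≠ 0 :=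
  fun h => hz.2 (L.crit z hz.1 h)

lemma locinv {f : ℂ → ℂ} {z : ℂ} (ha : AnalyticAt ℂ f z) (hd : deriv f z ≠ 0) {U : Set ℂ}
    (hU : IsOpen U) (hz : z ∈ U) :
    ∃ e : OpenPartialHomeomorph ℂ ℂ, z ∈ e.source ∧ e.source ⊆ U ∧ (∀ x, e x = f x) := by
  have hs : HasStrictDerivAt f (deriv f z) z := ha.hasStrictDerivAt
  let e0 := (hs.hasStrictFDerivAt_equiv hd).toOpenPartialHomeomorph f
  have h0 : z ∈ e0.source := (hs.hasStrictFDerivAt_equiv hd).mem_toOpenPartialHomeomorph_source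
  refine ⟨e0.restrOpen U hU, ?_, ?_, ?_⟩
  · simp [OpenPartialHomeomorph.restrOpen_source]; exact ⟨h0, hz⟩
  · simp [OpenPartialHomeomorph.restrOpen_source]
  · intro x; rfl

lemma LiftData.locinv (L : LiftData f P S) {z : ℂ} (hz : z ∈ regE f P S) :
    ∃ e : OpenPartialHomeomorph ℂ ℂ, z ∈ e.source ∧ e.source ⊆ regE f P S ∧ (∀ x, e x = f x) :=
  _root_.locinv (L.an z hz.1) (L.deriv_ne hz) L.open_reg hz

lemma LiftData.locHomeo (L : LiftData f P S) :
    IsLocalHomeomorph (fun x : regE f P S => f x) := by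
  rw [isLocalHomeomorph_iff_isLocalHomeomorphOn_univ]
  have h1 : IsLocalHomeomorphOn f (regE f P S) := by
    apply IsLocalHomeomorphOn.mk
    intro x hx
    obtain ⟨e, h1, h2, h3⟩ := L.locinv hx
    exact ⟨e, h1, fun y _ => (h3 y).symm⟩
  have h2 : IsLocalHomeomorphOn (Subtype.val : regE f P S → ℂ) univ :=
    L.open_reg.isOpenEmbedding_subtypeVal.isLocalHomeomorph.isLocalHomeomorphOn
  exact h1.comp h2 (fun x _ => x.2)

lemma LiftData.uniq (L : LiftData f P S) {X : Type*} [TopologicalSpace X] {K : Set X}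
    (hK : IsPreconnected K) {g₁ g₂ : X → ℂ} (c₁ : ContinuousOn g₁ K) (c₂ : ContinuousOn g₂ K)
    (m₁ : MapsTo g₁ K (regE f P S)) (m₂ : MapsTo g₂ K (regE f P S))
    (heq : ∀ x ∈ K, f (g₁ x) = f (g₂ x)) {x₀ : X} (hx : x₀ ∈ K) (h0 : g₁ x₀ = g₂ x₀) :
    EqOn g₁ g₂ K := by
  have : PreconnectedSpace K := isPreconnected_iff_preconnectedSpace.1 hK
  let G₁ : K → regE f P S := fun x => ⟨g₁ x, m₁ x.2⟩
  let G₂ : K → regE f P S := fun x => ⟨g₂ x, m₂ x.2⟩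
  have C₁ : Continuous G₁ := Continuous.subtype_mk c₁.domRestrict _
  have C₂ : Continuous G₂ := Continuous.subtype_mk c₂.domRestrict _
  have hG := (T2Space.isSeparatedMap (fun x : regE f P S => f x)).eq_of_comp_eq
    L.locHomeo.isLocallyInjective C₁ C₂ (funext fun x => heq x x.2) ⟨x₀, hx⟩ (Subtype.ext h0)
  intro x hx
  have := congrFun hG ⟨x, hx⟩
  exact congrArg Subtype.val this

/-- path lifting -/
lemma LiftData.path (L : LiftData f P S) {c : ℝ → ℂ} (hc : ContinuousOn c (Icc 0 1))
    (hcS : ∀ t ∈ Icc (0:ℝ) 1, c t ∉ S) {z₀ : ℂ} (hz : z₀ ∉ P) (h0 : f z₀ = c 0) :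
    ∃ γ : ℝ → ℂ, ContinuousOn γ (Icc 0 1) ∧ γ 0 = z₀ ∧
      ∀ t ∈ Icc (0:ℝ) 1, γ t ∈ regE f P S ∧ f (γ t) = c t := by
  let Q : ℝ → (ℝ → ℂ) → Prop := fun T γ => ContinuousOn γ (Icc 0 T) ∧ γ 0 = z₀ ∧
      ∀ t ∈ Icc (0:ℝ) T, γ t ∈ regE f P S ∧ f (γ t) = c t
  let J : Set ℝ := {T | T ∈ Icc (0:ℝ) 1 ∧ ∃ γ, Q T γ}
  have hz0 : z₀ ∈ regE f P S := ⟨hz, h0 ▸ hcS 0 (by simp)⟩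
  have J0 : (0:ℝ) ∈ J := ⟨by simp, fun _ => z₀, continuousOn_const, rfl, fun t ht => by
    have : t = 0 := le_antisymm ht.2 ht.1
    subst this; exact ⟨hz0, h0⟩⟩
  have Jbdd : BddAbove J := ⟨1, fun T hT => hT.1.2⟩
  set T := sSup J with hT
  have hT0 : 0 ≤ T := le_csSup Jbdd J0
  have hT1 : T ≤ 1 := csSup_le ⟨0, J0⟩ fun T hT => hT.1.2
  have Jdown : ∀ s ∈ J, ∀ t, 0 ≤ t → t ≤ s → t ∈ J := by
    rintro s ⟨hs, γ, g1, g2, g3⟩ t ht hts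
    exact ⟨⟨ht, hts.trans hs.2⟩, γ, g1.mono (Icc_subset_Icc_right hts), g2,
      fun x hx => g3 x ⟨hx.1, hx.2.trans hts⟩⟩
  have huniq : ∀ s, 0 ≤ s → ∀ γ₁ γ₂, Q s γ₁ → Q s γ₂ → EqOn γ₁ γ₂ (Icc 0 s) := by
    intro s hs γ₁ γ₂ q1 q2
    exact L.uniq isPreconnected_Icc q1.1 q2.1 (fun t ht => (q1.2.2 t ht).1)
      (fun t ht => (q2.2.2 t ht).1)
      (fun t ht => (q1.2.2 t ht).2.trans (q2.2.2 t ht).2.symm) (x₀ := 0) ⟨le_rfl, hs⟩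
      (q1.2.1.trans q2.2.1.symm)
  -- extension step: a lift on [0,s], point z with local inverse
  have hext : ∀ z ∈ regE f P S, f z = c T → (∀ U ∈ 𝓝 z, ∀ δ > 0, ∃ s ∈ J, T - δ < s ∧ s ≤ T ∧
      ∃ γ, Q s γ ∧ γ s ∈ U) → T = 1 ∧ (1:ℝ) ∈ J := by
    intro z hzE hzc happ
    obtain ⟨e, e1, e2, e3⟩ := L.locinv hzE
    have htgt : e.target ∈ 𝓝 (c T) := by
      rw [← hzc, ← e3]; exact e.open_target.mem_nhds (e.map_source e1)
    have hcT := hc T ⟨hT0, hT1⟩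
    have := hcT htgt
    rw [mem_map, Metric.mem_nhdsWithin_iff] at this
    obtain ⟨δ, hδ, hball⟩ := this
    obtain ⟨s, hsJ, hs1, hs2, γ, hγ, hγs⟩ := happ e.source (e.open_source.mem_nhds e1) δ hδ
    have hs0 : 0 ≤ s := hsJ.1.1
    -- new endpoint
    set T' := min 1 (T + δ / 2) with hT'
    have hT'1 : T' ≤ 1 := min_le_left _ _
    have hTT' : T ≤ T' := le_min hT1 (by linarith)
    have hctgt : ∀ t ∈ Icc s T', c t ∈ e.target := by
      intro t ht
      apply hball
      refine ⟨?_, hs0.trans ht.1, ht.2.trans hT'1⟩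
      rw [Metric.mem_ball, Real.dist_eq, abs_lt]
      have := ht.2.trans (min_le_right _ _)
      constructor <;> linarith [ht.1]
    let γ' : ℝ → ℂ := fun t => if t ≤ s then γ t else e.symm (c t)
    have hγ's : e.symm (c s) = γ s := by
      rw [← (hγ.2.2 s ⟨hs0, le_rfl⟩).2, ← e3, e.left_inv hγs]
    have hcont : ContinuousOn γ' (Icc 0 T') := by
      have hA : ContinuousOn (fun t => e.symm (c t)) (Icc s T') :=
        e.continuousOn_symm.comp (hc.mono (Icc_subset_Icc hs0 hT'1)) hctgt
      have hB : ContinuousOn γ' (Icc 0 s) := hγ.1.congr fun t ht => by simp [γ', ht.2]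
      have hC : ContinuousOn γ' (Icc s T') := hA.congr fun t ht => by
        simp only [γ']; split_ifs with h
        · have : t = s := le_antisymm h ht.1
          rw [this, hγ's]
        · rfl
      have := hB.union_of_isClosed hC isClosed_Icc isClosed_Icc
      rwa [Icc_union_Icc_eq_Icc hs0 (hs2.trans hTT')] at this
    have hQ : Q T' γ' := by
      refine ⟨hcont, ?_, ?_⟩
      · simp [γ', hs0, hγ.2.1]
      · intro t ht
        simp only [γ']; split_ifs with h
        · exact hγ.2.2 t ⟨ht.1, h⟩
        · push Not at h
          have h1 := hctgt t ⟨h.le, ht.2⟩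
          exact ⟨e2 (e.map_target h1), by rw [← e3, e.right_inv h1]⟩
    have hT'J : T' ∈ J := ⟨⟨hT0.trans hTT', hT'1⟩, γ', hQ⟩
    have hle : T' ≤ T := le_csSup Jbdd hT'J
    have : T' = 1 := by
      rcases min_choice 1 (T + δ / 2) with h | h
      · rw [hT', h]
      · rw [hT', h] at hle; linarith
    rw [this] at hle hT'J
    exact ⟨le_antisymm hT1 hle, hT'J⟩
  suffices h1 : (1:ℝ) ∈ J by
    obtain ⟨-, γ, h⟩ := h1
    exact ⟨γ, h⟩
  by_cases hTJ : T ∈ J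
  · obtain ⟨-, γ, hγ⟩ := id hTJ
    have := hγ.2.2 T ⟨hT0, le_rfl⟩
    refine (hext (γ T) this.1 this.2 ?_).2
    intro U hU δ hδ
    exact ⟨T, hTJ, by linarith, le_rfl, γ, hγ, mem_of_mem_nhds hU⟩
  have hlt : ∀ t, 0 ≤ t → t < T → t ∈ J := by
    intro t ht htT
    obtain ⟨s, hs, hts⟩ := exists_lt_of_lt_csSup ⟨0, J0⟩ htT
    exact Jdown s hs t ht hts.le
  have hTpos : 0 < T := lt_of_le_of_ne hT0 fun h => hTJ (h ▸ J0)
  choose! Γ hΓ using fun t (h : t ∈ J) => h.2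
  let γ : ℝ → ℂ := fun t => Γ t t
  have hγeq : ∀ s, 0 ≤ s → s < T → EqOn γ (Γ s) (Icc 0 s) := by
    intro s hs hsT t ht
    have hs' := hΓ s (hlt s hs hsT)
    have ht' := hΓ t (hlt t ht.1 (ht.2.trans_lt hsT))
    exact huniq t ht.1 _ _ ht' ⟨hs'.1.mono (Icc_subset_Icc_right ht.2), hs'.2.1,
      fun x hx => hs'.2.2 x ⟨hx.1, hx.2.trans ht.2⟩⟩ ⟨ht.1, le_rfl⟩
  have hQγ : ∀ s, 0 ≤ s → s < T → Q s γ := by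
    intro s hs hsT
    have hs' := hΓ s (hlt s hs hsT)
    have he := hγeq s hs hsT
    refine ⟨hs'.1.congr he, ?_, ?_⟩
    · rw [he ⟨le_rfl, hs⟩]; exact hs'.2.1
    · intro t ht; rw [he ht]; exact hs'.2.2 t ht
  have hcont : ContinuousOn γ (Ico 0 T) := by
    intro t ht
    have h1 := (hQγ ((t + T) / 2) (by linarith [ht.1]) (by linarith [ht.2])).1 t
      ⟨ht.1, by linarith [ht.2]⟩
    apply h1.mono_of_mem_nhdsWithin
    have : Ico 0 T ∩ Iio ((t + T) / 2) ⊆ Icc 0 ((t + T) / 2) := fun x hx => ⟨hx.1.1, hx.2.le⟩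
    exact mem_of_superset (inter_mem_nhdsWithin _ (Iio_mem_nhds (by linarith [ht.2]))) this
  have hval : ∀ t ∈ Ico 0 T, γ t ∈ regE f P S ∧ f (γ t) = c t := fun t ht =>
    (hQγ t ht.1 ht.2).2.2 t ⟨ht.1, le_rfl⟩
  have hmem : Ico 0 T ∈ 𝓝[<] T := Ico_mem_nhdsLT hTpos
  have hclim : Tendsto c (𝓝[<] T) (𝓝 (c T)) :=
    (hc T ⟨hT0, hT1⟩).mono_left (nhdsWithin_le_iff.2 (mem_of_superset hmem
      fun x hx => ⟨hx.1, hx.2.le.trans hT1⟩))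
  have hflim : Tendsto (fun t => f (γ t)) (𝓝[<] T) (𝓝 (c T)) := by
    refine hclim.congr' ?_
    filter_upwards [hmem] with t ht using (hval t ht).2.symm
  by_cases hinf : Tendsto (fun t => ‖γ t‖) (𝓝[<] T) atTop
  · exfalso
    have hr : Tendsto (fun s : ℝ => T * (1 - (1 + s)⁻¹)) atTop (𝓝[<] T) := by
      rw [tendsto_nhdsWithin_iff]
      constructor
      · have : Tendsto (fun s : ℝ => T * (1 - (1 + s)⁻¹)) atTop (𝓝 (T * (1 - 0))) :=
          (tendsto_const_nhds.sub (tendsto_inv_atTop_zero.comp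
            (tendsto_atTop_add_const_left atTop (1:ℝ) tendsto_id))).const_mul T
        simpa using this
      · filter_upwards [eventually_ge_atTop (0:ℝ)] with s hs
        have : 0 < (1 + s)⁻¹ := by positivity
        simp only [mem_Iio]; nlinarith
    have hrm : ∀ s : ℝ, 0 ≤ s → T * (1 - (1 + s)⁻¹) ∈ Ico 0 T := by
      intro s hs
      have h1 : 0 < (1 + s)⁻¹ := by positivity
      have h2 : (1 + s)⁻¹ ≤ 1 := inv_le_one_of_one_le₀ (by linarith)
      constructor <;> nlinarith
    refine hcS T ⟨hT0, hT1⟩ (L.asy (fun s => γ (T * (1 - (1 + s)⁻¹))) (c T) ?_ (hinf.comp hr) ?_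
      (hflim.comp hr))
    · apply hcont.comp _ (fun s hs => hrm s hs)
      apply ContinuousOn.mul continuousOn_const
      apply continuousOn_const.sub
      apply ContinuousOn.inv₀ (by fun_prop)
      intro s hs
      have : (0:ℝ) ≤ s := hs
      positivity
    · intro s hs; exact (hval _ (hrm s hs)).1.1
  · obtain ⟨R, hR⟩ : ∃ R, ∃ᶠ t in 𝓝[<] T, γ t ∈ Metric.closedBall (0:ℂ) R := by
      rw [tendsto_atTop] at hinf
      push Not at hinf
      obtain ⟨R, hR⟩ := hinf
      refine ⟨R, hR.mono fun t ht => ?_⟩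
      simpa using ht.le
    obtain ⟨z, -, hzc⟩ := (isCompact_closedBall (0:ℂ) R).exists_mapClusterPt_of_frequently hR
    have hzP : z ∉ P := by
      intro hzP
      have h1 : ∀ᶠ x in 𝓝 z, x ≠ z → ‖c T‖ + 1 < ‖f x‖ :=
        eventually_nhdsWithin_iff.1 ((L.pole z hzP).eventually_gt_atTop _)
      have h2 : ∀ᶠ t in 𝓝[<] T, ‖f (γ t)‖ < ‖c T‖ + 1 :=
        hflim.norm.eventually (gt_mem_nhds (by linarith))
      obtain ⟨t, ht1, ht2, ht3⟩ := ((hzc.frequently h1).and_eventually (h2.and hmem)).exists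
      have := ht1 (fun h => (hval t ht3).1.1 (h ▸ hzP))
      linarith
    have hfz : f z = c T := by
      have h1 : MapClusterPt (f z) (𝓝[<] T) (fun t => f (γ t)) :=
        hzc.continuousAt_comp (L.an z hzP).continuousAt
      exact (hflim.mono_left le_rfl |> fun h => by
        by_contra hne
        obtain ⟨u, v, hu, hv, huz, hvc, hd⟩ := t2_separation hne
        obtain ⟨t, ht, ht'⟩ := ((h1.frequently (hu.mem_nhds huz)).and_eventually
          (h (hv.mem_nhds hvc))).exists
        exact (Set.disjoint_left.1 hd) ht ht')
    refine (hext z ⟨hzP, hfz ▸ hcS T ⟨hT0, hT1⟩⟩ hfz ?_).2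
    intro U hU δ hδ
    have hm2 : Ioo (T - δ) T ∈ 𝓝[<] T := Ioo_mem_nhdsLT (by linarith)
    obtain ⟨t, ht1, ht2, ht3⟩ := ((hzc.frequently hU).and_eventually
      ((eventually_mem_set.2 hmem).and (eventually_mem_set.2 hm2))).exists
    exact ⟨t, hlt t ht2.1 ht2.2, ht3.1, ht3.2.le, γ, hQγ t ht2.1 ht2.2, ht1⟩

/-- lifting of a holomorphic map on a convex domain -/
theorem LiftData.lift (L : LiftData f P S) {Ω : Set ℂ} (hΩ : Convex ℝ Ω) (hΩo : IsOpen Ω)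
    {h : ℂ → ℂ} (hh : DifferentiableOn ℂ h Ω) (hS : ∀ w ∈ Ω, h w ∉ S) {w₀ z₀ : ℂ} (hw₀ : w₀ ∈ Ω)
    (hz₀ : z₀ ∉ P) (h0 : f z₀ = h w₀) :
    ∃ φ : ℂ → ℂ, DifferentiableOn ℂ φ Ω ∧ φ w₀ = z₀ ∧
      ∀ w ∈ Ω, φ w ∈ regE f P S ∧ f (φ w) = h w := by
  have hseg : ∀ w ∈ Ω, ∀ t ∈ Icc (0:ℝ) 1, w₀ + t * (w - w₀) ∈ Ω := by
    intro w hw t ht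
    have := hΩ.add_smul_sub_mem hw₀ hw ht
    simpa using this
  have hcont : ∀ w ∈ Ω, ContinuousOn (fun t : ℝ => h (w₀ + t * (w - w₀))) (Icc 0 1) := by
    intro w hw
    exact hh.continuousOn.comp (by fun_prop) (fun t ht => hseg w hw t ht)
  have hex : ∀ w ∈ Ω, ∃ γ : ℝ → ℂ, ContinuousOn γ (Icc 0 1) ∧ γ 0 = z₀ ∧
      ∀ t ∈ Icc (0:ℝ) 1, γ t ∈ regE f P S ∧ f (γ t) = h (w₀ + t * (w - w₀)) := by
    intro w hw
    exact L.path (hcont w hw) (fun t ht => hS _ (hseg w hw t ht)) hz₀ (by simpa using h0)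
  choose! Γ g1 g2 g3 using hex
  let G : unitInterval × Ω → regE f P S := fun x => ⟨Γ x.2 x.1, (g3 x.2 x.2.2 x.1 x.1.2).1⟩
  let F : C(unitInterval × Ω, ℂ) := ⟨fun x => h (w₀ + (x.1 : ℝ) * (x.2 - w₀)),
    hh.continuousOn.comp_continuous (by fun_prop) (fun x => hseg x.2 x.2.2 x.1 x.1.2)⟩
  have hGc : Continuous G := by
    refine L.locHomeo.continuous_lift (T2Space.isSeparatedMap _) F (g := G) ?_ ?_ ?_
    · funext x; exact (g3 x.2 x.2.2 x.1 x.1.2).2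
    · have : (fun a : Ω => G (0, a)) = fun _ => ⟨z₀, hz₀, h0 ▸ hS w₀ hw₀⟩ := by
        funext a; exact Subtype.ext (g2 a a.2)
      rw [this]; exact continuous_const
    · intro a
      apply Continuous.subtype_mk
      exact (g1 a a.2).comp_continuous continuous_subtype_val (fun t => t.2)
  have hφc : ContinuousOn (fun w => Γ w 1) Ω := by
    rw [continuousOn_iff_continuous_domRestrict]
    have : Continuous fun a : Ω => (G (1, a) : ℂ) := by fun_prop
    exact this
  have h1 : (1:ℝ) ∈ Icc (0:ℝ) 1 := by simp
  have hval : ∀ w ∈ Ω, Γ w 1 ∈ regE f P S ∧ f (Γ w 1) = h w := by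
    intro w hw
    have := g3 w hw 1 h1
    simpa using this
  refine ⟨fun w => Γ w 1, ?_, ?_, hval⟩
  · intro w hw
    obtain ⟨e, e1, e2, e3⟩ := L.locinv (hval w hw).1
    have hc : ContinuousAt (fun w => Γ w 1) w := hφc.continuousAt (hΩo.mem_nhds hw)
    have hev : (fun w => Γ w 1) =ᶠ[𝓝 w] fun w => e.symm (h w) := by
      filter_upwards [hc.eventually (e.open_source.mem_nhds e1), hΩo.mem_nhds hw] with x hx hxΩ
      rw [← (hval x hxΩ).2, ← e3, e.left_inv hx]
    have hde : HasDerivAt e (deriv f (Γ w 1)) (Γ w 1) := by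
      have : (e : ℂ → ℂ) = f := funext e3
      rw [this]; exact (L.an _ (hval w hw).1.1).differentiableAt.hasDerivAt
    have hev1 : e.symm (h w) = Γ w 1 := hev.eq_of_nhds.symm
    have htg : h w ∈ e.target := by
      rw [← (hval w hw).2, ← e3]; exact e.map_source e1
    have hds := e.hasDerivAt_symm htg (L.deriv_ne (hval w hw).1) (by rw [hev1]; exact hde)
    exact ((hds.comp w (hh.differentiableAt (hΩo.mem_nhds hw)).hasDerivAt).congr_of_eventuallyEq
      hev).differentiableAt.differentiableWithinAt
  · have e1 := L.uniq (K := Icc (0:ℝ) 1) isPreconnected_Icc (g1 w₀ hw₀) (continuousOn_const (c := z₀))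
      (fun t ht => (g3 w₀ hw₀ t ht).1) (fun t ht => ⟨hz₀, h0 ▸ hS w₀ hw₀⟩)
      (fun t ht => by rw [(g3 w₀ hw₀ t ht).2, h0]; simp) (x₀ := 0) (by simp) (g2 w₀ hw₀)
    exact e1 h1

end PartC

section PartE1

lemma wv_max {A : ℂ → ℂ} {R : ℝ} (hR : 1 ≤ R) (hA : ∀ z, R ≤ ‖z‖ → AnalyticAt ℂ A z)
    (hnp : ¬ ∃ (K : ℕ) (C : ℝ), ∀ z, R ≤ ‖z‖ → ‖A z‖ ≤ C * ‖z‖ ^ K) (K : ℕ) (hK : K ≠ 0)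
    {δ : ℝ} (hδ : 0 < δ) (T0 : ℝ) (hT0 : Real.log R ≤ T0) :
    ∃ T z', T0 ≤ T ∧ R ≤ ‖z'‖ ∧ Real.log ‖z'‖ ≤ T ∧ T - Real.log ‖z'‖ < δ ∧
      ∀ z, R ≤ ‖z‖ → Real.log ‖z‖ ≤ T →
        ‖A z‖ * (T - Real.log ‖z‖) ^ K ≤ ‖A z'‖ * (T - Real.log ‖z'‖) ^ K := by
  have hmax : ∀ T, T0 ≤ T → ∃ z', R ≤ ‖z'‖ ∧ Real.log ‖z'‖ ≤ T ∧
      ∀ z, R ≤ ‖z‖ → Real.log ‖z‖ ≤ T →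
        ‖A z‖ * (T - Real.log ‖z‖) ^ K ≤ ‖A z'‖ * (T - Real.log ‖z'‖) ^ K := by
    intro T hT
    let s : Set ℂ := {z | R ≤ ‖z‖} ∩ Metric.closedBall 0 (Real.exp T)
    have hs : IsCompact s := (isCompact_closedBall _ _).inter_left
      (isClosed_le continuous_const continuous_norm)
    have hmem : ∀ z, z ∈ s ↔ R ≤ ‖z‖ ∧ Real.log ‖z‖ ≤ T := by
      intro z
      simp only [s, mem_inter_iff, mem_ofPred_eq, Metric.mem_closedBall, dist_zero_right]
      constructor
      · rintro ⟨h1, h2⟩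
        exact ⟨h1, (Real.log_le_iff_le_exp (by linarith)).2 h2⟩
      · rintro ⟨h1, h2⟩
        exact ⟨h1, (Real.log_le_iff_le_exp (by linarith)).1 h2⟩
    have hne : s.Nonempty := by
      refine ⟨(R : ℂ), (hmem _).2 ?_⟩
      have : ‖(R:ℂ)‖ = R := by simp; linarith
      rw [this]; exact ⟨le_rfl, hT0.trans hT⟩
    have hc : ContinuousOn (fun z : ℂ => ‖A z‖ * (T - Real.log ‖z‖) ^ K) s := by
      intro z hz
      have h1 := ((hmem z).1 hz).1
      apply ContinuousAt.continuousWithinAt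
      refine (hA z h1).continuousAt.norm.mul ((continuousAt_const.sub ?_).pow K)
      exact continuous_norm.continuousAt.log (by intro h; linarith)
    obtain ⟨z', hz', h'⟩ := hs.exists_isMaxOn hne hc
    exact ⟨z', ((hmem _).1 hz').1, ((hmem _).1 hz').2, fun z h1 h2 => h' ((hmem z).2 ⟨h1, h2⟩)⟩
  by_contra hcon
  push Not at hcon
  have hfar : ∀ T, T0 ≤ T → ∃ z', R ≤ ‖z'‖ ∧ Real.log ‖z'‖ ≤ T - δ ∧
      ∀ z, R ≤ ‖z‖ → Real.log ‖z‖ ≤ T →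
        ‖A z‖ * (T - Real.log ‖z‖) ^ K ≤ ‖A z'‖ * (T - Real.log ‖z'‖) ^ K := by
    intro T hT
    obtain ⟨z', h1, h2, h3⟩ := hmax T hT
    refine ⟨z', h1, ?_, h3⟩
    by_contra h4
    obtain ⟨z, h5, h6, h7⟩ := hcon T z' hT h1 h2 (by linarith)
    exact absurd (h3 z h5 h6) (not_le.2 h7)
  obtain ⟨z0, h01, h02, h03⟩ := hmax T0 le_rfl
  set V := ‖A z0‖ * (T0 - Real.log ‖z0‖) ^ K with hV
  have hV0 : 0 ≤ V := mul_nonneg (norm_nonneg _) (pow_nonneg (by linarith) _)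
  have hind : ∀ j : ℕ, ∀ z, R ≤ ‖z‖ → Real.log ‖z‖ ≤ T0 + j * (δ / 2) →
      ‖A z‖ * (T0 + j * (δ / 2) - Real.log ‖z‖) ^ K ≤ (2 ^ K) ^ j * V := by
    intro j
    induction j with
    | zero => intro z h1 h2; simpa using h03 z h1 (by simpa using h2)
    | succ j ih =>
      intro z h1 h2
      obtain ⟨z', h3, h4, h5⟩ := hfar (T0 + (j + 1 : ℕ) * (δ / 2)) (by
        have : (0:ℝ) ≤ ((j + 1 : ℕ) : ℝ) * (δ / 2) := by positivity
        linarith)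
      push_cast at *
      refine (h5 z h1 h2).trans ?_
      have h6 := ih z' h3 (by linarith)
      have h7 : (T0 + (j + 1) * (δ / 2) - Real.log ‖z'‖) ^ K ≤
          (2 * (T0 + j * (δ / 2) - Real.log ‖z'‖)) ^ K := by
        apply pow_le_pow_left₀ <;> linarith
      calc _ ≤ ‖A z'‖ * (2 * (T0 + j * (δ / 2) - Real.log ‖z'‖)) ^ K := by gcongr
        _ = 2 ^ K * (‖A z'‖ * (T0 + j * (δ / 2) - Real.log ‖z'‖) ^ K) := by
          rw [mul_pow]; ring
        _ ≤ 2 ^ K * ((2 ^ K) ^ j * V) := by gcongr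
        _ = _ := by rw [pow_succ]; ring
  apply hnp
  obtain ⟨K', hK'⟩ := exists_nat_ge (K * Real.log 2 * (2 / δ))
  -- j with T0 + jη ≥ log|z|+1
  refine ⟨K', Real.exp (K * Real.log 2 * ((1 + |T0|) * (2 / δ) + 1)) * V, fun z hz => ?_⟩
  have hz0 : 0 < ‖z‖ := by linarith
  have hl : 0 ≤ Real.log ‖z‖ := Real.log_nonneg (by linarith)
  set j := ⌈(Real.log ‖z‖ + (1 + |T0|)) * (2 / δ)⌉₊ with hj
  have hj1 : (Real.log ‖z‖ + (1 + |T0|)) * (2 / δ) ≤ j := Nat.le_ceil _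
  have hj2 : (j : ℝ) < (Real.log ‖z‖ + (1 + |T0|)) * (2 / δ) + 1 :=
    Nat.ceil_lt_add_one (by positivity)
  have hj3 : Real.log ‖z‖ + (1 + |T0|) ≤ j * (δ / 2) := by
    have : (Real.log ‖z‖ + (1 + |T0|)) = (Real.log ‖z‖ + (1 + |T0|)) * (2 / δ) * (δ / 2) := by
      field_simp
    rw [this]; gcongr
  have hj4 : Real.log ‖z‖ + 1 ≤ T0 + j * (δ / 2) := by linarith [neg_abs_le T0]
  have h1 := hind j z hz (by linarith)
  have h2 : ‖A z‖ ≤ ‖A z‖ * (T0 + j * (δ / 2) - Real.log ‖z‖) ^ K :=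
    le_mul_of_one_le_right (norm_nonneg _) (one_le_pow₀ (by linarith))
  refine (h2.trans h1).trans ?_
  have h3 : ((2:ℝ) ^ K) ^ j = Real.exp (K * Real.log 2 * j) := by
    rw [← pow_mul, mul_comm (K:ℝ), mul_assoc, Real.exp_mul, Real.exp_log two_pos,
      ← Nat.cast_mul, Real.rpow_natCast]
  have h4 : ‖z‖ ^ K' = Real.exp (Real.log ‖z‖ * K') := by
    rw [Real.exp_mul, Real.exp_log hz0, Real.rpow_natCast]
  have hl2 : 0 ≤ Real.log 2 := Real.log_nonneg (by norm_num)
  rw [h3, h4]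
  rw [mul_right_comm (Real.exp _) V, ← Real.exp_add]
  gcongr
  calc K * Real.log 2 * j ≤ K * Real.log 2 * ((Real.log ‖z‖ + (1 + |T0|)) * (2 / δ) + 1) := by
        gcongr
    _ = K * Real.log 2 * ((1 + |T0|) * (2 / δ) + 1) + Real.log ‖z‖ * (K * Real.log 2 * (2 / δ)) := by
        ring
    _ ≤ _ := by gcongr

/-- the elementary growth inequality -/
lemma wv_elem {K M d : ℝ} (hM : 1 ≤ M) (hd : 0 < d) (hd1 : d ≤ 1) (hK : 8 * M ^ 2 ≤ K) {ζ : ℂ}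
    (hζ : ‖ζ‖ ≤ M) :
    0 < ‖1 + (d / K : ℝ) * ζ‖ ∧ Real.log ‖1 + (d / K : ℝ) * ζ‖ ≤ d / 2 ∧
    (-K) * Real.log (1 - Real.log ‖1 + (d / K : ℝ) * ζ‖ / d) ≤ ζ.re + 16 * M ^ 2 / K := by
  have hK0 : 0 < K := by nlinarith
  have hdK : 0 < d / K := by positivity
  have hdK1 : d / K ≤ 1 / K := by gcongr
  have hMK : M / K ≤ 1 / 8 := by
    rw [div_le_div_iff₀ hK0 (by norm_num)]; nlinarith
  have hn : ‖((d / K : ℝ) : ℂ) * ζ‖ ≤ 1 / 8 := by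
    rw [norm_mul, Complex.norm_real, Real.norm_of_nonneg hdK.le]
    calc d / K * ‖ζ‖ ≤ 1 / K * M := by gcongr
      _ = M / K := by ring
      _ ≤ _ := hMK
  set v := ((d / K : ℝ) : ℂ) * ζ with hv
  have hpos : 0 < ‖1 + v‖ := by
    have := norm_sub_norm_le (1:ℂ) (-v)
    rw [norm_neg, sub_neg_eq_add, norm_one] at this
    linarith
  have hlog : Real.log ‖1 + v‖ ≤ v.re + ‖v‖ ^ 2 / 2 := by
    have h1 : ‖1 + v‖ ^ 2 = 1 + 2 * v.re + ‖v‖ ^ 2 := by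
      rw [Complex.sq_norm, Complex.sq_norm, Complex.normSq_apply, Complex.normSq_apply]
      simp; ring
    have h2 := Real.log_le_sub_one_of_pos (x := ‖1 + v‖ ^ 2) (by positivity)
    rw [Real.log_pow] at h2
    push_cast at h2
    linarith
  have hvre : v.re = d / K * ζ.re := by
    rw [hv, Complex.re_ofReal_mul]
  have hvn : ‖v‖ = d / K * ‖ζ‖ := by
    rw [hv, norm_mul, Complex.norm_real, Real.norm_of_nonneg hdK.le]
  have hre : ζ.re ≤ M := (Complex.re_le_norm _).trans hζ
  set t := Real.log ‖1 + v‖ with ht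
  -- s = K t / d
  have hs : t / d ≤ (ζ.re + M ^ 2 / (2 * K)) / K := by
    rw [div_le_iff₀ hd]
    have : ‖v‖ ^ 2 / 2 ≤ (M ^ 2 / (2 * K)) / K * d := by
      rw [hvn]
      calc (d / K * ‖ζ‖) ^ 2 / 2 ≤ (d / K * M) ^ 2 / 2 := by gcongr
        _ = d * (d * (M ^ 2 / (2 * K)) / K) := by field_simp
        _ ≤ d * (1 * (M ^ 2 / (2 * K)) / K) := by gcongr
        _ = _ := by ring
    calc t ≤ d / K * ζ.re + ‖v‖ ^ 2 / 2 := by linarith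
      _ ≤ d / K * ζ.re + (M ^ 2 / (2 * K)) / K * d := by linarith
      _ = _ := by ring
  set X := (ζ.re + M ^ 2 / (2 * K)) / K with hX
  have hq : M ^ 2 / (2 * K) ≤ 1 / 16 := by
    rw [div_le_div_iff₀ (by positivity) (by norm_num)]; linarith
  have hXu : |X| ≤ 2 * M / K := by
    rw [hX, abs_div, abs_of_pos hK0]
    gcongr
    have := abs_le.1 ((Complex.abs_re_le_norm ζ).trans hζ)
    have h0 : 0 ≤ M ^ 2 / (2 * K) := by positivity
    rw [abs_le]; constructor <;> linarith
  have hXh : |X| ≤ 1 / 4 := hXu.trans (by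
    have : 2 * M / K = 2 * (M / K) := by ring
    rw [this]; linarith)
  obtain ⟨hX1, hX2⟩ := abs_le.1 hXh
  refine ⟨hpos, ?_, ?_⟩
  · have : t / d ≤ 1 / 2 := by linarith
    rw [div_le_iff₀ hd] at this; linarith
  have hlog2 : Real.log (1 - X) ≤ Real.log (1 - t / d) :=
    Real.log_le_log (by linarith) (by linarith)
  have hlog3 : -Real.log (1 - X) ≤ X + 2 * X ^ 2 := by
    have h := Real.one_sub_inv_le_log_of_pos (x := 1 - X) (by linarith)
    have h2 : (1 - X)⁻¹ - 1 ≤ X + 2 * X ^ 2 := by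
      rw [sub_le_iff_le_add, inv_le_iff_one_le_mul₀ (by linarith)]
      nlinarith [sq_nonneg X]
    linarith
  have hX3 : X ^ 2 ≤ (2 * M / K) ^ 2 := by
    rw [← sq_abs X]; gcongr
  calc -K * Real.log (1 - t / d) ≤ K * (X + 2 * X ^ 2) := by nlinarith
    _ ≤ K * (X + 2 * (2 * M / K) ^ 2) := by gcongr
    _ = ζ.re + M ^ 2 / (2 * K) + 8 * M ^ 2 / K := by rw [hX]; field_simp; ring
    _ ≤ ζ.re + 8 * M ^ 2 / K + 8 * M ^ 2 / K := by
      have : M ^ 2 / (2 * K) ≤ 8 * M ^ 2 / K := by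
        rw [div_le_div_iff₀ (by positivity) (by positivity)]; nlinarith [sq_nonneg M, mul_nonneg (sq_nonneg M) hK0.le]
      linarith
    _ = _ := by ring

theorem wv {A : ℂ → ℂ} {R : ℝ} (hR : 1 ≤ R) (hA : ∀ z, R ≤ ‖z‖ → AnalyticAt ℂ A z)
    (hnp : ¬ ∃ (K : ℕ) (C : ℝ), ∀ z, R ≤ ‖z‖ → ‖A z‖ ≤ C * ‖z‖ ^ K) (M ε Λ R' : ℝ) (hε : 0 < ε) :
    ∃ (z0 ρ : ℂ) (l : ℝ), ρ ≠ 0 ∧ Λ ≤ l ∧ 0 < l ∧ ∀ ζ : ℂ, ‖ζ‖ ≤ M → R' < ‖z0 + ρ * ζ‖ ∧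
      ‖ρ ^ 2 * A (z0 + ρ * ζ) - l ^ 2 * Complex.exp ζ‖ ≤ ε * (l ^ 2 * ‖Complex.exp ζ‖) := by
  obtain ⟨z1, hz1, hAz1⟩ : ∃ z1, R ≤ ‖z1‖ ∧ A z1 ≠ 0 := by
    by_contra h
    push Not at h
    exact hnp ⟨0, 0, fun z hz => by simp [h z hz]⟩
  set M1 := |M| + 4 with hM1
  have hM1' : 4 ≤ M1 := by have := abs_nonneg M; linarith
  obtain ⟨K, hK⟩ := exists_nat_ge (max (8 * (2 * M1) ^ 2) (16 * (2 * M1) ^ 2 / Real.log (1 + ε / 4)))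
  have hlpos : 0 < Real.log (1 + ε / 4) := Real.log_pos (by linarith)
  have hK1 : 8 * (2 * M1) ^ 2 ≤ K := (le_max_left _ _).trans hK
  have hK0 : (2:ℝ) ≤ K := by nlinarith
  have hK0' : (0:ℝ) < K := by linarith
  have hK2 : 16 * (2 * M1) ^ 2 / K ≤ Real.log (1 + ε / 4) := by
    have := (le_max_right _ _).trans hK
    rw [div_le_iff₀ hlpos] at this
    rw [div_le_iff₀ hK0']; linarith
  have hKn : 2 ≤ K := by exact_mod_cast hK0
  set Q := max (2 * R) (max (2 * |R'| + 1) (K * (|Λ| + 1) / Real.sqrt ‖A z1‖)) with hQ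
  have hQ1 : 2 * R ≤ Q := le_max_left _ _
  have hQ2 : 2 * |R'| + 1 ≤ Q := (le_max_left _ _).trans (le_max_right _ _)
  have hQ3 : K * (|Λ| + 1) / Real.sqrt ‖A z1‖ ≤ Q := (le_max_right _ _).trans (le_max_right _ _)
  have hQ0 : 0 < Q := by linarith
  obtain ⟨T, z', hT, hz', hTz, hd1, hmx⟩ := wv_max hR hA hnp K (by omega) one_pos
    (max (Real.log R) (max (Real.log ‖z1‖ + 1) (Real.log Q + 1))) (le_max_left _ _)
  have hT1 : Real.log ‖z1‖ + 1 ≤ T :=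
    ((le_max_left _ _).trans (le_max_right _ _)).trans hT
  have hT2 : Real.log Q + 1 ≤ T :=
    ((le_max_right _ _).trans (le_max_right _ _)).trans hT
  have hz0 : 0 < ‖z'‖ := by linarith
  have hzQ : Q ≤ ‖z'‖ := by
    rw [← Real.log_le_log_iff hQ0 hz0]; linarith
  set d := T - Real.log ‖z'‖ with hd
  have hV : ‖A z1‖ ≤ ‖A z'‖ * d ^ K :=
    (le_mul_of_one_le_right (norm_nonneg _) (one_le_pow₀ (by linarith))).trans
      (hmx z1 hz1 (by linarith))
  have hA1 : 0 < ‖A z1‖ := norm_pos_iff.2 hAz1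
  have hd0 : 0 < d := by
    rcases (show 0 ≤ d by linarith).eq_or_lt with h | h
    · rw [← h, zero_pow (by omega), mul_zero] at hV; linarith
    · exact h
  have hA' : 0 < ‖A z'‖ := by
    by_contra h
    have : ‖A z'‖ = 0 := le_antisymm (not_lt.1 h) (norm_nonneg _)
    rw [this, zero_mul] at hV; linarith
  set ρ : ℂ := z' * (d / K : ℝ) with hρ
  have hρn : ‖ρ‖ = ‖z'‖ * (d / K) := by
    rw [hρ, norm_mul, Complex.norm_real, Real.norm_of_nonneg (by positivity)]
  have hρ0 : ρ ≠ 0 := by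
    rw [← norm_pos_iff, hρn]; positivity
  have hpt : ∀ ζ : ℂ, z' + ρ * ζ = z' * (1 + (d / K : ℝ) * ζ) := by
    intro ζ; rw [hρ]; ring
  have hbd : ∀ ζ : ℂ, ‖ζ‖ ≤ 2 * M1 → ‖z'‖ / 2 ≤ ‖z' + ρ * ζ‖ ∧
      ‖A (z' + ρ * ζ)‖ ≤ ‖A z'‖ * ((1 + ε / 4) * ‖Complex.exp ζ‖) := by
    intro ζ hζ
    obtain ⟨e1, e2, e3⟩ := wv_elem (K := K) (M := 2 * M1) (by linarith) hd0 hd1.le hK1 hζ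
    have hlow : ‖z'‖ / 2 ≤ ‖z' + ρ * ζ‖ := by
      rw [hpt, norm_mul]
      have h1 : ‖((d / K : ℝ) : ℂ) * ζ‖ ≤ 1 / 2 := by
        rw [norm_mul, Complex.norm_real, Real.norm_of_nonneg (by positivity)]
        calc d / K * ‖ζ‖ ≤ 1 / K * (2 * M1) := by gcongr
          _ = 2 * M1 / K := by ring
          _ ≤ 1 / 2 := by rw [div_le_div_iff₀ hK0' two_pos]; nlinarith
      have h2 := norm_sub_norm_le (1:ℂ) (-(((d / K : ℝ) : ℂ) * ζ))
      rw [norm_neg, sub_neg_eq_add, norm_one] at h2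
      nlinarith
    refine ⟨hlow, ?_⟩
    have hlogz : Real.log ‖z' + ρ * ζ‖ = Real.log ‖z'‖ + Real.log ‖1 + (d / K : ℝ) * ζ‖ := by
      rw [hpt, norm_mul, Real.log_mul hz0.ne' e1.ne']
    have h1 := hmx (z' + ρ * ζ) (by linarith) (by rw [hlogz]; linarith)
    set t := Real.log ‖1 + (d / K : ℝ) * ζ‖ with ht
    have h2 : T - Real.log ‖z' + ρ * ζ‖ = d * (1 - t / d) := by
      rw [hlogz]; field_simp; ring
    have h3 : 0 < 1 - t / d := by
      have : t / d ≤ 1 / 2 := by rw [div_le_iff₀ hd0]; linarith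
      linarith
    rw [h2, mul_pow, mul_comm (d ^ K), ← mul_assoc] at h1
    have h4 : ‖A (z' + ρ * ζ)‖ * (1 - t / d) ^ K ≤ ‖A z'‖ :=
      le_of_mul_le_mul_right h1 (by positivity)
    have h5 : Real.exp (-K * Real.log (1 - t / d)) * (1 - t / d) ^ K = 1 := by
      rw [← Real.rpow_natCast, Real.rpow_def_of_pos h3, ← Real.exp_add]
      simp; ring
    have h6 : ‖A (z' + ρ * ζ)‖ ≤ ‖A z'‖ * Real.exp (-K * Real.log (1 - t / d)) := by
      have : ‖A (z' + ρ * ζ)‖ = ‖A (z' + ρ * ζ)‖ * (1 - t / d) ^ K *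
          Real.exp (-K * Real.log (1 - t / d)) := by
        linear_combination (-‖A (z' + ρ * ζ)‖) * h5
      rw [this]; gcongr
    refine h6.trans ?_
    gcongr
    calc _ ≤ Real.exp (ζ.re + Real.log (1 + ε / 4)) := by
          apply Real.exp_le_exp.2; linarith
      _ = _ := by rw [Real.exp_add, Real.exp_log (by linarith), Complex.norm_exp]; ring
  have hAz'0 : A z' ≠ 0 := norm_pos_iff.1 hA'
  have hkey : ∀ ζ : ℂ, ‖ζ‖ ≤ M1 → ‖A (z' + ρ * ζ) / A z' * Complex.exp (-ζ) - 1‖ ≤ ε / 2 := by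
    intro ζ hζ
    have hB := Complex.borelCaratheodory_zero (M := ε / 4) (R := 2 * M1)
      (f := fun ζ : ℂ => A (z' + ρ * ζ) / A z' * Complex.exp (-ζ) - 1) (z := ζ) (by linarith)
      ?_ ?_ (by linarith) ?_ ?_
    · refine hB.trans ?_
      rw [div_le_iff₀ (by linarith)]
      nlinarith
    · intro x hx
      have hx' : ‖x‖ ≤ 2 * M1 := by simpa using (mem_ball_zero_iff.1 hx).le
      have h1 : DifferentiableAt ℂ A (z' + ρ * x) :=
        (hA _ (by linarith [(hbd x hx').1])).differentiableAt
      have h2 : DifferentiableAt ℂ (fun ζ : ℂ => A (z' + ρ * ζ)) x :=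
        h1.comp x (f := fun ζ : ℂ => z' + ρ * ζ) (by fun_prop)
      exact (((h2.div_const _).mul (by fun_prop)).sub_const _).differentiableWithinAt
    · intro x hx
      have hx' : ‖x‖ ≤ 2 * M1 := by simpa using (mem_ball_zero_iff.1 hx).le
      have h1 : ‖A (z' + ρ * x) / A z' * Complex.exp (-x)‖ ≤ 1 + ε / 4 := by
        rw [norm_mul, norm_div, Complex.exp_neg, norm_inv]
        have h3 : 0 < ‖Complex.exp x‖ := by simp
        rw [← div_eq_mul_inv, div_div, div_le_iff₀ (by positivity)]
        calc _ ≤ _ := (hbd x hx').2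
          _ = _ := by ring
      have h2 := (Complex.re_le_norm _).trans h1
      simp only [mem_ofPred_eq, Complex.sub_re, Complex.one_re]
      linarith
    · simpa using (by linarith : ‖ζ‖ < 2 * M1)
    · simp [hAz'0]
  set θ := Complex.arg (ρ ^ 2 * A z') with hθ
  set l := Real.sqrt ‖ρ ^ 2 * A z'‖ with hl
  have hl2 : l ^ 2 = ‖ρ ^ 2 * A z'‖ := Real.sq_sqrt (norm_nonneg _)
  have hl0 : 0 < l := Real.sqrt_pos.2 (norm_pos_iff.2 (mul_ne_zero (pow_ne_zero _ hρ0) hAz'0))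
  refine ⟨z' + ρ * (-(θ * Complex.I)), ρ, l, hρ0, ?_, hl0, ?_⟩
  · have h1 : |Λ| + 1 ≤ l := by
      apply Real.le_sqrt_of_sq_le
      rw [norm_mul, norm_pow, hρn]
      have h2 : ‖A z1‖ ≤ ‖A z'‖ * d ^ 2 := hV.trans (mul_le_mul_of_nonneg_left
        (pow_le_pow_of_le_one hd0.le hd1.le hKn) (norm_nonneg _))
      have h3 : K * (|Λ| + 1) ≤ ‖z'‖ * Real.sqrt ‖A z1‖ := by
        have := hQ3.trans hzQ
        rwa [div_le_iff₀ (Real.sqrt_pos.2 hA1)] at this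
      have h4 : (K * (|Λ| + 1)) ^ 2 ≤ ‖z'‖ ^ 2 * ‖A z1‖ := by
        have := pow_le_pow_left₀ (by positivity) h3 2
        rwa [mul_pow ‖z'‖, Real.sq_sqrt (norm_nonneg _)] at this
      have h5 : (K * (|Λ| + 1)) ^ 2 ≤ ‖z'‖ ^ 2 * (‖A z'‖ * d ^ 2) := h4.trans (by gcongr)
      have h6 : (‖z'‖ * (d / K)) ^ 2 * ‖A z'‖ = ‖z'‖ ^ 2 * (‖A z'‖ * d ^ 2) / K ^ 2 := by
        field_simp
      rw [h6, le_div_iff₀ (by positivity)]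
      linarith [mul_pow (K:ℝ) (|Λ| + 1) 2, mul_comm ((|Λ| + 1) ^ 2) ((K:ℝ) ^ 2)]
    linarith [le_abs_self Λ]
  · intro ζ hζ
    set ζ' := ζ - θ * Complex.I with hζ'
    have hth : |θ| ≤ Real.pi := Complex.abs_arg_le_pi _
    have hn : ‖ζ'‖ ≤ M1 := by
      have h1 := norm_sub_le ζ (θ * Complex.I)
      have h2 : ‖(θ:ℂ) * Complex.I‖ = |θ| := by simp
      rw [h2] at h1
      have := Real.pi_lt_four
      have := le_abs_self M
      linarith
    have hp : z' + ρ * (-(θ * Complex.I)) + ρ * ζ = z' + ρ * ζ' := by rw [hζ']; ring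
    rw [hp]
    refine ⟨?_, ?_⟩
    · have := (hbd ζ' (by linarith)).1
      have := le_abs_self R'
      linarith
    · have h1 := hkey ζ' hn
      have h2 : (l:ℂ) ^ 2 * Complex.exp ζ = ρ ^ 2 * A z' * Complex.exp ζ' := by
        rw [← Complex.norm_mul_exp_arg_mul_I (ρ ^ 2 * A z'), ← hθ, ← hl2, mul_assoc,
          ← Complex.exp_add]
        congr 2
        · push_cast; ring
        · rw [hζ']; ring_nf
      have h3 : ρ ^ 2 * A (z' + ρ * ζ') - l ^ 2 * Complex.exp ζ =
          (l ^ 2 * Complex.exp ζ) * (A (z' + ρ * ζ') / A z' * Complex.exp (-ζ') - 1) := by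
        rw [h2, Complex.exp_neg]
        field_simp [Complex.exp_ne_zero]
      rw [h3, norm_mul, norm_mul]
      have h4 : ‖(l:ℂ) ^ 2‖ = l ^ 2 := by simp
      rw [h4, mul_comm]
      gcongr
      linarith

end PartE1

section PartF

lemma entire_poly {g : ℂ → ℂ} (hg : Differentiable ℂ g) {K : ℕ} {C R : ℝ} (hR : 1 ≤ R)
    (hb : ∀ z, R ≤ ‖z‖ → ‖g z‖ ≤ C * ‖z‖ ^ K) : ∃ p : Polynomial ℂ, ∀ z, g z = p.eval z := by
  have hC : 0 ≤ C := by
    have h1 := hb (R : ℂ) (by simp; exact le_abs_self R)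
    by_contra h
    have : C * ‖(R:ℂ)‖ ^ K < 0 := mul_neg_of_neg_of_pos (by linarith) (by
      apply pow_pos; simp; linarith)
    linarith [norm_nonneg (g R)]
  have hz : ∀ n, K < n → iteratedDeriv n g 0 = 0 := by
    intro n hn
    rw [← norm_le_zero_iff]
    have h1 : ∀ r : ℝ, R ≤ r → ‖iteratedDeriv n g 0‖ ≤ n.factorial * C * r⁻¹ := by
      intro r hr
      have hr0 : 0 < r := by linarith
      have h2 := Complex.norm_iteratedDeriv_le_of_forall_mem_sphere_norm_le (f := g) (c := 0) n hr0
        hg.diffContOnCl (C := C * r ^ K) (fun z hz => by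
          have : ‖z‖ = r := by simpa using hz
          rw [← this]; exact hb z (by rw [this]; exact hr))
      refine h2.trans ?_
      rw [div_le_iff₀ (by positivity)]
      have h3 : r ^ K ≤ r⁻¹ * r ^ n := by
        rw [inv_mul_eq_div, le_div_iff₀ hr0, ← pow_succ]
        exact pow_le_pow_right₀ (by linarith) hn
      calc (n.factorial : ℝ) * (C * r ^ K) ≤ n.factorial * (C * (r⁻¹ * r ^ n)) := by gcongr
        _ = _ := by ring
    have h2 : Tendsto (fun r : ℝ => n.factorial * C * r⁻¹) atTop (𝓝 (n.factorial * C * 0)) :=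
      tendsto_const_nhds.mul tendsto_inv_atTop_zero
    rw [mul_zero] at h2
    exact ge_of_tendsto h2 ((eventually_ge_atTop R).mono h1)
  refine ⟨∑ n ∈ Finset.range (K + 1), Polynomial.C ((n.factorial : ℂ)⁻¹ * iteratedDeriv n g 0) *
    Polynomial.X ^ n, fun z => ?_⟩
  have h := Complex.taylorSeries_eq_of_entire' (f := g) 0 z hg
  rw [← h, tsum_eq_sum (s := Finset.range (K + 1))]
  · simp [Polynomial.eval_finset_sum]
  · intro n hn
    rw [hz n (by simpa using hn)]; simp

theorem rational_of_poly (D : Finset ℂ) : ∀ {g : ℂ → ℂ}, (∀ z ∉ D, AnalyticAt ℂ g z) →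
    (∀ z, MeromorphicAt g z) → ∀ {K : ℕ} {C R : ℝ}, 1 ≤ R →
    (∀ z, R ≤ ‖z‖ → ‖g z‖ ≤ C * ‖z‖ ^ K) →
    ∃ p q : Polynomial ℂ, q ≠ 0 ∧ ∀ z ∉ D, g z = p.eval z / q.eval z := by
  induction D using Finset.induction_on with
  | empty =>
    intro g hg _ K C R hR hb
    obtain ⟨p, hp⟩ := entire_poly (fun z => (hg z (by simp)).differentiableAt) hR hb
    exact ⟨p, 1, one_ne_zero, fun z _ => by simp [hp z]⟩
  | insert d D hd ih =>
    intro g hg hm K C R hR hb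
    obtain ⟨n, hn⟩ := hm d
    have h1 : ∀ z ∉ D, AnalyticAt ℂ (fun z => (z - d) ^ n * g z) z := by
      intro z hz
      by_cases hzd : z = d
      · rw [hzd]; simpa using hn
      · exact AnalyticAt.mul (by fun_prop) (hg z (by simp [hzd, hz]))
    have h2 : ∀ z, MeromorphicAt (fun z => (z - d) ^ n * g z) z := fun z =>
      MeromorphicAt.mul (AnalyticAt.meromorphicAt (by fun_prop)) (hm z)
    obtain ⟨p, q, hq, hpq⟩ := ih h1 h2 (K := n + K) (C := (1 + ‖d‖) ^ n * C) (R := R) hR (by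
      intro z hz
      have h3 : ‖z - d‖ ≤ (1 + ‖d‖) * ‖z‖ := by
        have := norm_sub_le z d
        nlinarith [norm_nonneg d]
      rw [norm_mul, norm_pow]
      calc ‖z - d‖ ^ n * ‖g z‖ ≤ ((1 + ‖d‖) * ‖z‖) ^ n * (C * ‖z‖ ^ K) := by
            gcongr; exact hb z hz
        _ = _ := by rw [mul_pow, pow_add]; ring)
    refine ⟨p, (Polynomial.X - Polynomial.C d) ^ n * q,
      mul_ne_zero (pow_ne_zero _ (Polynomial.X_sub_C_ne_zero d)) hq, fun z hz => ?_⟩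
    have hz1 : z ≠ d := fun h => hz (by simp [h])
    have h4 := hpq z (fun h => hz (by simp [h]))
    simp only [Polynomial.eval_mul, Polynomial.eval_pow, Polynomial.eval_sub, Polynomial.eval_X,
      Polynomial.eval_C]
    rw [mul_comm, ← div_div, ← h4, mul_div_cancel_left₀]
    exact pow_ne_zero _ (sub_ne_zero.2 hz1)

end PartF

section PartH1

structure IsTract (F φ : ℂ → ℂ) (a : ℂ) (τ : ℝ) : Prop where
  diff : DifferentiableOn ℂ φ {w | w.re < τ}
  inj : InjOn φ {w | w.re < τ}
  val : ∀ w, w.re < τ → F (φ w) = a + Complex.exp w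
  an : ∀ w, w.re < τ → AnalyticAt ℂ F (φ w)
  inf : ∀ R : ℝ, ∃ s : ℝ, ∀ w, w.re < s → R < ‖φ w‖

lemma isOpen_reLt (τ : ℝ) : IsOpen {w : ℂ | w.re < τ} :=
  isOpen_lt Complex.continuous_re continuous_const

lemma IsTract.anφ {F φ : ℂ → ℂ} {a : ℂ} {τ : ℝ} (h : IsTract F φ a τ) {w : ℂ} (hw : w.re < τ) :
    AnalyticAt ℂ φ w :=
  h.diff.analyticAt ((isOpen_reLt τ).mem_nhds hw)

lemma IsTract.deriv_mul {F φ : ℂ → ℂ} {a : ℂ} {τ : ℝ} (h : IsTract F φ a τ) {w : ℂ}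
    (hw : w.re < τ) : deriv F (φ w) * deriv φ w = Complex.exp w := by
  have h1 : HasDerivAt (fun x => F (φ x)) (deriv F (φ w) * deriv φ w) w :=
    (h.an w hw).differentiableAt.hasDerivAt.comp w (h.anφ hw).differentiableAt.hasDerivAt
  have h2 : (fun x => F (φ x)) =ᶠ[𝓝 w] fun x => a + Complex.exp x := by
    filter_upwards [(isOpen_reLt τ).mem_nhds hw] with x hx using h.val x hx
  have h3 : HasDerivAt (fun x => a + Complex.exp x) (Complex.exp w) w :=
    (Complex.hasDerivAt_exp w).const_add a
  exact h1.unique (h3.congr_of_eventuallyEq h2)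

lemma IsTract.deriv_ne {F φ : ℂ → ℂ} {a : ℂ} {τ : ℝ} (h : IsTract F φ a τ) {w : ℂ}
    (hw : w.re < τ) : deriv F (φ w) ≠ 0 ∧ deriv φ w ≠ 0 := by
  have := h.deriv_mul hw
  have h0 := Complex.exp_ne_zero w
  rw [← this] at h0
  exact ⟨left_ne_zero_of_mul h0, right_ne_zero_of_mul h0⟩

lemma IsTract.schw {F φ : ℂ → ℂ} {a : ℂ} {τ : ℝ} (h : IsTract F φ a τ) {w : ℂ}
    (hw : w.re < τ) : schwarzian F (φ w) * deriv φ w ^ 2 = -1 / 2 - schwarzian φ w ∧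
      ‖schwarzian φ w‖ ≤ 64 / (τ - w.re) ^ 2 := by
  constructor
  · have h2 : (fun x => F (φ x)) =ᶠ[𝓝 w] fun x => a + Complex.exp x := by
      filter_upwards [(isOpen_reLt τ).mem_nhds hw] with x hx using h.val x hx
    have h3 := schw_comp (h.an w hw) (h.anφ hw) (h.deriv_ne hw).1 (h.deriv_ne hw).2
    rw [schw_congr h2, schw_exp] at h3
    rw [h3]; ring
  · have hsub : Metric.ball w (τ - w.re) ⊆ {w | w.re < τ} := by
      intro x hx
      rw [Metric.mem_ball, dist_eq_norm] at hx
      have := (Complex.re_le_norm (x - w))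
      rw [Complex.sub_re] at this
      simp only [mem_ofPred_eq]; linarith
    exact koebe_schw (by linarith) (h.diff.mono hsub) (h.inj.mono hsub) (h.deriv_ne hw).2

/-- approximation of the potential -/
def BApprox (F : ℂ → ℂ) (l ε M : ℝ) : Prop := ∀ ζ, ‖ζ‖ ≤ M → AnalyticAt ℂ F ζ →
  ‖schwarzian F ζ / 2 - l ^ 2 * Complex.exp ζ‖ ≤ ε * (l ^ 2 * ‖Complex.exp ζ‖)

def Vf (φ : ℂ → ℂ) (l : ℝ) (w : ℂ) : ℂ := (deriv φ w * (2 * Complex.I * l * Complex.exp (φ w / 2)))⁻¹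

lemma IsTract.V_sq {F φ : ℂ → ℂ} {a : ℂ} {τ l ε M μ : ℝ} (h : IsTract F φ a τ)
    (hB : BApprox F l ε M) (hl : 0 < l) (hε : ε ≤ 1 / 32) (hμ : 0 < μ) (hμε : 128 ≤ ε * μ ^ 2)
    {w : ℂ} (hw : w.re + μ ≤ τ) (hM : ‖φ w‖ ≤ M) :
    ‖Vf φ l w - 1‖ ≤ 4 * ε ∨ ‖Vf φ l w + 1‖ ≤ 4 * ε := by
  have hwτ : w.re < τ := by linarith
  obtain ⟨h1, h2⟩ := h.schw hwτ
  have h3 := hB (φ w) hM (h.an w hwτ)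
  set S := schwarzian φ w
  set D := deriv φ w with hD
  have hD0 : D ≠ 0 := (h.deriv_ne hwτ).2
  set e := Complex.exp (φ w / 2) with he
  have he0 : e ≠ 0 := Complex.exp_ne_zero _
  have hee : Complex.exp (φ w) = e ^ 2 := by
    rw [he, ← Complex.exp_nat_mul]; congr 1; push_cast; ring
  have hl0 : (l:ℂ) ≠ 0 := by exact_mod_cast hl.ne'
  set V := Vf φ l w with hV
  have hVe : V * (D * (2 * Complex.I * l * e)) = 1 := by
    rw [hV, Vf]; apply inv_mul_cancel₀
    simp only [← hD, ← he]; simp [hD0, hl0, he0]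
  have hS : ‖S‖ ≤ ε / 2 := by
    refine h2.trans ?_
    rw [div_le_div_iff₀ (pow_pos (by linarith) 2) two_pos]
    have : μ ^ 2 ≤ (τ - w.re) ^ 2 := by
      apply pow_le_pow_left₀ hμ.le; linarith
    have hε0 : 0 ≤ ε := by
      by_contra hh
      nlinarith [sq_nonneg μ]
    nlinarith
  -- V^2 - 1
  rw [hee] at h3
  set β := schwarzian F (φ w) / 2 - l ^ 2 * e ^ 2 with hβ
  have hSF : schwarzian F (φ w) = 2 * (β + l ^ 2 * e ^ 2) := by rw [hβ]; ring
  rw [hSF] at h1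
  have hnum : (V ^ 2 - 1) * ((l:ℂ) ^ 2 * e ^ 2) * (1 + 2 * S) = β - 2 * S * (l ^ 2 * e ^ 2) := by
    have hD2 : V ^ 2 * (D ^ 2 * (-4 * l ^ 2 * e ^ 2)) = 1 := by
      have := congrArg (· ^ 2) hVe
      simp only [mul_pow, Complex.I_sq, one_pow] at this
      rw [← this]; ring
    have h4 : 4 * (β + l ^ 2 * e ^ 2) * D ^ 2 = -1 - 2 * S := by linear_combination 2 * h1
    linear_combination ((l:ℂ) ^ 2 * e ^ 2 * V ^ 2) * h4 + (β + l ^ 2 * e ^ 2) * hD2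
  have hn1 : ‖(l:ℂ) ^ 2 * e ^ 2‖ = l ^ 2 * ‖e ^ 2‖ := by
    rw [norm_mul]; simp
  have hn0 : 0 < l ^ 2 * ‖e ^ 2‖ :=
    mul_pos (pow_pos hl 2) (norm_pos_iff.2 (pow_ne_zero 2 he0))
  have hn2 : 1 / 2 ≤ ‖1 + 2 * S‖ := by
    have := norm_sub_norm_le (1:ℂ) (-(2 * S))
    rw [norm_neg, sub_neg_eq_add, norm_one, norm_mul] at this
    simp at this; linarith
  have hV2 : ‖V ^ 2 - 1‖ ≤ 4 * ε := by
    have h5 := congrArg norm hnum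
    rw [norm_mul, norm_mul, hn1] at h5
    have h6 : ‖β - 2 * S * (l ^ 2 * e ^ 2)‖ ≤ 2 * ε * (l ^ 2 * ‖e ^ 2‖) := by
      refine (norm_sub_le _ _).trans ?_
      rw [norm_mul _ ((l:ℂ) ^ 2 * e ^ 2), hn1, norm_mul]
      simp only [Complex.norm_ofNat]
      nlinarith
    have h7 : ‖V ^ 2 - 1‖ * (1 / 2) * (l ^ 2 * ‖e ^ 2‖) ≤ 2 * ε * (l ^ 2 * ‖e ^ 2‖) := by
      calc _ ≤ ‖V ^ 2 - 1‖ * ‖1 + 2 * S‖ * (l ^ 2 * ‖e ^ 2‖) := by gcongr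
        _ = _ := by rw [← h5]; ring
        _ ≤ _ := h6
    have := le_of_mul_le_mul_right h7 hn0
    linarith
  have hfac : V ^ 2 - 1 = (V - 1) * (V + 1) := by ring
  rw [hfac, norm_mul] at hV2
  rcases le_total 0 V.re with hr | hr
  · left
    have : 1 ≤ ‖V + 1‖ := by
      have := Complex.re_le_norm (V + 1); simp at this; linarith
    nlinarith [norm_nonneg (V - 1)]
  · right
    have : 1 ≤ ‖V - 1‖ := by
      have := Complex.abs_re_le_norm (V - 1)
      simp at this
      rw [abs_of_nonpos (by linarith)] at this; linarith
    nlinarith [norm_nonneg (V + 1)]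

end PartH1

section PartH2

/-- straight point on a segment -/
def sg (ζ0 ζ1 : ℂ) (t : ℝ) : ℂ := ζ0 + t * (ζ1 - ζ0)

/-- predicted position -/
def prd (w0 ζ0 : ℂ) (σ l : ℝ) (ζ : ℂ) : ℂ :=
  w0 + 4 * Complex.I * σ * l * (Complex.exp (ζ / 2) - Complex.exp (ζ0 / 2))

lemma IsTract.V_cont {F φ : ℂ → ℂ} {a : ℂ} {τ l : ℝ} (h : IsTract F φ a τ) (hl : 0 < l) {w : ℂ}
    (hw : w.re < τ) : ContinuousAt (Vf φ l) w := by
  have h1 : ContinuousAt (deriv φ) w := (h.anφ hw).deriv.continuousAt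
  have h2 : ContinuousAt φ w := (h.anφ hw).continuousAt
  have hl0 : (l:ℂ) ≠ 0 := by exact_mod_cast hl.ne'
  refine ContinuousAt.inv₀ ?_ ?_
  · exact h1.mul (continuousAt_const.mul (Complex.continuous_exp.continuousAt.comp (h2.div_const 2)))
  · simp [hl0, (h.deriv_ne hw).2]

lemma exp_half_le {ζ : ℂ} {M : ℝ} (h : ‖ζ‖ ≤ M) : ‖Complex.exp (ζ / 2)‖ ≤ Real.exp (M / 2) := by
  rw [Complex.norm_exp]
  apply Real.exp_le_exp.2
  have := Complex.re_le_norm ζ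
  have h2 : (ζ / 2).re = ζ.re / 2 := by simp
  rw [h2]; linarith

theorem lemmaC {F φ : ℂ → ℂ} {a : ℂ} {τ l ε M μ L : ℝ} (h : IsTract F φ a τ)
    (hB : BApprox F l ε M) (hl : 0 < l) (hε0 : 0 < ε) (hε : ε ≤ 1 / 32) (hμ : 0 < μ)
    (hμε : 128 ≤ ε * μ ^ 2)
    {w0 ζ0 ζ1 : ℂ} (h0 : φ w0 = ζ0) (hζ0 : ‖ζ0‖ ≤ M) (hζ1 : ‖ζ1‖ ≤ M) (hL : 0 < L)
    (hL1 : ‖ζ1 - ζ0‖ ≤ L) {σ : ℝ} (hσ : σ = 1 ∨ σ = -1) (hV0 : ‖Vf φ l w0 - σ‖ ≤ 4 * ε)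
    (hpred : ∀ t ∈ Icc (0:ℝ) 1, (prd w0 ζ0 σ l (sg ζ0 ζ1 t)).re + μ + 9 * ε * l * Real.exp (M / 2) * L
      ≤ τ) :
    ∃ w1, w1.re + μ ≤ τ ∧ φ w1 = ζ1 ∧
      ‖w1 - prd w0 ζ0 σ l ζ1‖ ≤ 9 * ε * l * Real.exp (M / 2) * L ∧ ‖Vf φ l w1 - σ‖ ≤ 4 * ε := by
  set E := 9 * ε * l * Real.exp (M / 2) * L with hE
  have hE0 : 0 < E := by positivity
  have hball : ∀ t ∈ Icc (0:ℝ) 1, ‖sg ζ0 ζ1 t‖ ≤ M := by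
    intro t ht
    have := (convex_closedBall (0:ℂ) M).add_smul_sub_mem (x := ζ0) (y := ζ1) (by simpa using hζ0)
      (by simpa using hζ1) ht
    simpa [sg] using this
  set p : ℝ → ℂ := fun t => prd w0 ζ0 σ l (sg ζ0 ζ1 t) with hp
  have hsgc : Continuous (sg ζ0 ζ1) := by unfold sg; fun_prop
  have hpc : Continuous p := by
    simp only [hp, prd]; fun_prop
  have hdep : ∀ t ∈ Icc (0:ℝ) 1, ∀ w, ‖w - p t‖ ≤ E * t → w.re + μ ≤ τ := by
    intro t ht w hw
    have h1 := Complex.re_le_norm (w - p t)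
    rw [Complex.sub_re] at h1
    have h2 := hpred t ht
    have h3 : E * t ≤ E := by nlinarith [ht.2]
    linarith
  -- sharpening
  have hsharp : ∀ w, w.re + μ ≤ τ → ‖φ w‖ ≤ M → ‖Vf φ l w - σ‖ ≤ 1 / 4 → ‖Vf φ l w - σ‖ ≤ 4 * ε := by
    intro w hw hM hV
    have hA : ∀ V : ℂ, ‖V - 1‖ ≤ 1 / 4 → ‖V + 1‖ ≤ 1 / 4 → False := by
      intro V ha hb
      have : ‖(2:ℂ)‖ ≤ ‖V + 1‖ + ‖V - 1‖ := by
        have := norm_sub_le (V + 1) (V - 1)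
        have h2 : V + 1 - (V - 1) = 2 := by ring
        rwa [h2] at this
      simp at this
      linarith
    rcases h.V_sq hB hl hε hμ hμε hw hM with h1 | h1 <;> rcases hσ with rfl | rfl
    · simpa using h1
    · exact (hA _ (h1.trans (by linarith)) (by simpa using hV)).elim
    · exact (hA _ (by simpa using hV) (h1.trans (by linarith))).elim
    · simpa using h1
  set Q : Set ℝ := {t | ∃ w, ‖w - p t‖ ≤ E * t ∧ φ w = sg ζ0 ζ1 t ∧ ‖Vf φ l w - σ‖ ≤ 1 / 4} with hQ
  have hcl : IsClosed (Q ∩ Icc 0 1) := by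
    refine IsSeqClosed.isClosed ?_
    intro ts T hts hT
    have hTI : T ∈ Icc (0:ℝ) 1 := isClosed_Icc.mem_of_tendsto hT (Eventually.of_forall fun n => (hts n).2)
    choose ws hw1 hw2 hw3 using fun n => (hts n).1
    have hbd : ∃ R, ∀ n, ws n ∈ Metric.closedBall (0:ℂ) R := by
      obtain ⟨R, hR⟩ := (isCompact_Icc (a := (0:ℝ)) (b := 1)).exists_bound_of_continuousOn hpc.continuousOn
      refine ⟨R + E, fun n => ?_⟩
      rw [mem_closedBall_zero_iff]
      have h1 := hR (ts n) (hts n).2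
      have h2 := norm_add_le (ws n - p (ts n)) (p (ts n))
      rw [sub_add_cancel] at h2
      have h3 : E * ts n ≤ E := by nlinarith [(hts n).2.2]
      linarith [hw1 n]
    obtain ⟨R, hR⟩ := hbd
    obtain ⟨w, -, ψ, hψ, hw⟩ := (isCompact_closedBall (0:ℂ) R).tendsto_subseq hR
    have hT' : Tendsto (ts ∘ ψ) atTop (𝓝 T) := hT.comp hψ.tendsto_atTop
    have hlim1 : ‖w - p T‖ ≤ E * T :=
      le_of_tendsto_of_tendsto' ((hw.sub ((hpc.tendsto T).comp hT')).norm) (hT'.const_mul E)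
        (fun n => hw1 (ψ n))
    have hwτ : w.re < τ := by have := hdep T hTI w hlim1; linarith
    refine ⟨⟨w, hlim1, ?_, ?_⟩, hTI⟩
    · have h1 : Tendsto (fun n => φ (ws (ψ n))) atTop (𝓝 (φ w)) :=
        (h.anφ hwτ).continuousAt.tendsto.comp hw
      have h2 : Tendsto (fun n => φ (ws (ψ n))) atTop (𝓝 (sg ζ0 ζ1 T)) := by
        have := (hsgc.tendsto T).comp hT'
        refine this.congr fun n => (hw2 (ψ n)).symm
      exact tendsto_nhds_unique h1 h2
    · exact le_of_tendsto ((((h.V_cont hl hwτ).tendsto.comp hw).sub_const _).norm)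
        (Eventually.of_forall fun n => hw3 (ψ n))
  have hstart : (0:ℝ) ∈ Q := by
    refine ⟨w0, ?_, ?_, ?_⟩
    · simp [hp, prd, sg]
    · simpa [sg] using h0
    · linarith
  have hext : ∀ t ∈ Q ∩ Ico 0 1, ∀ y ∈ Ioi t, (Q ∩ Ioc t y).Nonempty := by
    rintro t ⟨⟨w, hw1, hw2, hw3⟩, ht⟩ y hy
    have htI : t ∈ Icc (0:ℝ) 1 := ⟨ht.1, ht.2.le⟩
    have hwd := hdep t htI w hw1
    have hwτ : w.re < τ := by linarith
    have hwM : ‖φ w‖ ≤ M := by rw [hw2]; exact hball t htI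
    have hVs := hsharp w hwd hwM hw3
    obtain ⟨e, he1, he2, he3⟩ := locinv (h.anφ hwτ) (h.deriv_ne hwτ).2 (isOpen_reLt τ) hwτ
    have he4 : φ w ∈ e.target := by rw [← he3]; exact e.map_source he1
    have hsymm : e.symm (φ w) = w := by rw [← he3]; exact e.left_inv he1
    have hder : HasDerivAt e.symm (deriv φ w)⁻¹ (φ w) := by
      refine e.hasDerivAt_symm he4 (h.deriv_ne hwτ).2 ?_
      rw [hsymm]
      exact (h.anφ hwτ).differentiableAt.hasDerivAt.congr_of_eventuallyEq
        (Eventually.of_forall fun x => he3 x)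
    have hsgd : HasDerivAt (sg ζ0 ζ1) (ζ1 - ζ0) t := by
      have : HasDerivAt (fun t : ℝ => (t:ℂ)) 1 t := Complex.ofRealCLM.hasDerivAt
      exact ((this.mul_const (ζ1 - ζ0)).const_add ζ0).congr_deriv (one_mul _)
    have hWd : HasDerivAt (fun s => e.symm (sg ζ0 ζ1 s)) ((deriv φ w)⁻¹ * (ζ1 - ζ0)) t := by
      rw [hw2] at hder
      have := hder.comp_of_eq t hsgd rfl
      exact this
    have hpd : HasDerivAt p (2 * Complex.I * σ * l * Complex.exp (sg ζ0 ζ1 t / 2) * (ζ1 - ζ0)) t := by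
      have h1 : HasDerivAt (fun s => Complex.exp (sg ζ0 ζ1 s / 2))
          (Complex.exp (sg ζ0 ζ1 t / 2) * ((ζ1 - ζ0) / 2)) t := (hsgd.div_const 2).cexp
      have h2 := ((h1.sub_const (Complex.exp (ζ0 / 2))).const_mul (4 * Complex.I * σ * l)).const_add w0
      exact h2.congr_deriv (by ring)
    have hdd := (hWd.sub hpd)
    have hnorm : ‖(deriv φ w)⁻¹ * (ζ1 - ζ0) -
        2 * Complex.I * σ * l * Complex.exp (sg ζ0 ζ1 t / 2) * (ζ1 - ζ0)‖ < E := by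
      have hl0 : (l:ℂ) ≠ 0 := by exact_mod_cast hl.ne'
      have h1 : (deriv φ w)⁻¹ = Vf φ l w * (2 * Complex.I * l * Complex.exp (sg ζ0 ζ1 t / 2)) := by
        rw [← hw2, Vf, mul_inv, mul_assoc, inv_mul_cancel₀, mul_one]
        simp [hl0]
      have h2 : (deriv φ w)⁻¹ * (ζ1 - ζ0) -
        2 * Complex.I * σ * l * Complex.exp (sg ζ0 ζ1 t / 2) * (ζ1 - ζ0) =
        (Vf φ l w - σ) * (2 * Complex.I * l * Complex.exp (sg ζ0 ζ1 t / 2)) * (ζ1 - ζ0) := by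
        rw [h1]; ring
      rw [h2, norm_mul, norm_mul]
      have h3 : ‖2 * Complex.I * l * Complex.exp (sg ζ0 ζ1 t / 2)‖ ≤ 2 * l * Real.exp (M / 2) := by
        rw [norm_mul]
        have : ‖2 * Complex.I * (l:ℂ)‖ = 2 * l := by simp [abs_of_pos hl]
        rw [this]
        gcongr
        exact exp_half_le (hball t htI)
      calc _ ≤ 4 * ε * (2 * l * Real.exp (M / 2)) * L := by gcongr
        _ = 8 * ε * l * Real.exp (M / 2) * L := by ring
        _ < E := by
          rw [hE]
          have : 0 < ε * l * Real.exp (M / 2) * L := by positivity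
          nlinarith
    have hev1 := (hdd.hasDerivWithinAt (s := Ioi t)).limsup_norm_slope_le hnorm
    have hcontW : ContinuousAt (fun s => e.symm (sg ζ0 ζ1 s)) t := hWd.continuousAt
    have hWt : e.symm (sg ζ0 ζ1 t) = w := by rw [← hw2]; exact hsymm
    have hev2 : ∀ᶠ s in 𝓝 t, ‖Vf φ l (e.symm (sg ζ0 ζ1 s)) - σ‖ < 1 / 4 := by
      have h1 : ContinuousAt (fun s => ‖Vf φ l (e.symm (sg ζ0 ζ1 s)) - σ‖) t := by
        refine ContinuousAt.norm (ContinuousAt.sub ?_ continuousAt_const)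
        exact ContinuousAt.comp (f := fun s => e.symm (sg ζ0 ζ1 s)) (by
          rw [hWt]; exact h.V_cont hl hwτ) hcontW
      refine h1.eventually_lt_const ?_
      show ‖Vf φ l (e.symm (sg ζ0 ζ1 t)) - σ‖ < 1 / 4
      rw [hWt]; linarith
    have hev3 : ∀ᶠ s in 𝓝 t, sg ζ0 ζ1 s ∈ e.target :=
      hsgc.continuousAt.eventually (e.open_target.mem_nhds (by rw [← hw2]; exact he4))
    have hev4 : ∀ᶠ s in 𝓝[>] t, s ∈ Ioc t y := Ioc_mem_nhdsGT hy
    obtain ⟨s, ⟨hs1, hs2⟩, hs3, hs4⟩ := ((hev1.and (hev2.filter_mono nhdsWithin_le_nhds)).and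
      ((hev3.filter_mono nhdsWithin_le_nhds).and hev4)).exists
    refine ⟨s, ⟨e.symm (sg ζ0 ζ1 s), ?_, ?_, hs2.le⟩, hs4⟩
    · have hst : 0 < s - t := by linarith [hs4.1]
      rw [Real.norm_of_nonneg hst.le, inv_mul_lt_iff₀ hst] at hs1
      simp only [Pi.sub_apply, hWt] at hs1
      have := norm_add_le (e.symm (sg ζ0 ζ1 s) - p s - (w - p t)) (w - p t)
      rw [sub_add_cancel] at this
      nlinarith
    · rw [← he3]; exact e.right_inv hs3
  have hall := hcl.Icc_subset_of_forall_exists_gt (a := 0) (b := 1) hstart hext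
  obtain ⟨w1, h1, h2, h3⟩ := hall (right_mem_Icc.2 zero_le_one)
  have hs1 : sg ζ0 ζ1 1 = ζ1 := by simp [sg]
  have hd := hdep 1 (by simp) w1 h1
  refine ⟨w1, hd, by rw [h2, hs1], ?_, hsharp w1 hd ?_ h3⟩
  · simpa [hp, hs1] using h1
  · rw [h2, hs1]; exact hζ1

end PartH2

section PartH3

def hh (ζ : ℂ) : ℝ := 4 * (Complex.exp (ζ / 2)).im

lemma hh_eq (x y : ℝ) : hh (x + y * Complex.I) = 4 * (Real.exp (x / 2) * Real.sin (y / 2)) := by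
  unfold hh
  rw [Complex.exp_im]
  simp

structure SCtx (F : ℂ → ℂ) (l ε M : ℝ) : Prop where
  hB : BApprox F l ε M
  hl : 0 < l
  hε0 : 0 < ε
  hε : ε ≤ 1 / 32
  hμ : 128 ≤ ε * (l / 20000) ^ 2
  hE : 9 * ε * Real.exp (M / 2) * 30 ≤ 1 / 10 ^ 6
  hM : 60 ≤ M

lemma prd_re (w0 ζ0 : ℂ) (σ l : ℝ) (ζ : ℂ) :
    (prd w0 ζ0 σ l ζ).re = w0.re - l * σ * (hh ζ - hh ζ0) := by
  unfold prd hh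
  simp; ring

lemma SCtx.E_le {F : ℂ → ℂ} {l ε M : ℝ} (c : SCtx F l ε M) :
    9 * ε * l * Real.exp (M / 2) * 30 ≤ l / 10 ^ 6 := by
  have := mul_le_mul_of_nonneg_right c.hE c.hl.le
  linarith

lemma SCtx.step {F φ : ℂ → ℂ} {a : ℂ} {l ε M τ : ℝ} (c : SCtx F l ε M) (h : IsTract F φ a τ)
    {w0 ζ0 ζ1 : ℂ} (h0 : φ w0 = ζ0) (hζ0 : ‖ζ0‖ ≤ M) (hζ1 : ‖ζ1‖ ≤ M) (hL : ‖ζ1 - ζ0‖ ≤ 30)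
    {σ : ℝ} (hσ : σ = 1 ∨ σ = -1) (hV0 : ‖Vf φ l w0 - σ‖ ≤ 4 * ε)
    (hd : ∀ t ∈ Icc (0:ℝ) 1, w0.re - l * σ * (hh (sg ζ0 ζ1 t) - hh ζ0) + l / 10000 ≤ τ) :
    ∃ w1, w1.re + l / 20000 ≤ τ ∧ φ w1 = ζ1 ∧ ‖w1 - prd w0 ζ0 σ l ζ1‖ ≤ 9 * ε * l * Real.exp (M / 2) * 30 ∧
      |w1.re - (w0.re - l * σ * (hh ζ1 - hh ζ0))| ≤ l / 10 ^ 6 ∧ ‖Vf φ l w1 - σ‖ ≤ 4 * ε := by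
  have hl := c.hl
  have hE := c.E_le
  obtain ⟨w1, h1, h2, h3, h4⟩ := lemmaC h c.hB c.hl c.hε0 c.hε (by linarith : 0 < l / 20000) c.hμ h0 hζ0
    hζ1 (by norm_num : (0:ℝ) < 30) hL hσ hV0 (by
      intro t ht
      have := hd t ht
      rw [prd_re]
      linarith)
  refine ⟨w1, h1, h2, h3, ?_, h4⟩
  have := Complex.abs_re_le_norm (w1 - prd w0 ζ0 σ l ζ1)
  rw [Complex.sub_re, prd_re] at this
  linarith

lemma SCtx.sign {F φ : ℂ → ℂ} {a : ℂ} {l ε M τ : ℝ} (c : SCtx F l ε M) (h : IsTract F φ a τ)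
    {w : ℂ} (hw : w.re + l / 20000 ≤ τ) (hM : ‖φ w‖ ≤ M) :
    ∃ σ : ℝ, (σ = 1 ∨ σ = -1) ∧ ‖Vf φ l w - σ‖ ≤ 4 * ε := by
  rcases h.V_sq c.hB c.hl c.hε (by linarith [c.hl] : 0 < l / 20000) c.hμ hw hM with h1 | h1
  · exact ⟨1, Or.inl rfl, by simpa using h1⟩
  · exact ⟨-1, Or.inr rfl, by simpa using h1⟩

lemma SCtx.dφ {F φ : ℂ → ℂ} {a : ℂ} {l ε M τ : ℝ} (c : SCtx F l ε M) (h : IsTract F φ a τ)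
    {w : ℂ} (hw : w.re + l / 20000 ≤ τ) (hM : ‖φ w‖ ≤ M) :
    ‖deriv φ w‖ ≤ Real.exp (-(φ w).re / 2) / l := by
  obtain ⟨σ, hσ, hV⟩ := c.sign h hw hM
  have hl := c.hl
  have hwτ : w.re < τ := by linarith
  have hn : 1 - 4 * ε ≤ ‖Vf φ l w‖ := by
    have h1 : ‖(σ:ℂ)‖ = 1 := by rcases hσ with rfl | rfl <;> simp
    have := norm_sub_norm_le (σ:ℂ) (Vf φ l w)
    rw [norm_sub_rev, h1] at this
    linarith
  have hε := c.hε
  have hV2 : ‖Vf φ l w‖ * (‖deriv φ w‖ * (2 * l * Real.exp ((φ w).re / 2))) = 1 := by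
    have h1 : ‖deriv φ w * (2 * Complex.I * l * Complex.exp (φ w / 2))‖ =
        ‖deriv φ w‖ * (2 * l * Real.exp ((φ w).re / 2)) := by
      rw [norm_mul, norm_mul, Complex.norm_exp]
      simp [abs_of_pos hl]
    rw [Vf, norm_inv, h1, inv_mul_cancel₀]
    have := norm_pos_iff.2 (h.deriv_ne hwτ).2
    positivity
  set D := ‖deriv φ w‖
  have hD : 0 ≤ D := norm_nonneg _
  have he : Real.exp (-(φ w).re / 2) * Real.exp ((φ w).re / 2) = 1 := by
    rw [← Real.exp_add]; simp; ring_nf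
  have he0 := Real.exp_pos ((φ w).re / 2)
  have hDe : D * (l * Real.exp ((φ w).re / 2)) ≤ 1 := by
    have : 0 ≤ D * (l * Real.exp ((φ w).re / 2)) := by positivity
    nlinarith
  rw [le_div_iff₀ hl]
  have h3 : D * l * Real.exp ((φ w).re / 2) ≤ Real.exp (-(φ w).re / 2) * Real.exp ((φ w).re / 2) := by
    rw [he]; linarith
  exact le_of_mul_le_mul_right h3 he0

theorem SCtx.W {F φ : ℂ → ℂ} {a : ℂ} {l ε M τ : ℝ} (c : SCtx F l ε M) (h : IsTract F φ a τ)
    {w : ℂ} {x y : ℝ} (hw : φ w = x + y * Complex.I) (hx : |x| ≤ 3) (hy : |y| ≤ 8) (hwτ : w.re < τ) :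
    τ - w.re ≤ l * (4 * (Real.exp (x / 2) * |Real.sin (y / 2)|) + 1 / 2000) := by
  by_contra hcon
  push Not at hcon
  have hl := c.hl
  have hM := c.hM
  rw [abs_le] at hx hy
  have hnorm : ∀ u v : ℝ, |u| ≤ 25 → |v| ≤ 34 → ‖(u + v * Complex.I : ℂ)‖ ≤ M := by
    intro u v hu hv
    have := Complex.norm_le_abs_re_add_abs_im (u + v * Complex.I : ℂ)
    simp at this; linarith
  have hs0 := abs_nonneg (Real.sin (y / 2))
  have he0 := Real.exp_pos (x / 2)
  have hd0 : w.re + l / 2000 ≤ τ := by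
    have : 0 ≤ l * (4 * (Real.exp (x / 2) * |Real.sin (y / 2)|)) := by positivity
    linarith
  have hn0 : ‖φ w‖ ≤ M := by
    rw [hw]; exact hnorm x y (abs_le.2 ⟨by linarith, by linarith⟩) (abs_le.2 ⟨by linarith, by linarith⟩)
  obtain ⟨σ, hσ, hV⟩ := c.sign h (w := w) (by linarith) hn0
  -- step left
  have hsg : ∀ t : ℝ, sg (x + y * Complex.I) (((-24:ℝ):ℂ) + y * Complex.I) t =
      ((x + t * (-24 - x) : ℝ) : ℂ) + y * Complex.I := by
    intro t; simp [sg]; ring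
  have hdiff : ∀ z : ℝ, z ≤ x → l * σ * (hh (z + y * Complex.I) - hh (x + y * Complex.I)) ≥
      - (l * (4 * (Real.exp (x / 2) * |Real.sin (y / 2)|))) := by
    intro z hz
    rw [hh_eq, hh_eq]
    have h1 : Real.exp (z / 2) ≤ Real.exp (x / 2) := Real.exp_le_exp.2 (by linarith)
    have h2 := Real.exp_pos (z / 2)
    have h3 : |σ * ((Real.exp (z / 2) - Real.exp (x / 2)) * Real.sin (y / 2))| ≤
        Real.exp (x / 2) * |Real.sin (y / 2)| := by
      rw [abs_mul, abs_mul]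
      have : |σ| = 1 := by rcases hσ with rfl | rfl <;> simp
      rw [this, one_mul]
      gcongr
      rw [abs_le]; constructor <;> linarith
    have h4 := neg_abs_le (σ * ((Real.exp (z / 2) - Real.exp (x / 2)) * Real.sin (y / 2)))
    have h5 : -(Real.exp (x / 2) * |Real.sin (y / 2)|) ≤ σ * ((Real.exp (z / 2) - Real.exp (x / 2)) * Real.sin (y / 2)) := by
      linarith
    have := mul_le_mul_of_nonneg_left h5 hl.le
    linarith
  obtain ⟨w1, -, hw1, -, hd1, hV1⟩ := c.step h hw (by rw [← hw]; exact hn0)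
    (ζ1 := ((-24:ℝ):ℂ) + y * Complex.I) (hnorm _ _ (by norm_num) (abs_le.2 ⟨by linarith, by linarith⟩)) (by
      have : ((-24:ℝ):ℂ) + y * Complex.I - (x + y * Complex.I) = ((-24 - x : ℝ) : ℂ) := by push_cast; ring
      rw [this, Complex.norm_real, Real.norm_eq_abs, abs_le]
      constructor <;> linarith) hσ hV (by
      intro t ht
      rw [hsg]
      have := hdiff (x + t * (-24 - x)) (by nlinarith [ht.1])
      linarith)
  have h24 := hdiff (-24) (by linarith)
  rw [abs_le] at hd1
  have hw1d : w1.re + l * (49/100000) ≤ τ := by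
    linarith
  have hpi := Real.pi_gt_three
  have hpi2 := Real.pi_lt_four
  have hexp24 : Real.exp (-24 / 2) ≤ 1 / 150000 := by
    have h1 : (150000:ℝ) ≤ Real.exp 12 := by
      have h2 : Real.exp 12 = Real.exp 1 ^ 12 := by rw [← Real.exp_nat_mul]; norm_num
      rw [h2]
      calc (150000:ℝ) ≤ 2.7 ^ 12 := by norm_num
        _ ≤ _ := by gcongr; linarith [Real.exp_one_gt_d9]
    have h3 : Real.exp (-24 / 2) = (Real.exp 12)⁻¹ := by rw [← Real.exp_neg]; norm_num
    rw [h3, one_div]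
    exact inv_anti₀ (by norm_num) h1
  have hh24 : ∀ v : ℝ, |hh (((-24:ℝ):ℂ) + v * Complex.I)| ≤ 4 / 150000 := by
    intro v
    rw [hh_eq, abs_mul, abs_mul]
    have h1 := Real.abs_sin_le_one (v / 2)
    have h2 : |Real.exp (-24 / 2)| ≤ 1 / 150000 := by rwa [abs_of_pos (Real.exp_pos _)]
    have h3 := mul_le_mul h2 h1 (abs_nonneg _) (by norm_num)
    rw [abs_of_pos (by norm_num : (0:ℝ) < 4)]
    linarith
  have hper : Complex.exp ((((-24:ℝ):ℂ) + (y + 4 * Real.pi : ℝ) * Complex.I) / 2) =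
      Complex.exp ((((-24:ℝ):ℂ) + y * Complex.I) / 2) := by
    have : (((-24:ℝ):ℂ) + (y + 4 * Real.pi : ℝ) * Complex.I) / 2 =
      (((-24:ℝ):ℂ) + y * Complex.I) / 2 + 2 * Real.pi * Complex.I := by push_cast; ring
    rw [this, Complex.exp_periodic]
  obtain ⟨w2, -, hw2, hE2, hd2, -⟩ := c.step h hw1
    (hnorm _ _ (by norm_num) (abs_le.2 ⟨by linarith, by linarith⟩))
    (ζ1 := ((-24:ℝ):ℂ) + (y + 4 * Real.pi : ℝ) * Complex.I)
    (hnorm _ _ (by norm_num) (abs_le.2 ⟨by linarith, by linarith⟩)) (by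
      have : ((-24:ℝ):ℂ) + (y + 4 * Real.pi : ℝ) * Complex.I - (((-24:ℝ):ℂ) + y * Complex.I) =
        ((4 * Real.pi : ℝ) : ℂ) * Complex.I := by push_cast; ring
      rw [this, norm_mul, Complex.norm_real, Real.norm_eq_abs, Complex.norm_I, abs_of_pos (by linarith)]
      linarith) hσ hV1 (by
      intro t ht
      have h1 : sg (((-24:ℝ):ℂ) + y * Complex.I) (((-24:ℝ):ℂ) + (y + 4 * Real.pi : ℝ) * Complex.I) t =
        ((-24:ℝ):ℂ) + (y + t * (4 * Real.pi) : ℝ) * Complex.I := by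
        simp [sg]; ring
      rw [h1]
      have h2 := abs_le.1 (hh24 (y + t * (4 * Real.pi)))
      have h3 := abs_le.1 (hh24 y)
      have h4 : |σ * (hh (((-24:ℝ):ℂ) + (y + t * (4 * Real.pi) : ℝ) * Complex.I) - hh (((-24:ℝ):ℂ) + y * Complex.I))|
          ≤ 8 / 150000 := by
        rw [abs_mul]
        have : |σ| = 1 := by rcases hσ with rfl | rfl <;> simp
        rw [this, one_mul, abs_le]
        constructor <;> linarith
      have h5 := mul_le_mul_of_nonneg_left (abs_le.1 h4).1 hl.le
      linarith)
  have hprd : prd w1 (((-24:ℝ):ℂ) + y * Complex.I) σ l (((-24:ℝ):ℂ) + (y + 4 * Real.pi : ℝ) * Complex.I) = w1 := by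
    unfold prd; rw [hper]; ring
  rw [hprd] at hE2
  have hE3 : ‖w2 - w1‖ ≤ l / 10 ^ 6 := hE2.trans c.E_le
  have hexp13 : Real.exp (25 / 2) < 10 ^ 6 := by
    calc Real.exp (25 / 2) ≤ Real.exp 13 := Real.exp_le_exp.2 (by norm_num)
      _ = Real.exp 1 ^ 13 := by rw [← Real.exp_nat_mul]; norm_num
      _ ≤ 2.72 ^ 13 := by gcongr; linarith [Real.exp_one_lt_d9]
      _ < _ := by norm_num
  have hdep : ∀ t ∈ Icc (0:ℝ) 1, (w1 + t * (w2 - w1)).re + l / 20000 ≤ τ := by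
    intro t ht
    have h1 := Complex.re_le_norm ((t:ℂ) * (w2 - w1))
    rw [norm_mul, Complex.norm_real, Real.norm_of_nonneg ht.1] at h1
    rw [Complex.add_re]
    have : t * ‖w2 - w1‖ ≤ ‖w2 - w1‖ := by nlinarith [ht.2, norm_nonneg (w2 - w1)]
    linarith
  have hder : ∀ t ∈ Icc (0:ℝ) 1, HasDerivAt (fun t : ℝ => φ (w1 + t * (w2 - w1)) - φ w1)
      (deriv φ (w1 + t * (w2 - w1)) * (w2 - w1)) t := by
    intro t ht
    have h1 : HasDerivAt (fun t : ℝ => (t:ℂ)) 1 t := Complex.ofRealCLM.hasDerivAt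
    have h2 : HasDerivAt (fun t : ℝ => w1 + (t:ℂ) * (w2 - w1)) (w2 - w1) t :=
      ((h1.mul_const (w2 - w1)).const_add w1).congr_deriv (one_mul _)
    have h3 : HasDerivAt φ (deriv φ (w1 + t * (w2 - w1))) (w1 + t * (w2 - w1)) :=
      (h.anφ (by linarith [hdep t ht])).differentiableAt.hasDerivAt
    exact (h3.comp_of_eq t h2 rfl).sub_const _
  have hfin := image_norm_le_of_norm_deriv_right_lt_deriv_boundary' (a := 0) (b := 1)
    (f := fun t : ℝ => φ (w1 + t * (w2 - w1)) - φ w1) (B := fun t => t) (B' := fun _ => 1)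
    (fun t ht => (hder t ht).continuousAt.continuousWithinAt)
    (fun t ht => (hder t ⟨ht.1, ht.2.le⟩).hasDerivWithinAt) (by simp) continuousOn_id
    (fun t _ => hasDerivWithinAt_id t _) (by
      intro t ht heq
      have ht' : t ∈ Icc (0:ℝ) 1 := ⟨ht.1, ht.2.le⟩
      set z := φ (w1 + t * (w2 - w1)) with hz
      have hzn : ‖z‖ ≤ M := by
        have h1 := norm_add_le (z - φ w1) (φ w1)
        rw [sub_add_cancel, heq, hw1] at h1
        have h2 : ‖((-24:ℝ):ℂ) + y * Complex.I‖ ≤ 24 + 8 := by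
          have := Complex.norm_le_abs_re_add_abs_im (((-24:ℝ):ℂ) + y * Complex.I : ℂ)
          simp at this
          have h3 : |y| ≤ 8 := abs_le.2 hy
          simp
          linarith
        linarith [ht.2]
      have hre : -25 ≤ z.re := by
        have h1 := Complex.abs_re_le_norm (z - φ w1)
        rw [heq, hw1, abs_le] at h1
        simp at h1
        linarith [ht.2]
      have h3 := c.dφ h (hdep t ht') hzn
      rw [norm_mul]
      calc _ ≤ Real.exp (25 / 2) / l * (l / 10 ^ 6) := by
            gcongr
            refine h3.trans ?_
            gcongr
            rw [← hz]; linarith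
        _ = Real.exp (25 / 2) / 10 ^ 6 := by field_simp
        _ < 1 := by rw [div_lt_one (by norm_num)]; exact hexp13)
    (right_mem_Icc.2 zero_le_one)
  simp only [Complex.ofReal_one, one_mul, add_sub_cancel] at hfin
  rw [hw1, hw2] at hfin
  have := Complex.abs_im_le_norm (((-24:ℝ):ℂ) + (y + 4 * Real.pi : ℝ) * Complex.I - (((-24:ℝ):ℂ) + y * Complex.I))
  simp at this hfin
  rw [abs_of_pos (by linarith)] at this
  linarith

end PartH3

section PartK

lemma max_princ {a b : ℝ} {g g1 g2 : ℝ → ℝ}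
    (h1 : ∀ t ∈ Icc a b, HasDerivAt g (g1 t) t) (h2 : ∀ t ∈ Icc a b, HasDerivAt g1 (g2 t) t)
    (ha : g a ≤ 0) (hb : g b ≤ 0) (hpos : ∀ t ∈ Ioo a b, 0 < g t → 0 < g2 t) :
    ∀ t ∈ Icc a b, g t ≤ 0 := by
  intro t ht
  by_contra hcon
  push Not at hcon
  obtain ⟨t0, ht0, hmax⟩ := isCompact_Icc.exists_isMaxOn ⟨t, ht⟩
    (fun x hx => (h1 x hx).continuousAt.continuousWithinAt : ContinuousOn g (Icc a b))
  have hg0 : 0 < g t0 := hcon.trans_le (hmax ht)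
  have hI : t0 ∈ Ioo a b := by
    refine ⟨lt_of_le_of_ne ht0.1 ?_, lt_of_le_of_ne ht0.2 ?_⟩
    · rintro rfl; linarith
    · rintro rfl; linarith
  have hnb : Ioo a b ∈ 𝓝 t0 := Ioo_mem_nhds hI.1 hI.2
  have hloc : IsLocalMax g t0 := by
    filter_upwards [hnb] with x hx using hmax (Ioo_subset_Icc_self hx)
  have hd0 : g1 t0 = 0 := hloc.hasDerivAt_eq_zero (h1 t0 ht0)
  have hde : deriv g =ᶠ[𝓝 t0] g1 := by
    filter_upwards [hnb] with x hx using (h1 x (Ioo_subset_Icc_self hx)).deriv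
  have hdd : deriv (deriv g) t0 = g2 t0 := by
    rw [hde.deriv_eq]; exact (h2 t0 ht0).deriv
  have hp := hpos t0 hI hg0
  have hmin := isLocalMin_of_deriv_deriv_pos (f := g) (x₀ := t0) (by rw [hdd]; exact hp)
    (by rw [(h1 t0 ht0).deriv, hd0]) (h1 t0 ht0).continuousAt
  have hconst : g =ᶠ[𝓝 t0] fun _ => g t0 := by
    filter_upwards [hloc, hmin] with x hx hx' using le_antisymm hx hx'
  have h3 : deriv g =ᶠ[𝓝 t0] fun _ => 0 := by
    have := hconst.deriv
    simpa using this
  have h4 : deriv (deriv g) t0 = 0 := by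
    rw [h3.deriv_eq]; simp
  rw [hdd] at h4
  linarith

lemma decay {a b k A : ℝ} {g g1 g2 : ℝ → ℝ} (hk : 0 < k) (hA : 0 ≤ A)
    (h1 : ∀ t ∈ Icc a b, HasDerivAt g (g1 t) t) (h2 : ∀ t ∈ Icc a b, HasDerivAt g1 (g2 t) t)
    (ha : g a ≤ A) (hb : g b ≤ A) (hpos : ∀ t ∈ Icc a b, k ^ 2 * g t ≤ g2 t) :
    ∀ t ∈ Icc a b, g t ≤ A * (Real.exp (k * (t - b)) + Real.exp (k * (a - t))) := by
  have he1 : ∀ t, HasDerivAt (fun t => Real.exp (k * (t - b))) (k * Real.exp (k * (t - b))) t := by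
    intro t
    have := (((hasDerivAt_id t).sub_const b).const_mul k).exp
    exact this.congr_deriv (by simp [mul_comm])
  have he2 : ∀ t, HasDerivAt (fun t => Real.exp (k * (a - t))) (-k * Real.exp (k * (a - t))) t := by
    intro t
    have := (((hasDerivAt_id t).const_sub a).const_mul k).exp
    exact this.congr_deriv (by simp [mul_comm])
  have := max_princ (a := a) (b := b)
    (g := fun t => g t - A * (Real.exp (k * (t - b)) + Real.exp (k * (a - t))))
    (g1 := fun t => g1 t - A * (k * Real.exp (k * (t - b)) + -k * Real.exp (k * (a - t))))
    (g2 := fun t => g2 t - A * (k * (k * Real.exp (k * (t - b))) + -k * (-k * Real.exp (k * (a - t)))))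
    (fun t ht => (h1 t ht).sub (((he1 t).add (he2 t)).const_mul A))
    (fun t ht => (h2 t ht).sub ((((he1 t).const_mul k).add ((he2 t).const_mul (-k))).const_mul A))
    (by
      have := Real.exp_pos (k * (a - b))
      simp only [sub_self, mul_zero, Real.exp_zero]
      nlinarith)
    (by
      have := Real.exp_pos (k * (a - b))
      simp only [sub_self, mul_zero, Real.exp_zero]
      nlinarith)
    (by
      intro t ht hp
      have h3 := hpos t (Ioo_subset_Icc_self ht)
      have : 0 < k ^ 2 * (g t - A * (Real.exp (k * (t - b)) + Real.exp (k * (a - t)))) := by positivity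
      nlinarith)
  intro t ht
  have := this t ht
  linarith

lemma lemmaK {a h k A : ℝ} {N N1 N2 : ℝ → ℝ} (hh : 0 < h) (hk : 0 < k)
    (h1 : ∀ t ∈ Icc a (a + 4 * h), HasDerivAt N (N1 t) t)
    (h2 : ∀ t ∈ Icc a (a + 4 * h), HasDerivAt N1 (N2 t) t)
    (hN : ∀ t ∈ Icc a (a + 4 * h), 0 < N t)
    (ha : N a ≤ A) (hb : N (a + 4 * h) ≤ A)
    (hp1 : ∀ t ∈ Icc a (a + 4 * h), k ^ 2 * N t ≤ N2 t)
    (hp2 : ∀ t ∈ Icc a (a + 4 * h), 2 / N t ≤ N2 t) : h / 4 * Real.exp (k * h) ≤ A := by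
  have hA : 0 < A := (hN a ⟨le_rfl, by linarith⟩).trans_le ha
  set c := 2 * A * Real.exp (-(k * h)) with hc
  have hc0 : 0 < c := by positivity
  have hle : ∀ t ∈ Icc (a + h) (a + 3 * h), N t ≤ c := by
    intro t ht
    have := decay hk hA.le h1 h2 ha hb hp1 t ⟨by linarith [ht.1], by linarith [ht.2]⟩
    have e1 : Real.exp (k * (t - (a + 4 * h))) ≤ Real.exp (-(k * h)) :=
      Real.exp_le_exp.2 (by nlinarith [ht.2])
    have e2 : Real.exp (k * (a - t)) ≤ Real.exp (-(k * h)) :=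
      Real.exp_le_exp.2 (by nlinarith [ht.1])
    rw [hc]; nlinarith
  have hsub : ∀ t ∈ Icc (a + h) (a + 3 * h), t ∈ Icc a (a + 4 * h) :=
    fun t ht => ⟨by linarith [ht.1], by linarith [ht.2]⟩
  have hd1 : ∀ t, HasDerivAt (fun t => ((t - (a + 2 * h)) ^ 2 - h ^ 2) / (2 * c)) ((t - (a + 2 * h)) / c) t := by
    intro t
    have := ((((hasDerivAt_id t).sub_const (a + 2 * h)).pow 2).sub_const (h ^ 2)).div_const (2 * c)
    exact this.congr_deriv (by simp; field_simp)
  have hd2 : ∀ t, HasDerivAt (fun t => (t - (a + 2 * h)) / c) (1 / c) t := fun t =>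
    ((hasDerivAt_id t).sub_const (a + 2 * h)).div_const c
  have := max_princ (a := a + h) (b := a + 3 * h)
    (fun t ht => ((h1 t (hsub t ht)).sub_const c).sub (hd1 t))
    (fun t ht => (h2 t (hsub t ht)).sub (hd2 t))
    (by
      have := hle (a + h) ⟨le_rfl, by linarith⟩
      have e : ((a + h - (a + 2 * h)) ^ 2 - h ^ 2) / (2 * c) = 0 := by ring_nf
      simp only [Pi.sub_apply]
      rw [e]; linarith)
    (by
      have := hle (a + 3 * h) ⟨by linarith, le_rfl⟩
      have e : ((a + 3 * h - (a + 2 * h)) ^ 2 - h ^ 2) / (2 * c) = 0 := by ring_nf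
      simp only [Pi.sub_apply]
      rw [e]; linarith)
    (by
      intro t ht _
      have ht' := Ioo_subset_Icc_self ht
      have e1 := hp2 t (hsub t ht')
      have e2 : 2 / c ≤ 2 / N t := by
        have := hN t (hsub t ht')
        have := hle t ht'
        gcongr
      have e3 : 2 / c = 1 / c + 1 / c := by ring
      have e4 : 0 < 1 / c := by positivity
      linarith)
    (a + 2 * h) ⟨by linarith, by linarith⟩
  simp only [Pi.sub_apply] at this
  have hm := hN (a + 2 * h) ⟨by linarith, by linarith⟩
  have e : ((a + 2 * h - (a + 2 * h)) ^ 2 - h ^ 2) / (2 * c) = - (h ^ 2 / (2 * c)) := by ring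
  rw [e] at this
  have h5 : h ^ 2 / (2 * c) < c := by linarith
  rw [div_lt_iff₀ (by positivity)] at h5
  have h6 : h / 2 ≤ c := by
    by_contra hcon
    push Not at hcon
    nlinarith
  have h7 : Real.exp (-(k * h)) * Real.exp (k * h) = 1 := by rw [← Real.exp_add]; simp
  have h8 := mul_le_mul_of_nonneg_right h6 (Real.exp_pos (k * h)).le
  rw [hc, mul_assoc (2 * A), h7] at h8
  linarith

def Nn (F : ℂ → ℂ) (a : ℂ) (α β : ℝ) (ζ : ℂ) : ℝ := (α * ‖F ζ - a‖ ^ 2 + β) * ‖deriv F ζ‖⁻¹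

def Nn1 (F : ℂ → ℂ) (a : ℂ) (α β : ℝ) (ζ : ℂ) : ℝ :=
  (-2 * α * (starRingEnd ℂ (F ζ - a) * deriv F ζ).im
    + (α * ‖F ζ - a‖ ^ 2 + β) * (deriv (deriv F) ζ / deriv F ζ).im) * ‖deriv F ζ‖⁻¹

def Nn2 (F : ℂ → ℂ) (a : ℂ) (α β : ℝ) (ζ : ℂ) : ℝ :=
  (2 * α * (‖deriv F ζ‖ ^ 2 - (starRingEnd ℂ (F ζ - a) * deriv (deriv F) ζ).re)
    + (-2 * α * (starRingEnd ℂ (F ζ - a) * deriv F ζ).im) * (deriv (deriv F) ζ / deriv F ζ).im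
    + (α * ‖F ζ - a‖ ^ 2 + β) * (schwarzian F ζ + 1 / 2 * (deriv (deriv F) ζ / deriv F ζ) ^ 2).re) * ‖deriv F ζ‖⁻¹
  + Nn1 F a α β ζ * (deriv (deriv F) ζ / deriv F ζ).im

lemma line_deriv {G : ℂ → ℂ} {x y : ℝ} (hG : AnalyticAt ℂ G (x + y * Complex.I)) :
    HasDerivAt (fun t : ℝ => G (x + t * Complex.I)) (Complex.I * deriv G (x + y * Complex.I)) y := by
  have h1 : HasDerivAt (fun t : ℝ => (t:ℂ)) 1 y := Complex.ofRealCLM.hasDerivAt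
  have h2 : HasDerivAt (fun t : ℝ => (x:ℂ) + (t:ℂ) * Complex.I) Complex.I y :=
    ((h1.mul_const Complex.I).const_add (x:ℂ)).congr_deriv (one_mul _)
  exact (hG.differentiableAt.hasDerivAt.comp_of_eq y h2 rfl).congr_deriv (mul_comm _ _)

lemma hasDerivAt_re {u : ℝ → ℂ} {u' : ℂ} {y : ℝ} (h : HasDerivAt u u' y) :
    HasDerivAt (fun t => (u t).re) u'.re y :=
  (Complex.reCLM.hasFDerivAt.comp_hasDerivAt y h)

lemma hasDerivAt_im {u : ℝ → ℂ} {u' : ℂ} {y : ℝ} (h : HasDerivAt u u' y) :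
    HasDerivAt (fun t => (u t).im) u'.im y :=
  (Complex.imCLM.hasFDerivAt.comp_hasDerivAt y h)

lemma hasDerivAt_nsq {u : ℝ → ℂ} {u' : ℂ} {y : ℝ} (h : HasDerivAt u u' y) :
    HasDerivAt (fun t => ‖u t‖ ^ 2) (2 * (starRingEnd ℂ (u y) * u').re) y := by
  have h1 := ((hasDerivAt_re h).fun_mul (hasDerivAt_re h)).add ((hasDerivAt_im h).fun_mul (hasDerivAt_im h))
  have h2 : (fun t => ‖u t‖ ^ 2) = fun t => (u t).re * (u t).re + (u t).im * (u t).im := by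
    funext t; rw [← Complex.normSq_eq_norm_sq, Complex.normSq_apply]
  rw [h2]
  refine h1.congr_deriv ?_
  simp; ring

lemma hasDerivAt_ninv {u : ℝ → ℂ} {u' : ℂ} {y : ℝ} (h : HasDerivAt u u' y) (h0 : u y ≠ 0) :
    HasDerivAt (fun t => ‖u t‖⁻¹) (-(u' / u y).re * ‖u y‖⁻¹) y := by
  have h1 := (hasDerivAt_nsq h).sqrt (by positivity)
  have h2 : (fun t => √(‖u t‖ ^ 2)) = fun t => ‖u t‖ := by
    funext t; exact Real.sqrt_sq (norm_nonneg _)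
  rw [h2] at h1
  have h3 := h1.inv (norm_ne_zero_iff.2 h0)
  refine h3.congr_deriv ?_
  rw [Real.sqrt_sq (norm_nonneg _)]
  have hn := norm_ne_zero_iff.2 h0
  have h4 : (u' / u y).re = (starRingEnd ℂ (u y) * u').re / ‖u y‖ ^ 2 := by
    rw [Complex.div_re, ← Complex.normSq_eq_norm_sq]
    simp; ring
  rw [h4]; field_simp

lemma line_Nn {F : ℂ → ℂ} {x y : ℝ} (a : ℂ) (α β : ℝ) (hF : AnalyticAt ℂ F (x + y * Complex.I))
    (h0 : deriv F (x + y * Complex.I) ≠ 0) :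
    HasDerivAt (fun t : ℝ => Nn F a α β (x + t * Complex.I)) (Nn1 F a α β (x + y * Complex.I)) y ∧
    HasDerivAt (fun t : ℝ => Nn1 F a α β (x + t * Complex.I)) (Nn2 F a α β (x + y * Complex.I)) y := by
  have u1 : HasDerivAt (fun t : ℝ => F (x + t * Complex.I) - a) _ y := (line_deriv hF).sub_const a
  have G1 := line_deriv hF.deriv
  have H1 := line_deriv hF.deriv.deriv
  have D1 := hasDerivAt_ninv G1 h0
  have D1' : HasDerivAt (fun t : ℝ => ‖deriv F (x + t * Complex.I)‖⁻¹)
      ((deriv (deriv F) (x + y * Complex.I) / deriv F (x + y * Complex.I)).im *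
        ‖deriv F (x + y * Complex.I)‖⁻¹) y := by
    refine D1.congr_deriv ?_
    rw [mul_div_assoc]; simp
  have P1 := ((hasDerivAt_nsq u1).const_mul α).add_const β
  have cj : HasDerivAt (fun t : ℝ => starRingEnd ℂ (F (x + t * Complex.I) - a))
      (starRingEnd ℂ (Complex.I * deriv F (x + y * Complex.I))) y :=
    (Complex.conjCLE.toContinuousLinearMap.hasFDerivAt.comp_hasDerivAt y u1)
  have Q1 : HasDerivAt (fun t : ℝ => deriv (deriv F) (x + t * Complex.I) / deriv F (x + t * Complex.I))
      (Complex.I * (schwarzian F (x + y * Complex.I) + 1 / 2 *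
        (deriv (deriv F) (x + y * Complex.I) / deriv F (x + y * Complex.I)) ^ 2)) y := by
    refine (H1.fun_div G1 h0).congr_deriv ?_
    unfold schwarzian; field_simp; ring
  have C1 := hasDerivAt_im (cj.fun_mul G1)
  have hN1 := P1.fun_mul D1'
  refine ⟨hN1.congr_deriv ?_, ?_⟩
  · simp only [Nn1]; simp; ring
  · have := (((C1.const_mul (-2 * α)).fun_add (P1.fun_mul (hasDerivAt_im Q1))).fun_mul D1')
    refine this.congr_deriv ?_
    have hn : ‖deriv F (x + y * Complex.I)‖ ^ 2 = (deriv F (x + y * Complex.I)).re ^ 2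
        + (deriv F (x + y * Complex.I)).im ^ 2 := by
      rw [← Complex.normSq_eq_norm_sq, Complex.normSq_apply]; ring
    simp only [Nn2, Nn1, hn]
    generalize (deriv (deriv F) (x + y * Complex.I) / deriv F (x + y * Complex.I)) = q
    generalize schwarzian F (x + y * Complex.I) + 1 / 2 * q ^ 2 = s
    generalize deriv F (x + y * Complex.I) = G
    generalize deriv (deriv F) (x + y * Complex.I) = H
    generalize F (x + y * Complex.I) - a = u
    simp only [Complex.mul_re, Complex.mul_im, Complex.conj_re, Complex.conj_im, Complex.add_im,
      Complex.I_re, Complex.I_im]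
    ring

lemma Nn2_ge {F : ℂ → ℂ} {ζ a : ℂ} {α β : ℝ} (hα : 0 ≤ α) (hβ : 0 ≤ β) (h0 : deriv F ζ ≠ 0)
    (hN : 0 < Nn F a α β ζ) :
    (schwarzian F ζ).re * Nn F a α β ζ + 2 * (α * β) / Nn F a α β ζ ≤ Nn2 F a α β ζ := by
  have hn0 : 0 < ‖deriv F ζ‖ := norm_pos_iff.2 h0
  set D := ‖deriv F ζ‖⁻¹ with hD
  have hD0 : 0 < D := inv_pos.2 hn0
  set G := deriv F ζ with hG
  set q := deriv (deriv F) ζ / G with hq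
  have hH : deriv (deriv F) ζ = q * G := by rw [hq]; field_simp
  set u := F ζ - a with hu
  have hnG : ‖G‖ ^ 2 = G.re ^ 2 + G.im ^ 2 := by
    rw [← Complex.normSq_eq_norm_sq, Complex.normSq_apply]; ring
  have hnu : ‖u‖ ^ 2 = u.re ^ 2 + u.im ^ 2 := by
    rw [← Complex.normSq_eq_norm_sq, Complex.normSq_apply]; ring
  set X1 := G.re - (q.re * u.re - q.im * u.im) / 2 with hX1
  set X2 := G.im - (q.re * u.im + q.im * u.re) / 2 with hX2
  set K := α * (X1 ^ 2 + X2 ^ 2) + β * ((q.re ^ 2 + q.im ^ 2) / 4) with hK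
  set T := α * ‖u‖ ^ 2 + β with hT
  have hNT : Nn F a α β ζ = T * D := rfl
  have hid : Nn2 F a α β ζ = (schwarzian F ζ).re * (T * D) + 2 * K * D := by
    simp only [Nn2, Nn1]
    simp only [← hG, ← hu, ← hD, hH, ← hT]
    have : q * G / G = q := by field_simp
    rw [this, hnG]
    rw [Complex.add_re]
    have e : (1 / 2 * q ^ 2 : ℂ).re = (q.re ^ 2 - q.im ^ 2) / 2 := by
      rw [pow_two]; simp [Complex.mul_re]; ring
    rw [e, hK, hX1, hX2, hT, hnu]
    simp only [Complex.mul_re, Complex.mul_im, Complex.conj_re, Complex.conj_im]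
    ring
  have hTp : 0 < T := by
    rw [hNT] at hN; exact pos_of_mul_pos_left hN hD0.le
  have hcs : α * β * ‖G‖ ^ 2 ≤ K * T := by
    rw [hnG, hK, hT, hnu]
    have hGr : G.re = X1 + (q.re * u.re - q.im * u.im) / 2 := by rw [hX1]; ring
    have hGi : G.im = X2 + (q.re * u.im + q.im * u.re) / 2 := by rw [hX2]; ring
    rw [hGr, hGi]
    have key : (α * (X1 ^ 2 + X2 ^ 2) + β * ((q.re ^ 2 + q.im ^ 2) / 4)) * (α * (u.re ^ 2 + u.im ^ 2) + β)
      - α * β * ((X1 + (q.re * u.re - q.im * u.im) / 2) ^ 2 + (X2 + (q.re * u.im + q.im * u.re) / 2) ^ 2)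
      = (α * (X1 * u.re + X2 * u.im) - β * q.re / 2) ^ 2 + (α * (X2 * u.re - X1 * u.im) - β * q.im / 2) ^ 2 := by
      ring
    linarith [sq_nonneg (α * (X1 * u.re + X2 * u.im) - β * q.re / 2),
      sq_nonneg (α * (X2 * u.re - X1 * u.im) - β * q.im / 2)]
  rw [hid, hNT]
  have hDG : D * ‖G‖ = 1 := inv_mul_cancel₀ hn0.ne'
  have : 2 * (α * β) / (T * D) ≤ 2 * K * D := by
    rw [div_le_iff₀ (by positivity)]
    have h1 : α * β = α * β * ‖G‖ ^ 2 * D ^ 2 := by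
      rw [mul_assoc, ← mul_pow, mul_comm ‖G‖, hDG]; ring
    calc 2 * (α * β) = 2 * (α * β * ‖G‖ ^ 2) * D ^ 2 := by linear_combination 2 * h1
      _ ≤ 2 * (K * T) * D ^ 2 := by gcongr
      _ = _ := by ring
  linarith

end PartK

section PartU

def HDp (F : ℂ → ℂ) (S : Set ℂ) (τ C0 M : ℝ) : Prop :=
  ∀ ζ, ‖ζ‖ ≤ M → AnalyticAt ℂ F ζ → F ζ ∉ S → deriv F ζ ≠ 0 →
    (Nn F 0 1 1 ζ) ^ 2 * ‖schwarzian F ζ / 2‖ ≤ C0 ∨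
    ∃ a ∈ S, ∃ φ w, IsTract F φ a τ ∧ w.re < τ ∧ φ w = ζ ∧
      (Nn F 0 1 1 ζ) ^ 2 * ‖schwarzian F ζ / 2‖ ≤ C0 * Real.exp (2 * (τ - w.re))

structure LCtx (F : ℂ → ℂ) (S : Set ℂ) (l ε M τ C0 x0 : ℝ) : Prop extends SCtx F l ε M where
  hD : HDp F S τ C0 M
  hl4 : 10 ^ 4 ≤ l
  hC0 : 0 ≤ C0
  hlC : 2 * C0 ≤ l ^ 2
  hτ : τ ≤ 0
  hx0 : 0 < x0
  hx1 : x0 < 1 / 100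
  an : ∀ y ∈ Icc (-(1/100):ℝ) (1/100), AnalyticAt ℂ F (x0 + y * Complex.I)
  dn : ∀ y ∈ Icc (-(1/100):ℝ) (1/100), deriv F (x0 + y * Complex.I) ≠ 0
  nS : ∀ y ∈ Icc (-(1/100):ℝ) (1/100), F (x0 + y * Complex.I) ∉ S

section U
variable {F : ℂ → ℂ} {S : Set ℂ} {l ε M τ C0 x0 : ℝ}

lemma norm_xy {M : ℝ} (hM : 60 ≤ M) {x y : ℝ} (hx : |x| ≤ 3) (hy : |y| ≤ 8) : ‖(x + y * Complex.I : ℂ)‖ ≤ M := by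
  have := Complex.norm_le_abs_re_add_abs_im (x + y * Complex.I : ℂ)
  simp at this; linarith

lemma LCtx.nrm (L : LCtx F S l ε M τ C0 x0) {y : ℝ} (hy : |y| ≤ 8) : ‖(x0 + y * Complex.I : ℂ)‖ ≤ M :=
  norm_xy L.hM (by rw [abs_of_pos L.hx0]; linarith [L.hx1]) hy

lemma LCtx.expx (L : LCtx F S l ε M τ C0 x0) : 1 ≤ Real.exp (x0 / 2) ∧ Real.exp (x0 / 2) ≤ 1.01 := by
  have h0 := L.hx0
  have h1 := L.hx1
  refine ⟨Real.one_le_exp (by linarith), ?_⟩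
  have := Real.exp_bound_div_one_sub_of_interval (x := x0 / 2) (by linarith) (by linarith)
  refine this.trans ?_
  rw [div_le_iff₀ (by linarith)]; linarith

lemma LCtx.reS (L : LCtx F S l ε M τ C0 x0) {y : ℝ} (hy : y ∈ Icc (-(1/100):ℝ) (1/100)) :
    l ^ 2 ≤ (schwarzian F (x0 + y * Complex.I)).re ∧ l ^ 2 / 2 ≤ ‖schwarzian F (x0 + y * Complex.I) / 2‖ := by
  have hy' : |y| ≤ 1/100 := abs_le.2 hy
  have h1 := L.hB _ (L.nrm (y := y) (by linarith)) (L.an y hy)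
  have hre : (Complex.exp (x0 + y * Complex.I)).re = Real.exp x0 * Real.cos y := by
    rw [Complex.exp_re]; simp
  have hn : ‖Complex.exp (x0 + y * Complex.I)‖ = Real.exp x0 := by
    rw [Complex.norm_exp]; simp
  rw [hn] at h1
  have h2 := Complex.abs_re_le_norm (schwarzian F (x0 + y * Complex.I) / 2 - l ^ 2 * Complex.exp (x0 + y * Complex.I))
  have h3 : (schwarzian F (x0 + y * Complex.I) / 2 - l ^ 2 * Complex.exp (x0 + y * Complex.I)).re =
      (schwarzian F (x0 + y * Complex.I)).re / 2 - l ^ 2 * (Real.exp x0 * Real.cos y) := by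
    rw [Complex.sub_re, ← hre, ← Complex.ofReal_pow, Complex.re_ofReal_mul]
    simp
  rw [h3, abs_le] at h2
  have hcos := Real.one_sub_sq_div_two_le_cos (x := y)
  have hy2 : y ^ 2 ≤ 1 := by nlinarith [hy.1, hy.2]
  have hex := Real.one_le_exp L.hx0.le
  have hε := L.hε
  have hl2 : 0 < l ^ 2 := pow_pos L.hl 2
  have hy3 : y ^ 2 ≤ 1/100 := by nlinarith [hy.1, hy.2]
  have h4 : l ^ 2 / 2 ≤ l ^ 2 * (Real.exp x0 * (Real.cos y - ε)) := by
    have : 1 / 2 ≤ Real.exp x0 * (Real.cos y - ε) := by nlinarith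
    nlinarith
  have h5 : l ^ 2 / 2 ≤ (schwarzian F (x0 + y * Complex.I)).re / 2 := by
    nlinarith [h2.1]
  refine ⟨by linarith, h5.trans ?_⟩
  have := Complex.re_le_norm (schwarzian F (x0 + y * Complex.I) / 2)
  simpa using this

lemma Nn_pos {ζ a : ℂ} {α β : ℝ} (hα : 0 ≤ α) (hβ : 0 < β) (h : deriv F ζ ≠ 0) : 0 < Nn F a α β ζ := by
  have := norm_pos_iff.2 h
  unfold Nn; positivity

lemma LCtx.upper (L : LCtx F S l ε M τ C0 x0) {y : ℝ} (hy : y ∈ Icc (-(1/100):ℝ) (1/100)) :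
    Nn F 0 1 1 (x0 + y * Complex.I) ≤ Real.exp (l * (2.02 * |y| + 1 / 2000)) := by
  have hy' : |y| ≤ 1/100 := abs_le.2 hy
  have hB := (L.reS hy).2
  have hN := Nn_pos (F := F) (ζ := x0 + y * Complex.I) (a := 0) zero_le_one one_pos (L.dn y hy)
  have hlC := L.hlC
  have hC0 := L.hC0
  have hl := L.hl
  have hl2 : 0 < l ^ 2 := pow_pos L.hl 2
  set N := Nn F 0 1 1 (x0 + y * Complex.I)
  have key : ∀ d, 0 ≤ d → d ≤ l * (2.02 * |y| + 1 / 2000) →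
      N ^ 2 * ‖schwarzian F (x0 + y * Complex.I) / 2‖ ≤ C0 * Real.exp (2 * d) → N ≤ Real.exp (l * (2.02 * |y| + 1 / 2000)) := by
    intro d _ hd h
    have h1 : N ^ 2 * (l ^ 2 / 2) ≤ (l ^ 2 / 2) * Real.exp (2 * d) := by
      calc _ ≤ N ^ 2 * ‖schwarzian F (x0 + y * Complex.I) / 2‖ := by gcongr
        _ ≤ C0 * Real.exp (2 * d) := h
        _ ≤ _ := by gcongr; linarith
    have h2 : N ^ 2 ≤ Real.exp d ^ 2 := by
      have : Real.exp d ^ 2 = Real.exp (2 * d) := by rw [← Real.exp_nat_mul]; norm_num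
      rw [this]
      have h3 : N ^ 2 * (l ^ 2 / 2) ≤ Real.exp (2 * d) * (l ^ 2 / 2) := by linarith
      exact le_of_mul_le_mul_right h3 (by positivity)
    have h3 : N ≤ Real.exp d := by
      exact (pow_le_pow_iff_left₀ hN.le (Real.exp_pos d).le two_ne_zero).1 h2
    exact h3.trans (Real.exp_le_exp.2 hd)
  rcases L.hD _ (L.nrm (y := y) (by linarith)) (L.an y hy) (L.nS y hy) (L.dn y hy) with h | ⟨a, _, φ, w, ht, hw, hφ, h⟩
  · exact key 0 le_rfl (by positivity) (by simpa using h)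
  · refine key (τ - w.re) (by linarith) ?_ h
    have h1 := L.toSCtx.W ht hφ (by rw [abs_of_pos L.hx0]; linarith [L.hx1]) (by linarith) hw
    refine h1.trans ?_
    have h2 : |Real.sin (y / 2)| ≤ |y| / 2 := by
      have := Real.abs_sin_le_abs (x := y / 2)
      rwa [abs_div, abs_of_pos (two_pos : (0:ℝ) < 2)] at this
    have h3 := mul_le_mul L.expx.2 h2 (abs_nonneg _) (by norm_num)
    apply mul_le_mul_of_nonneg_left _ hl.le
    linarith

lemma LCtx.lineN (L : LCtx F S l ε M τ C0 x0) (a : ℂ) {α β : ℝ} (hα : 0 ≤ α) (hβ : 0 ≤ β)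
    (hpos : ∀ y ∈ Icc (-(1/100):ℝ) (1/100), 0 < Nn F a α β (x0 + y * Complex.I)) :
    ∀ y ∈ Icc (-(1/100):ℝ) (1/100),
      HasDerivAt (fun t : ℝ => Nn F a α β (x0 + t * Complex.I)) (Nn1 F a α β (x0 + y * Complex.I)) y ∧
      HasDerivAt (fun t : ℝ => Nn1 F a α β (x0 + t * Complex.I)) (Nn2 F a α β (x0 + y * Complex.I)) y ∧
      l ^ 2 * Nn F a α β (x0 + y * Complex.I) ≤ Nn2 F a α β (x0 + y * Complex.I) ∧
      2 * (α * β) / Nn F a α β (x0 + y * Complex.I) ≤ Nn2 F a α β (x0 + y * Complex.I) := by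
  intro y hy
  obtain ⟨h1, h2⟩ := line_Nn a α β (L.an y hy) (L.dn y hy)
  have h3 := Nn2_ge hα hβ (L.dn y hy) (hpos y hy)
  have h4 := (L.reS hy).1
  have h5 := hpos y hy
  have h6 : 0 ≤ 2 * (α * β) / Nn F a α β (x0 + y * Complex.I) := by positivity
  have h7 : l ^ 2 * Nn F a α β (x0 + y * Complex.I) ≤
    (schwarzian F (x0 + y * Complex.I)).re * Nn F a α β (x0 + y * Complex.I) := by gcongr
  have h8 : 0 ≤ l ^ 2 * Nn F a α β (x0 + y * Complex.I) := by positivity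
  exact ⟨h1, h2, by linarith, by linarith⟩

lemma LCtx.exp_big (L : LCtx F S l ε M τ C0 x0) : 20000 < Real.exp (l / 1000) := by
  have h1 : Real.exp 10 ≤ Real.exp (l / 1000) := Real.exp_le_exp.2 (by linarith [L.hl4])
  have h2 : Real.exp 10 = Real.exp 1 ^ 10 := by rw [← Real.exp_nat_mul]; norm_num
  have h3 : (2.7:ℝ) ^ 10 ≤ Real.exp 1 ^ 10 := by gcongr; linarith [Real.exp_one_gt_d9]
  have h4 : (20000:ℝ) < 2.7 ^ 10 := by norm_num
  linarith

lemma LCtx.big (L : LCtx F S l ε M τ C0 x0) {η : ℝ} (hη : η = 1 ∨ η = -1) :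
    Real.exp (l / 1000) < Nn F 0 1 1 (x0 + (η * (1/100) : ℝ) * Complex.I) := by
  by_contra hcon
  push Not at hcon
  have hpos : ∀ y ∈ Icc (-(1/100):ℝ) (1/100), 0 < Nn F 0 1 1 (x0 + y * Complex.I) := fun y hy =>
    Nn_pos (F := F) (ζ := x0 + y * Complex.I) (a := 0) zero_le_one one_pos (L.dn y hy)
  have hl := L.hl
  have h0 : Nn F 0 1 1 (x0 + (0:ℝ) * Complex.I) ≤ Real.exp (l / 1000) := by
    refine (L.upper (y := 0) (by norm_num)).trans (Real.exp_le_exp.2 ?_)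
    simp; linarith
  have hl1 := L.lineN 0 zero_le_one zero_le_one hpos
  have key : ∀ a : ℝ, (∀ t ∈ Icc a (a + 4 * (1/400)), t ∈ Icc (-(1/100):ℝ) (1/100)) →
      Nn F 0 1 1 (x0 + a * Complex.I) ≤ Real.exp (l / 1000) →
      Nn F 0 1 1 (x0 + (a + 4 * (1/400) : ℝ) * Complex.I) ≤ Real.exp (l / 1000) → False := by
    intro a ha ha1 ha2
    have := lemmaK (a := a) (h := 1/400) (k := l) (by norm_num) hl (fun t ht => (hl1 t (ha t ht)).1)
      (fun t ht => (hl1 t (ha t ht)).2.1) (fun t ht => hpos t (ha t ht)) ha1 ha2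
      (fun t ht => (hl1 t (ha t ht)).2.2.1) (fun t ht => by simpa using (hl1 t (ha t ht)).2.2.2)
    have h3 : Real.exp (l / 1000) ^ 2 ≤ Real.exp (l * (1/400)) := by
      rw [← Real.exp_nat_mul]; apply Real.exp_le_exp.2; push_cast; linarith
    have h4 := L.exp_big
    nlinarith
  rcases hη with rfl | rfl
  · refine key 0 (fun t ht => ⟨by linarith [ht.1], by linarith [ht.2]⟩) h0 ?_
    rw [show ((0:ℝ) + 4 * (1/400)) = 1 * (1/100) by norm_num]; exact hcon
  · refine key (-(1/100)) (fun t ht => ⟨by linarith [ht.1], by linarith [ht.2]⟩) ?_ ?_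
    · rw [show (-(1/100) : ℝ) = -1 * (1/100) by norm_num]; exact hcon
    · rw [show (-(1/100) + 4 * (1/400) : ℝ) = 0 by norm_num]; exact h0

lemma LCtx.enter (L : LCtx F S l ε M τ C0 x0) {η : ℝ} (hη : η = 1 ∨ η = -1) :
    ∃ a ∈ S, ∃ φ w, IsTract F φ a τ ∧ w.re + l / 1000 ≤ τ ∧ φ w = x0 + (η * (1/100) : ℝ) * Complex.I := by
  have hy : η * (1/100) ∈ Icc (-(1/100):ℝ) (1/100) := by rcases hη with rfl | rfl <;> norm_num
  have hy' : |η * (1/100)| ≤ 1/100 := abs_le.2 hy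
  have hbig := L.big hη
  have hB := (L.reS hy).2
  have hlC := L.hlC
  have hl := L.hl
  have hl2 : 0 < l ^ 2 := pow_pos L.hl 2
  have key : ∀ d, d ≤ l / 1000 →
      (Nn F 0 1 1 (x0 + (η * (1/100) : ℝ) * Complex.I)) ^ 2 * ‖schwarzian F (x0 + (η * (1/100) : ℝ) * Complex.I) / 2‖
        ≤ C0 * Real.exp (2 * d) → False := by
    intro d hd h
    have h1 : Real.exp (2 * d) ≤ Real.exp (l / 1000) ^ 2 := by
      rw [← Real.exp_nat_mul]; apply Real.exp_le_exp.2; push_cast; linarith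
    have h2 : Real.exp (l / 1000) ^ 2 < (Nn F 0 1 1 (x0 + (η * (1/100) : ℝ) * Complex.I)) ^ 2 :=
      pow_lt_pow_left₀ hbig (Real.exp_pos _).le two_ne_zero
    have h3 : C0 * Real.exp (2 * d) ≤ l ^ 2 / 2 * Real.exp (2 * d) := by gcongr; linarith
    have h4 : (Nn F 0 1 1 (x0 + (η * (1/100) : ℝ) * Complex.I)) ^ 2 * (l ^ 2 / 2) ≤
      (Nn F 0 1 1 (x0 + (η * (1/100) : ℝ) * Complex.I)) ^ 2 * ‖schwarzian F (x0 + (η * (1/100) : ℝ) * Complex.I) / 2‖ := by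
      gcongr
    nlinarith
  rcases L.hD _ (L.nrm (by linarith)) (L.an _ hy) (L.nS _ hy) (L.dn _ hy) with h | ⟨a, ha, φ, w, ht, hw, hφ, h⟩
  · exact (key 0 (by positivity) (by simpa using h)).elim
  · refine ⟨a, ha, φ, w, ht, ?_, hφ⟩
    by_contra hc
    exact key (τ - w.re) (by linarith) h

lemma LCtx.hhv (L : LCtx F S l ε M τ C0 x0) {η : ℝ} (hη : η = 1 ∨ η = -1) (x y : ℝ) :
    η * hh (x + (η * y : ℝ) * Complex.I) = 4 * (Real.exp (x / 2) * Real.sin (y / 2)) := by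
  rw [hh_eq]
  rcases hη with rfl | rfl
  · simp
  · rw [show (-1 * y / 2) = -(y / 2) by ring, Real.sin_neg]; ring

lemma LCtx.arm (L : LCtx F S l ε M τ C0 x0) {η : ℝ} (hη : η = 1 ∨ η = -1) {φ : ℂ → ℂ} {a w : ℂ}
    (ht : IsTract F φ a τ) (hw : w.re + l / 1000 ≤ τ) (hφ : φ w = x0 + (η * (1/100) : ℝ) * Complex.I) :
    ∀ x ∈ Icc (0:ℝ) 2, ∃ w, φ w = x + (η * Real.pi : ℝ) * Complex.I ∧
      w.re + l * (4 * Real.exp (x / 2) - 1/10) ≤ τ := by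
  have hl := L.hl
  have hpi := Real.pi_gt_three
  have hpi2 := Real.pi_lt_four
  have hηa : ∀ y : ℝ, |η * y| = |y| := by intro y; rcases hη with rfl | rfl <;> simp
  have hη2 : η * η = 1 := by rcases hη with rfl | rfl <;> simp
  have hsg : ∀ (x y y' t : ℝ), sg ((x:ℂ) + (η * y : ℝ) * Complex.I) ((x:ℂ) + (η * y' : ℝ) * Complex.I) t =
      (x:ℂ) + (η * (y + t * (y' - y)) : ℝ) * Complex.I := by
    intro x y y' t; simp [sg]; ring
  have hsgx : ∀ (x x' y t : ℝ), sg ((x:ℂ) + (y : ℝ) * Complex.I) ((x':ℂ) + (y : ℝ) * Complex.I) t =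
      ((x + t * (x' - x) : ℝ) :ℂ) + (y : ℝ) * Complex.I := by
    intro x x' y t; simp [sg]; ring
  have hn1 : ‖φ w‖ ≤ M := by rw [hφ]; exact L.nrm (by rw [hηa, abs_of_pos] <;> norm_num)
  obtain ⟨σ, hσ, hV⟩ := L.toSCtx.sign ht (w := w) (by linarith) hn1
  have hex := L.expx
  have hsin0 : 0 ≤ Real.sin ((1/100) / 2) := Real.sin_nonneg_of_nonneg_of_le_pi (by norm_num) (by linarith)
  have hsin1 : Real.sin ((1/100) / 2) ≤ (1/100) / 2 := Real.sin_le (by norm_num)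
  have hση : σ = η := by
    by_contra hne
    have hση : σ = -η := by rcases hσ with rfl | rfl <;> rcases hη with rfl | rfl <;> simp_all
    have hst : ∀ y, l * σ * (hh (x0 + (η * y : ℝ) * Complex.I) - hh (x0 + (η * (1/100) : ℝ) * Complex.I)) =
        l * (4 * Real.exp (x0 / 2) * (Real.sin ((1/100) / 2) - Real.sin (y / 2))) := by
      intro y
      have e1 := L.hhv hη x0 y
      have e2 := L.hhv hη x0 (1/100)
      rw [hση]; linear_combination l * e2 - l * e1
    obtain ⟨w1, h1, h2, -, h3, -⟩ := L.toSCtx.step ht hφ (by rw [← hφ]; exact hn1)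
      (ζ1 := x0 + (η * 0 : ℝ) * Complex.I) (L.nrm (by simp)) (by
        have : (x0:ℂ) + (η * 0 : ℝ) * Complex.I - (x0 + (η * (1/100) : ℝ) * Complex.I) = ((-(η * (1/100)) : ℝ) : ℂ) * Complex.I := by
          push_cast; ring
        rw [this, norm_mul, Complex.norm_real, Complex.norm_I, Real.norm_eq_abs, abs_neg, hηa, abs_of_pos] <;> norm_num) hσ hV (by
        intro t ht'
        rw [hsg, hst]
        have : Real.sin ((1/100 + t * (0 - 1/100)) / 2) ≤ Real.sin ((1/100) / 2) :=
          Real.sin_le_sin_of_le_of_le_pi_div_two (by linarith [ht'.2]) (by linarith) (by linarith [ht'.1])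
        have h5 : 0 ≤ l * (4 * Real.exp (x0 / 2) * (Real.sin ((1/100) / 2) - Real.sin ((1/100 + t * (0 - 1/100)) / 2))) := by
          have := sub_nonneg.2 this
          positivity
        linarith)
    rw [hst, abs_le] at h3
    have h5 : 0 ≤ l * (4 * Real.exp (x0 / 2) * (Real.sin ((1/100) / 2) - Real.sin (0 / 2))) := by
      rw [zero_div, Real.sin_zero, sub_zero]
      exact mul_nonneg hl.le (mul_nonneg (by positivity) hsin0)
    have h4 := L.toSCtx.W ht h2 (by rw [abs_of_pos L.hx0]; linarith [L.hx1]) (by simp) (by linarith)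
    simp at h4
    linarith [h3.2]
  subst hση
  have hst : ∀ x y x' y' : ℝ, l * σ * (hh ((x:ℂ) + (σ * y : ℝ) * Complex.I) - hh ((x':ℂ) + (σ * y' : ℝ) * Complex.I)) =
        l * (4 * (Real.exp (x / 2) * Real.sin (y / 2) - Real.exp (x' / 2) * Real.sin (y' / 2))) := by
      intro x y x' y'
      have e1 := L.hhv hη x y
      have e2 := L.hhv hη x' y'
      linear_combination l * e1 - l * e2
  obtain ⟨w1, h1, h2, -, h3, hV1⟩ := L.toSCtx.step ht hφ (by rw [← hφ]; exact hn1)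
      (ζ1 := x0 + (σ * Real.pi : ℝ) * Complex.I) (L.nrm (by rw [hηa, abs_of_pos] <;> linarith)) (by
        have : (x0:ℂ) + (σ * Real.pi : ℝ) * Complex.I - (x0 + (σ * (1/100) : ℝ) * Complex.I) = ((σ * (Real.pi - 1/100) : ℝ) : ℂ) * Complex.I := by
          push_cast; ring
        rw [this, norm_mul, Complex.norm_real, Complex.norm_I, Real.norm_eq_abs, hηa, abs_of_pos] <;> linarith) hσ hV (by
        intro t ht'
        rw [hsg, hst]
        have : Real.sin ((1/100) / 2) ≤ Real.sin ((1/100 + t * (Real.pi - 1/100)) / 2) :=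
          Real.sin_le_sin_of_le_of_le_pi_div_two (by linarith) (by nlinarith [ht'.2]) (by nlinarith [ht'.1])
        have h5 : 0 ≤ l * (4 * (Real.exp (x0 / 2) * Real.sin ((1/100 + t * (Real.pi - 1/100)) / 2) - Real.exp (x0 / 2) * Real.sin ((1/100) / 2))) := by
          have := sub_nonneg.2 this
          rw [← mul_sub]
          positivity
        linarith)
  rw [hst, abs_le] at h3
  simp only [Real.sin_pi_div_two, mul_one] at h3
  have h6 : Real.exp (x0 / 2) * Real.sin ((1/100) / 2) ≤ 1.01 * ((1/100) / 2) :=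
    mul_le_mul hex.2 hsin1 hsin0 (by norm_num)
  have h6' := mul_le_mul_of_nonneg_left h6 hl.le
  intro x hx
  obtain ⟨w2, g1, g2, -, g3, -⟩ := L.toSCtx.step ht h2 (L.nrm (by rw [hηa, abs_of_pos] <;> linarith))
      (ζ1 := x + (σ * Real.pi : ℝ) * Complex.I)
      (norm_xy L.hM (by rw [abs_of_nonneg hx.1]; linarith [hx.2]) (by rw [hηa, abs_of_pos] <;> linarith)) (by
        have : (x:ℂ) + (σ * Real.pi : ℝ) * Complex.I - (x0 + (σ * Real.pi : ℝ) * Complex.I) = ((x - x0 : ℝ) : ℂ) := by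
          push_cast; ring
        rw [this, Complex.norm_real, Real.norm_eq_abs, abs_le]
        constructor <;> linarith [hx.1, hx.2, L.hx0, L.hx1]) hσ hV1 (by
        intro t ht'
        rw [hsgx, hst]
        simp only [Real.sin_pi_div_two, mul_one]
        have h7 : 1 ≤ Real.exp ((x0 + t * (x - x0)) / 2) := Real.one_le_exp (by nlinarith [ht'.1, ht'.2, hx.1, L.hx0])
        have h7' := mul_le_mul_of_nonneg_left h7 hl.le
        linarith [h3.2])
  refine ⟨w2, g2, ?_⟩
  rw [hst, abs_le] at g3
  simp only [Real.sin_pi_div_two, mul_one] at g3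
  linarith [g3.2, h3.2]

lemma LCtx.distinct (L : LCtx F S l ε M τ C0 x0) {φ ψ : ℂ → ℂ} {a w w' : ℂ} (haS : a ∈ S)
    (ht : IsTract F φ a τ) (hw : w.re + l / 1000 ≤ τ) (hφ : φ w = x0 + (1 * (1/100) : ℝ) * Complex.I)
    (ht' : IsTract F ψ a τ) (hw' : w'.re + l / 1000 ≤ τ) (hψ : ψ w' = x0 + (-1 * (1/100) : ℝ) * Complex.I) :
    False := by
  have hl := L.hl
  have hend : ∀ (χ : ℂ → ℂ) (v : ℂ) (y : ℝ), y ∈ Icc (-(1/100):ℝ) (1/100) → IsTract F χ a τ → v.re + l / 1000 ≤ τ →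
      χ v = x0 + y * Complex.I → Nn F a 1 0 (x0 + y * Complex.I) ≤ 1 := by
    intro χ v y hy h1 h2 h3
    have hy' : |y| ≤ 1/100 := abs_le.2 hy
    have hv : v.re < τ := by linarith
    have hd := L.toSCtx.dφ h1 (w := v) (by linarith) (by rw [h3]; exact L.nrm (by linarith))
    have hm := h1.deriv_mul hv
    have hval := h1.val v hv
    rw [h3] at hd hm hval
    have hm' := congrArg norm hm
    rw [norm_mul] at hm'
    have he : ‖Complex.exp v‖ ≤ 1 := by
      rw [Complex.norm_exp]; exact Real.exp_le_one_iff.2 (by linarith [L.hτ])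
    have hd1 : ‖deriv χ v‖ ≤ 1 := by
      refine hd.trans ?_
      rw [div_le_one hl]
      have : Real.exp (-(x0 + y * Complex.I : ℂ).re / 2) ≤ 1 := Real.exp_le_one_iff.2 (by simp; linarith [L.hx0])
      linarith [L.hl4]
    have hG : 0 < ‖deriv F (x0 + y * Complex.I)‖ := norm_pos_iff.2 (L.dn y hy)
    unfold Nn
    rw [hval, add_sub_cancel_left, add_zero, one_mul, mul_inv_le_iff₀ hG, one_mul]
    rw [← hm'] at he ⊢
    rw [pow_two]
    calc _ ≤ 1 * (‖deriv F (x0 + y * Complex.I)‖ * ‖deriv χ v‖) := by gcongr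
      _ ≤ 1 * (‖deriv F (x0 + y * Complex.I)‖ * 1) := by gcongr
      _ = _ := by ring
  have hne : ∀ y ∈ Icc (-(1/100):ℝ) (1/100), F (x0 + y * Complex.I) - a ≠ 0 := by
    intro y hy h0
    have := L.nS y hy
    rw [sub_eq_zero.1 h0] at this
    exact this haS
  have hvpos : ∀ y ∈ Icc (-(1/100):ℝ) (1/100), 0 < Nn F a 1 0 (x0 + y * Complex.I) := by
    intro y hy
    have h1 := norm_pos_iff.2 (hne y hy)
    have h2 := norm_pos_iff.2 (L.dn y hy)
    unfold Nn; positivity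
  have hv := L.lineN a zero_le_one le_rfl hvpos
  have hdec := decay (a := -(1/100)) (b := 1/100) hl zero_le_one (fun t ht => (hv t ht).1)
    (fun t ht => (hv t ht).2.1)
    (by refine hend ψ w' _ (by norm_num) ht' hw' ?_
        rw [hψ]; norm_num)
    (by refine hend φ w _ (by norm_num) ht hw ?_
        rw [hφ]; norm_num)
    (fun t ht => (hv t ht).2.2.1)
  set α := Real.exp (l / 200) with hα
  set β := Real.exp (-(l / 200)) with hβ
  have hαβ : α * β = 1 := by rw [hα, hβ, ← Real.exp_add]; simp
  have hα0 : 0 < α := Real.exp_pos _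
  have hβ0 : 0 < β := Real.exp_pos _
  have hpos : ∀ y ∈ Icc (-(1/100):ℝ) (1/100), 0 < Nn F a α β (x0 + y * Complex.I) := fun y hy =>
    Nn_pos hα0.le hβ0 (L.dn y hy)
  have hlN := L.lineN a hα0.le hβ0.le hpos
  have hle : ∀ y : ℝ, |y| = 1/500 → Nn F a α β (x0 + y * Complex.I) ≤ 3 := by
    intro y hy
    have hy1 := abs_le.1 hy.le
    have hyI : y ∈ Icc (-(1/100):ℝ) (1/100) := ⟨by linarith [hy1.1], by linarith [hy1.2]⟩
    have h1 := hdec y hyI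
    have h2 := L.upper hyI
    have e1 : Real.exp (l * (y - 1/100)) ≤ β := Real.exp_le_exp.2 (by nlinarith [hy1.2])
    have e2 : Real.exp (l * (-(1/100) - y)) ≤ β := Real.exp_le_exp.2 (by nlinarith [hy1.1])
    have e3 : Real.exp (l * (2.02 * |y| + 1/2000)) ≤ α := by
      apply Real.exp_le_exp.2; rw [hy]; linarith
    have h3 : ‖deriv F (x0 + y * Complex.I)‖⁻¹ ≤ α := by
      refine le_trans ?_ (h2.trans e3)
      unfold Nn
      have : 0 ≤ ‖deriv F (x0 + y * Complex.I)‖⁻¹ := by positivity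
      nlinarith [sq_nonneg ‖F (x0 + y * Complex.I) - 0‖]
    have h4 : Nn F a α β (x0 + y * Complex.I) = α * Nn F a 1 0 (x0 + y * Complex.I) + β * ‖deriv F (x0 + y * Complex.I)‖⁻¹ := by
      unfold Nn; ring
    rw [h4]
    have h5 : α * Nn F a 1 0 (x0 + y * Complex.I) ≤ α * (2 * β) := by
      gcongr; linarith
    have h6 : β * ‖deriv F (x0 + y * Complex.I)‖⁻¹ ≤ β * α := by gcongr
    nlinarith
  have hsub : ∀ t ∈ Icc (-(1/500):ℝ) (-(1/500) + 4 * (1/1000)), t ∈ Icc (-(1/100):ℝ) (1/100) :=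
    fun t ht => ⟨by linarith [ht.1], by linarith [ht.2]⟩
  have hK := lemmaK (a := -(1/500)) (h := 1/1000) (k := l) (A := 3) (by norm_num) hl
    (fun t ht => (hlN t (hsub t ht)).1) (fun t ht => (hlN t (hsub t ht)).2.1)
    (fun t ht => hpos t (hsub t ht)) (hle _ (by rw [abs_neg, abs_of_pos] <;> norm_num))
    (hle _ (by norm_num [abs_of_pos]))
    (fun t ht => (hlN t (hsub t ht)).2.2.1)
    (fun t ht => by
      have := (hlN t (hsub t ht)).2.2.2
      rwa [hαβ, mul_one] at this)
  have h4 := L.exp_big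
  rw [show l * (1/1000) = l / 1000 by ring] at hK
  linarith

theorem LCtx.strip (L : LCtx F S l ε M τ C0 x0) : ∃ a1 ∈ S, ∃ a2 ∈ S, ∃ φ1 φ2, a1 ≠ a2 ∧
    IsTract F φ1 a1 τ ∧ IsTract F φ2 a2 τ ∧
    (∀ x ∈ Icc (0:ℝ) 2, ∃ w, φ1 w = x + (-Real.pi : ℝ) * Complex.I ∧
      w.re + l * (4 * Real.exp (x / 2) - 1/10) ≤ τ) ∧
    (∀ x ∈ Icc (0:ℝ) 2, ∃ w, φ2 w = x + (Real.pi : ℝ) * Complex.I ∧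
      w.re + l * (4 * Real.exp (x / 2) - 1/10) ≤ τ) := by
  obtain ⟨a, ha, φ, w, h1, h2, h3⟩ := L.enter (Or.inr rfl : (-1:ℝ) = 1 ∨ (-1:ℝ) = -1)
  obtain ⟨b, hb, ψ, v, g1, g2, g3⟩ := L.enter (Or.inl rfl : (1:ℝ) = 1 ∨ (1:ℝ) = -1)
  refine ⟨a, ha, b, hb, φ, ψ, ?_, h1, g1, ?_, ?_⟩
  · rintro rfl
    exact L.distinct ha g1 g2 g3 h1 h2 h3
  · simpa only [neg_mul, one_mul] using L.arm (Or.inr rfl) h1 h2 h3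
  · simpa only [one_mul] using L.arm (Or.inl rfl) g1 g2 g3
end U

end PartU

section PartV1

lemma exp_const {K : Set ℂ} (hK : IsPreconnected K) {u v : ℂ → ℂ} (hu : ContinuousOn u K) (hv : ContinuousOn v K)
    (h : ∀ z ∈ K, Complex.exp (u z) = Complex.exp (v z)) {x y : ℂ} (hx : x ∈ K) (hy : y ∈ K) :
    u x - v x = u y - v y := by
  refine hK.induction₂' (fun x y => u x - v x = u y - v y) ?_ (fun _ _ _ _ _ _ h1 h2 => h1.trans h2) hx hy
  intro x hx
  have hc := (hu.sub hv) x hx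
  filter_upwards [hc.eventually (Metric.ball_mem_nhds _ one_pos), self_mem_nhdsWithin] with y hy hyK
  simp only [dist_eq_norm] at hy
  have : Complex.exp ((u y - v y) - (u x - v x)) = 1 := by
    rw [Complex.exp_sub, Complex.exp_sub, Complex.exp_sub, h x hx, h y hyK]
    simp [Complex.exp_ne_zero]
  obtain ⟨n, hn⟩ := Complex.exp_eq_one_iff.1 this
  have hn0 : n = 0 := by
    by_contra h0
    have h1 : (1:ℝ) ≤ |(n:ℝ)| := by exact_mod_cast Int.one_le_abs h0
    rw [Pi.sub_apply, Pi.sub_apply, hn] at hy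
    simp only [norm_mul, Complex.norm_intCast, Complex.norm_I, Complex.norm_real, Complex.norm_ofNat,
      Real.norm_eq_abs, abs_of_pos Real.pi_pos, mul_one] at hy
    nlinarith [Real.pi_gt_three]
  have h2 : u x - v x = u y - v y := by
    rw [hn0] at hn; simp at hn; linear_combination -hn
  exact ⟨h2, h2.symm⟩

lemma log_move {E K : Set ℂ} (hE : IsPreconnected E) (hK : IsCompact K) (hd : Disjoint E K) {p q : ℂ}
    (hp : p ∈ E) (hq : q ∈ E) : ∃ Λ : ℂ → ℂ, ContinuousOn Λ K ∧ ∀ z ∈ K, Complex.exp (Λ z) = (q - z) / (p - z) := by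
  have hne : ∀ e ∈ E, ∀ z ∈ K, e - z ≠ 0 := fun e he z hz h0 =>
    hd.ne_of_mem he hz (sub_eq_zero.1 h0)
  refine hE.induction₂' (fun p q => ∃ Λ : ℂ → ℂ, ContinuousOn Λ K ∧ ∀ z ∈ K, Complex.exp (Λ z) = (q - z) / (p - z)) ?_ ?_ hp hq
  · intro x hx
    have hKn : Kᶜ ∈ 𝓝 x := hK.isClosed.isOpen_compl.mem_nhds (fun h => hd.ne_of_mem hx h rfl)
    obtain ⟨r, hr, hb⟩ := Metric.mem_nhds_iff.1 hKn
    filter_upwards [mem_nhdsWithin_of_mem_nhds (Metric.ball_mem_nhds x hr), self_mem_nhdsWithin] with y hy hyE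
    have hs : ∀ z ∈ K, (y - z) / (x - z) ∈ Complex.slitPlane := by
      intro z hz
      have h1 : ‖y - x‖ < ‖x - z‖ := by
        rw [Metric.mem_ball, dist_eq_norm] at hy
        refine hy.trans_le ?_
        by_contra h
        refine hb (show z ∈ Metric.ball x r from ?_) hz
        rw [Metric.mem_ball, dist_eq_norm, ← norm_neg, neg_sub]; exact not_le.1 h
      have h2 : ‖(y - x) / (x - z)‖ < 1 := by
        rw [norm_div, div_lt_one (norm_pos_iff.2 (hne x hx z hz))]; exact h1
      have h3 := Complex.mem_slitPlane_of_norm_lt_one h2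
      have h4 := hne x hx z hz
      convert h3 using 1
      field_simp; ring
    have hL : ∃ Λ : ℂ → ℂ, ContinuousOn Λ K ∧ ∀ z ∈ K, Complex.exp (Λ z) = (y - z) / (x - z) := by
      refine ⟨fun z => Complex.log ((y - z) / (x - z)), ?_, fun z hz => Complex.exp_log (div_ne_zero (hne y hyE z hz) (hne x hx z hz))⟩
      exact ContinuousOn.clog (ContinuousOn.div (by fun_prop) (by fun_prop) (hne x hx)) hs
    refine ⟨hL, ?_⟩
    obtain ⟨Λ, h1, h2⟩ := hL
    exact ⟨fun z => -Λ z, h1.neg, fun z hz => by rw [Complex.exp_neg, h2 z hz, inv_div]⟩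
  · rintro x y z hx hy hz ⟨Λ, h1, h2⟩ ⟨Λ', h1', h2'⟩
    refine ⟨fun z => Λ z + Λ' z, h1.add h1', fun v hv => ?_⟩
    rw [Complex.exp_add, h2 v hv, h2' v hv]
    have := hne y hy v hv
    have := hne x hx v hv
    field_simp

lemma log_pt {E K : Set ℂ} (hE : IsPreconnected E) (hK : IsCompact K) (hd : Disjoint E K) {p : ℂ}
    (hp : p ∈ E) (hu : ∀ R : ℝ, ∃ q ∈ E, R < ‖q‖) :
    ∃ (Λ : ℂ → ℂ) (c : ℂ), ContinuousOn Λ K ∧ ∀ z ∈ K, Complex.exp (Λ z) = Complex.exp c * (p - z) := by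
  obtain ⟨R, hR⟩ := hK.isBounded.exists_norm_le
  obtain ⟨q, hq, hRq⟩ := hu (max R 0)
  have hq0 : 0 < ‖q‖ := (le_max_right _ _).trans_lt hRq
  have hq1 : q ≠ 0 := norm_pos_iff.1 hq0
  obtain ⟨Λ, h1, h2⟩ := log_move hE hK hd hp hq
  have hs : ∀ z ∈ K, 1 + -z / q ∈ Complex.slitPlane := fun z hz => Complex.mem_slitPlane_of_norm_lt_one (by
    rw [norm_div, norm_neg, div_lt_one hq0]; exact (hR z hz).trans_lt ((le_max_left _ _).trans_lt hRq))
  refine ⟨fun z => Complex.log (1 + -z / q) - Λ z, -Complex.log q, ?_, fun z hz => ?_⟩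
  · exact (ContinuousOn.clog (by fun_prop) hs).sub h1
  · have hne := Complex.slitPlane_ne_zero (hs z hz)
    rw [Complex.exp_sub, Complex.exp_log hne, h2 z hz, Complex.exp_neg, Complex.exp_log hq1]
    have h3 : p - z ≠ 0 := fun h0 => hd.ne_of_mem hp hz (sub_eq_zero.1 h0)
    have h4 : q - z ≠ 0 := fun h0 => hd.ne_of_mem hq hz (sub_eq_zero.1 h0)
    have h5 : 1 + -z / q = (q - z) / q := by field_simp; ring
    rw [h5]; field_simp

lemma index_contra {Ep Em K1 K2 : Set ℂ} {p m A B : ℂ} (hEp : IsPreconnected Ep) (hEm : IsPreconnected Em)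
    (up : ∀ R : ℝ, ∃ q ∈ Ep, R < ‖q‖) (um : ∀ R : ℝ, ∃ q ∈ Em, R < ‖q‖)
    (hp : p ∈ Ep) (hm : m ∈ Em) (hK1 : IsPreconnected K1) (hK2 : IsPreconnected K2)
    (c1 : IsCompact K1) (c2 : IsCompact K2) (dp : Disjoint Ep (K1 ∪ K2)) (dm : Disjoint Em (K1 ∪ K2))
    (A1 : A ∈ K1) (A2 : A ∈ K2) (B1 : B ∈ K1) (B2 : B ∈ K2)
    (s1 : ∀ z ∈ K1, -((p - z) / (m - z)) ∈ Complex.slitPlane)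
    (s2 : ∀ z ∈ K2, (p - z) / (m - z) ∈ Complex.slitPlane)
    (iA : 0 < ((p - A) / (m - A)).im) (iB : ((p - B) / (m - B)).im < 0) : False := by
  obtain ⟨Λ, c, h1, h2⟩ := log_pt hEp (c1.union c2) dp hp up
  obtain ⟨Λ', c', h1', h2'⟩ := log_pt hEm (c1.union c2) dm hm um
  set T := fun z => Λ z - Λ' z - c + c'
  have hT : ContinuousOn T (K1 ∪ K2) := ((h1.sub h1').sub continuousOn_const).add continuousOn_const
  have hexp : ∀ z ∈ K1 ∪ K2, Complex.exp (T z) = (p - z) / (m - z) := by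
    intro z hz
    have h4 : m - z ≠ 0 := fun h0 => dm.ne_of_mem hm hz (sub_eq_zero.1 h0)
    simp only [T]
    rw [Complex.exp_add, Complex.exp_sub, Complex.exp_sub, h2 z hz, h2' z hz]
    have := Complex.exp_ne_zero c
    have := Complex.exp_ne_zero c'
    field_simp
  have hmz : ∀ z ∈ K1 ∪ K2, m - z ≠ 0 := fun z hz h0 => dm.ne_of_mem hm hz (sub_eq_zero.1 h0)
  have e2 := exp_const hK2 (hT.mono subset_union_right) (v := fun z => Complex.log ((p - z) / (m - z)))
    (ContinuousOn.clog (ContinuousOn.div (by fun_prop) (by fun_prop) (fun z hz => hmz z (Or.inr hz))) s2)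
    (fun z hz => by rw [hexp z (Or.inr hz), Complex.exp_log (Complex.slitPlane_ne_zero (s2 z hz))]) A2 B2
  have e1 := exp_const hK1 (hT.mono subset_union_left) (v := fun z => Complex.log (-((p - z) / (m - z))) + Real.pi * Complex.I)
    ((ContinuousOn.clog (ContinuousOn.neg (ContinuousOn.div (by fun_prop) (by fun_prop) (fun z hz => hmz z (Or.inl hz)))) s1).add continuousOn_const)
    (fun z hz => by rw [hexp z (Or.inl hz), Complex.exp_add, Complex.exp_pi_mul_I, Complex.exp_log (Complex.slitPlane_ne_zero (s1 z hz))]; ring) A1 B1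
  have e3 : Complex.log ((p - A) / (m - A)) - Complex.log (-((p - A) / (m - A))) =
    Complex.log ((p - B) / (m - B)) - Complex.log (-((p - B) / (m - B))) := by linear_combination e1 - e2
  have e4 := congrArg Complex.im e3
  simp only [Complex.sub_im, Complex.log_im] at e4
  rw [Complex.arg_neg_eq_arg_sub_pi_of_im_pos iA, Complex.arg_neg_eq_arg_add_pi_of_im_neg iB] at e4
  linarith [Real.pi_pos]

end PartV1

section PartV2

lemma aff_an {F : ℂ → ℂ} {z0 ρ ζ : ℂ} (hρ : ρ ≠ 0) :
    AnalyticAt ℂ (fun ζ => F (z0 + ρ * ζ)) ζ ↔ AnalyticAt ℂ F (z0 + ρ * ζ) := by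
  constructor
  · intro h
    have h1 : AnalyticAt ℂ (fun z => (z - z0) / ρ) (z0 + ρ * ζ) := by fun_prop (disch := assumption)
    have h2 : AnalyticAt ℂ (fun ζ => F (z0 + ρ * ζ)) ((fun z => (z - z0) / ρ) (z0 + ρ * ζ)) := by
      simpa [mul_div_cancel_left₀ _ hρ] using h
    have := AnalyticAt.fun_comp (f := fun z => (z - z0) / ρ) h2 h1
    convert this using 1
    funext z
    congr 1; field_simp; ring
  · intro h
    exact AnalyticAt.fun_comp (g := F) (f := fun ζ => z0 + ρ * ζ) h (by fun_prop)

lemma aff_deriv {F : ℂ → ℂ} {z0 ρ ζ : ℂ} : deriv (fun ζ => F (z0 + ρ * ζ)) ζ = ρ * deriv F (z0 + ρ * ζ) := by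
  have h1 := deriv_comp_mul_left ρ (fun x => F (z0 + x)) ζ
  rw [h1, deriv_comp_const_add, smul_eq_mul]

lemma IsTract.aff {F φ : ℂ → ℂ} {a z0 ρ : ℂ} {τ : ℝ} (h : IsTract F φ a τ) (hρ : ρ ≠ 0) :
    IsTract (fun ζ => F (z0 + ρ * ζ)) (fun w => (φ w - z0) / ρ) a τ := by
  have e : ∀ w, z0 + ρ * ((φ w - z0) / ρ) = φ w := fun w => by field_simp; ring
  refine ⟨(h.diff.sub_const z0).div_const ρ, ?_, ?_, ?_, ?_⟩
  · intro x hx y hy hxy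
    refine h.inj hx hy ?_
    rw [← e x, ← e y]; simp only at hxy; rw [hxy]
  · intro w hw; simp only [e]; exact h.val w hw
  · intro w hw; rw [aff_an hρ, e]; exact h.an w hw
  · intro R
    obtain ⟨s, hs⟩ := h.inf (‖ρ‖ * R + ‖z0‖)
    refine ⟨s, fun w hw => ?_⟩
    have h1 := hs w hw
    have h2 := norm_sub_norm_le (φ w) z0
    rw [norm_div, lt_div_iff₀ (norm_pos_iff.2 hρ)]; linarith

def HDs (F : ℂ → ℂ) (S : Set ℂ) (τ C0 : ℝ) (U : Set ℂ) : Prop :=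
  ∀ ζ ∈ U, AnalyticAt ℂ F ζ → F ζ ∉ S → deriv F ζ ≠ 0 →
    (Nn F 0 1 1 ζ) ^ 2 * ‖schwarzian F ζ / 2‖ ≤ C0 ∨
    ∃ a ∈ S, ∃ φ w, IsTract F φ a τ ∧ w.re < τ ∧ φ w = ζ ∧
      (Nn F 0 1 1 ζ) ^ 2 * ‖schwarzian F ζ / 2‖ ≤ C0 * Real.exp (2 * (τ - w.re))

lemma HDs.aff {F : ℂ → ℂ} {S U : Set ℂ} {τ C0 M : ℝ} {z0 ρ : ℂ} (h : HDs F S τ C0 U) (hρ : ρ ≠ 0)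
    (hU : ∀ ζ, ‖ζ‖ ≤ M → z0 + ρ * ζ ∈ U) : HDp (fun ζ => F (z0 + ρ * ζ)) S τ C0 M := by
  intro ζ hζ ha hS hd
  rw [aff_an hρ] at ha
  rw [aff_deriv] at hd
  have hd' := right_ne_zero_of_mul hd
  have key : (Nn (fun ζ => F (z0 + ρ * ζ)) 0 1 1 ζ) ^ 2 * ‖schwarzian (fun ζ => F (z0 + ρ * ζ)) ζ / 2‖ =
      (Nn F 0 1 1 (z0 + ρ * ζ)) ^ 2 * ‖schwarzian F (z0 + ρ * ζ) / 2‖ := by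
    rw [schw_comp_affine ha hρ hd']
    unfold Nn
    rw [aff_deriv, mul_div_assoc, norm_mul, norm_mul, norm_pow]
    have := norm_ne_zero_iff.2 hρ
    have := norm_ne_zero_iff.2 hd'
    field_simp
  rw [key]
  rcases h _ (hU ζ hζ) ha hS hd' with h1 | ⟨a, haS, φ, w, h1, h2, h3, h4⟩
  · exact Or.inl h1
  · refine Or.inr ⟨a, haS, _, w, h1.aff hρ, h2, ?_, h4⟩
    rw [h3]; field_simp; ring

section V2
variable {F φ ψ : ℂ → ℂ} {P S : Set ℂ} {a b w v : ℂ} {τ : ℝ}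

lemma IsTract.reg (h : IsTract F φ a τ) (L : LiftData F P S) (ha : a ∈ S)
    (hsep : ∀ a ∈ S, ∀ b ∈ S, a ≠ b → 2 * Real.exp τ ≤ ‖a - b‖) (hw : w.re < τ) : φ w ∈ regE F P S := by
  constructor
  · intro hP
    have h1 := (h.an w hw).continuousAt.norm.tendsto.mono_left (nhdsWithin_le_nhds (s := {φ w}ᶜ))
    exact not_tendsto_nhds_of_tendsto_atTop (L.pole _ hP) _ h1
  · rw [h.val w hw]
    intro hS
    have h1 := hsep _ hS a ha (by simp [Complex.exp_ne_zero])
    rw [add_sub_cancel_left, Complex.norm_exp] at h1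
    have := Real.exp_lt_exp.2 hw
    linarith [Real.exp_pos τ]

lemma IsTract.a_eq (h : IsTract F φ a τ) (h' : IsTract F ψ b τ) (ha : a ∈ S) (hb : b ∈ S)
    (hsep : ∀ a ∈ S, ∀ b ∈ S, a ≠ b → 2 * Real.exp τ ≤ ‖a - b‖) (hw : w.re < τ) (hv : v.re < τ)
    (he : φ w = ψ v) : a = b := by
  by_contra hne
  have h1 := hsep a ha b hb hne
  have h2 := h.val w hw
  rw [he, h'.val v hv] at h2
  have h3 : a - b = Complex.exp v - Complex.exp w := by linear_combination -h2
  have h4 := norm_sub_le (Complex.exp v) (Complex.exp w)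
  rw [← h3, Complex.norm_exp, Complex.norm_exp] at h4
  linarith [Real.exp_lt_exp.2 hw, Real.exp_lt_exp.2 hv]

lemma IsTract.same (h : IsTract F φ a τ) (h' : IsTract F ψ a τ) (L : LiftData F P S) (ha : a ∈ S)
    (hsep : ∀ a ∈ S, ∀ b ∈ S, a ≠ b → 2 * Real.exp τ ≤ ‖a - b‖) (hw : w.re < τ) (hv : v.re < τ)
    (he : φ w = ψ v) : ∃ m : ℤ, ∀ u : ℂ, u.re < τ → ψ u = φ (u + m * (2 * Real.pi * Complex.I)) := by
  have h2 := h.val w hw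
  rw [he, h'.val v hv] at h2
  obtain ⟨m, hm⟩ := Complex.exp_eq_exp_iff_exists_int.1 (add_left_cancel h2).symm
  have hre : ∀ u : ℂ, (u + m * (2 * Real.pi * Complex.I)).re = u.re := by intro u; simp
  have hc : Convex ℝ {w : ℂ | w.re < τ} := convex_halfSpace_re_lt τ
  refine ⟨m, fun u hu => ?_⟩
  refine L.uniq hc.isPreconnected h'.diff.continuousOn (g₂ := fun u => φ (u + m * (2 * Real.pi * Complex.I)))
    (h.diff.continuousOn.comp (by fun_prop) (fun u hu => by simpa [hre] using hu))
    (fun u hu => h'.reg L ha hsep hu) (fun u hu => h.reg L ha hsep (by rw [hre]; exact hu)) ?_ hv ?_ hu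
  · intro u hu
    rw [h'.val u hu, h.val _ (by rw [hre]; exact hu), Complex.exp_add, Complex.exp_int_mul_two_pi_mul_I, mul_one]
  · rw [← he, hm]

end V2

structure GCtx (F : ℂ → ℂ) (P S : Set ℂ) (l ε τ C0 : ℝ) (N : ℕ) : Prop where
  L : LiftData F P S
  sep : ∀ a ∈ S, ∀ b ∈ S, a ≠ b → 2 * Real.exp τ ≤ ‖a - b‖
  ct : (regE F P S)ᶜ.Countable
  sc : ∀ k : ℕ, k ≤ N → SCtx (fun ζ => F ((k * (2 * Real.pi) : ℝ) * Complex.I + 1 * ζ)) l ε 60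
  hD : ∀ k : ℕ, k ≤ N → HDp (fun ζ => F ((k * (2 * Real.pi) : ℝ) * Complex.I + 1 * ζ)) S τ C0 60
  hl4 : 10 ^ 4 ≤ l
  hC0 : 0 ≤ C0
  hlC : 2 * C0 ≤ l ^ 2
  hτ : τ ≤ 0

section V3
variable {F : ℂ → ℂ} {P S : Set ℂ} {l ε τ C0 : ℝ} {N : ℕ}

def mid (k : ℕ) : ℝ := k * (2 * Real.pi) - Real.pi

lemma GCtx.strip1 (G : GCtx F P S l ε τ C0 N) {k : ℕ} (hk : k ≤ N) :
    ∃ a1 ∈ S, ∃ a2 ∈ S, ∃ φ1 φ2, a1 ≠ a2 ∧ IsTract F φ1 a1 τ ∧ IsTract F φ2 a2 τ ∧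
    (∀ x ∈ Icc (0:ℝ) 2, ∃ w, φ1 w = x + (mid k : ℝ) * Complex.I ∧ w.re + l * (4 * Real.exp (x / 2) - 1/10) ≤ τ) ∧
    (∀ x ∈ Icc (0:ℝ) 2, ∃ w, φ2 w = x + (mid (k+1) : ℝ) * Complex.I ∧ w.re + l * (4 * Real.exp (x / 2) - 1/10) ≤ τ) := by
  set c : ℂ := (k * (2 * Real.pi) : ℝ) * Complex.I with hc
  obtain ⟨x0, ⟨h0, h1⟩, hx⟩ : ∃ x0 ∈ Ioo (0:ℝ) (1/100), x0 ∉ Complex.re '' (regE F P S)ᶜ := by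
    by_contra hcon
    push Not at hcon
    have h1 := (G.ct.image Complex.re).mono hcon
    have h2 := Cardinal.le_aleph0_iff_set_countable.2 h1
    rw [Cardinal.mk_Ioo_real (by norm_num)] at h2
    exact absurd h2 (not_le.2 Cardinal.aleph0_lt_continuum)
  have hreg : ∀ y : ℝ, c + 1 * (x0 + y * Complex.I) ∈ regE F P S := by
    intro y
    by_contra hcon
    exact hx ⟨_, hcon, by simp [hc]⟩
  have Lc : LCtx (fun ζ => F (c + 1 * ζ)) S l ε 60 τ C0 x0 :=
    { toSCtx := G.sc k hk, hD := G.hD k hk, hl4 := G.hl4, hC0 := G.hC0, hlC := G.hlC, hτ := G.hτ, hx0 := h0, hx1 := h1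
      an := fun y _ => (aff_an one_ne_zero).2 (G.L.an _ (hreg y).1)
      dn := fun y _ => by rw [aff_deriv, one_mul]; exact G.L.deriv_ne (hreg y)
      nS := fun y _ => (hreg y).2 }
  have hF : (fun ζ => (fun ζ => F (c + 1 * ζ)) (-c + 1 * ζ)) = F := by funext z; simp
  obtain ⟨a1, e1, a2, e2, φ1, φ2, hne, t1, t2, m1, m2⟩ := Lc.strip
  refine ⟨a1, e1, a2, e2, _, _, hne, hF ▸ t1.aff (z0 := -c) one_ne_zero, hF ▸ t2.aff (z0 := -c) one_ne_zero, ?_, ?_⟩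
  · intro x hx
    obtain ⟨w, g1, g2⟩ := m1 x hx
    refine ⟨w, ?_, g2⟩
    rw [g1, hc, mid]; push_cast; ring
  · intro x hx
    obtain ⟨w, g1, g2⟩ := m2 x hx
    refine ⟨w, ?_, g2⟩
    rw [g1, hc, mid]; push_cast; ring

lemma GCtx.W (G : GCtx F P S l ε τ C0 N) {φ : ℂ → ℂ} {b w : ℂ} {x y : ℝ} (h : IsTract F φ b τ) (hw : w.re < τ)
    (hφ : φ w = x + y * Complex.I) (hx : |x| ≤ 3) (h1 : mid 0 ≤ y) (h2 : y < mid (N + 1)) :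
    τ - w.re ≤ l * (4 * Real.exp (x / 2) + 1 / 2000) := by
  have hpi := Real.pi_pos
  simp only [mid] at h1 h2
  push_cast at h1 h2
  obtain ⟨k, hk, hk1⟩ : ∃ k : ℕ, k ≤ N ∧ |y - k * (2 * Real.pi)| ≤ Real.pi := by
    have h0 : 0 ≤ (y + Real.pi) / (2 * Real.pi) := div_nonneg (by linarith) (by linarith)
    have f1 := Nat.floor_le h0
    have f2 := Nat.lt_floor_add_one ((y + Real.pi) / (2 * Real.pi))
    rw [le_div_iff₀ (by linarith)] at f1
    rw [div_lt_iff₀ (by linarith)] at f2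
    refine ⟨⌊(y + Real.pi) / (2 * Real.pi)⌋₊, ?_, ?_⟩
    · have : ⌊(y + Real.pi) / (2 * Real.pi)⌋₊ < N + 1 := by
        rw [Nat.floor_lt h0, div_lt_iff₀ (by linarith)]; push_cast; linarith
      omega
    · rw [abs_le]; constructor <;> linarith
  have := (G.sc k hk).W (h.aff (z0 := (k * (2 * Real.pi) : ℝ) * Complex.I) one_ne_zero) (x := x) (y := y - k * (2 * Real.pi))
    (w := w) (by rw [hφ]; push_cast; ring) hx (by linarith [Real.pi_lt_d2]) hw
  refine this.trans (mul_le_mul_of_nonneg_left ?_ (G.sc k hk).hl.le)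
  have h3 := mul_le_mul_of_nonneg_left (Real.abs_sin_le_one ((y - k * (2 * Real.pi)) / 2)) (Real.exp_pos (x/2)).le
  linarith

end V3

end PartV2

section PartV3

section V4
variable {F : ℂ → ℂ} {P S : Set ℂ} {l ε τ C0 : ℝ} {N : ℕ}

lemma slit_R {d : ℝ} {z : ℂ} (h : z.re = 1 → ¬(d - 2 * Real.pi ≤ z.im ∧ z.im ≤ d + 2 * Real.pi)) :
    ((1:ℝ) + (d + 2 * Real.pi : ℝ) * Complex.I - z) / ((1:ℝ) + (d - 2 * Real.pi : ℝ) * Complex.I - z) ∈ Complex.slitPlane := by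
  have hpi := Real.pi_pos
  have hn : 0 < (1 - z.re) ^ 2 + (d - 2 * Real.pi - z.im) ^ 2 := by
    by_contra h0
    have h1 : z.re = 1 := by nlinarith [sq_nonneg (1 - z.re), sq_nonneg (d - 2 * Real.pi - z.im)]
    have h2 : z.im = d - 2 * Real.pi := by nlinarith [sq_nonneg (1 - z.re), sq_nonneg (d - 2 * Real.pi - z.im)]
    exact h h1 ⟨h2.ge, by linarith⟩
  rw [Complex.mem_slitPlane_iff, Complex.div_re, Complex.div_im]
  simp only [Complex.normSq_apply, Complex.sub_re, Complex.add_re, Complex.ofReal_re, Complex.mul_re, Complex.I_re,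
    Complex.ofReal_im, Complex.I_im, Complex.sub_im, Complex.add_im, Complex.mul_im, mul_zero, mul_one, sub_zero, add_zero, zero_add, zero_sub, zero_mul]
  rw [← add_div, ← sub_div]
  by_cases h1 : z.re = 1
  · left
    apply div_pos _ (by nlinarith)
    have := h h1
    rw [h1]
    by_cases h2 : d - 2 * Real.pi ≤ z.im
    · have : d + 2 * Real.pi < z.im := by by_contra h3; exact this ⟨h2, not_lt.1 h3⟩
      nlinarith
    · push Not at h2
      nlinarith
  · right
    apply div_ne_zero _ (by nlinarith)
    have : 1 - z.re ≠ 0 := fun h2 => h1 (by linarith)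
    have h3 : (d + 2 * Real.pi - z.im) * (1 - z.re) - (1 - z.re) * (d - 2 * Real.pi - z.im) = 4 * Real.pi * (1 - z.re) := by ring
    rw [h3]
    exact mul_ne_zero (by positivity) this

lemma R_val (d x : ℝ) : ((1:ℝ) + (d + 2 * Real.pi : ℝ) * Complex.I - (x + d * Complex.I)) /
      ((1:ℝ) + (d - 2 * Real.pi : ℝ) * Complex.I - (x + d * Complex.I)) =
    (((1 - x) ^ 2 - 4 * Real.pi ^ 2) / ((1 - x) ^ 2 + 4 * Real.pi ^ 2) : ℝ) +
      ((4 * Real.pi * (1 - x)) / ((1 - x) ^ 2 + 4 * Real.pi ^ 2) : ℝ) * Complex.I := by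
  have hpi := Real.pi_pos
  have h1 : ((1 - x) ^ 2 + 4 * Real.pi ^ 2 : ℝ) ≠ 0 := by positivity
  have h2 : ((1 - x) ^ 2 + 4 * Real.pi ^ 2 : ℂ) ≠ 0 := by exact_mod_cast h1
  have h3 : ((1:ℝ) + (d - 2 * Real.pi : ℝ) * Complex.I - (x + d * Complex.I) : ℂ) ≠ 0 := by
    intro h; have := congrArg Complex.im h; simp at this
  rw [div_eq_iff h3]
  push_cast
  rw [div_mul_eq_mul_div, ← add_div, div_mul_eq_mul_div, eq_div_iff h2]
  linear_combination (8 * (Real.pi:ℂ) ^ 2 * (1 - x)) * Complex.I_sq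

set_option maxHeartbeats 1600000 in
theorem GCtx.disj (G : GCtx F P S l ε τ C0 N) : ∃ (a : ℕ → ℂ) (φ : ℕ → ℂ → ℂ),
    (∀ k ≤ N, a k ∈ S ∧ IsTract F (φ k) (a k) τ) ∧
    ∀ k j, 1 ≤ k → k < j → j ≤ N → ∀ w v : ℂ, w.re < τ → v.re < τ → φ k w ≠ φ j v := by
  have hl : 0 < l := by linarith [G.hl4]
  have hpi := Real.pi_pos
  have H : ∀ k, ∃ (a : ℂ) (φ : ℂ → ℂ) (b : ℂ) (ψ : ℂ → ℂ), k ≤ N → a ∈ S ∧ b ∈ S ∧ a ≠ b ∧ IsTract F φ a τ ∧ IsTract F ψ b τ ∧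
      (∀ x ∈ Icc (0:ℝ) 2, ∃ w, φ w = x + (mid k : ℝ) * Complex.I ∧ w.re + l * (4 * Real.exp (x / 2) - 1/10) ≤ τ) ∧
      (∀ x ∈ Icc (0:ℝ) 2, ∃ w, ψ w = x + (mid (k+1) : ℝ) * Complex.I ∧ w.re + l * (4 * Real.exp (x / 2) - 1/10) ≤ τ) := by
    intro k
    by_cases hk : k ≤ N
    · obtain ⟨a1, e1, a2, e2, φ1, φ2, h⟩ := G.strip1 hk
      exact ⟨a1, φ1, a2, φ2, fun _ => ⟨e1, e2, h⟩⟩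
    · exact ⟨0, id, 0, id, fun h => absurd h hk⟩
  choose a φ b ψ H using H
  have hS : ∀ k ≤ N, a k ∈ S := fun k hk => (H k hk).1
  have hT : ∀ k ≤ N, IsTract F (φ k) (a k) τ := fun k hk => (H k hk).2.2.2.1
  have hex : ∀ x ∈ Icc (0:ℝ) 2, 0 < l * (4 * Real.exp (x / 2) - 1/10) := fun x hx => by
    have := Real.one_le_exp (x := x / 2) (by linarith [hx.1])
    apply mul_pos hl; linarith
  have hmid : ∀ k ≤ N, ∀ x ∈ Icc (0:ℝ) 2, ∃ w, w.re < τ ∧ φ k w = x + (mid k : ℝ) * Complex.I ∧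
      w.re + l * (4 * Real.exp (x / 2) - 1/10) ≤ τ := by
    intro k hk x hx
    obtain ⟨w, h1, h2⟩ := (H k hk).2.2.2.2.2.1 x hx
    exact ⟨w, by linarith [hex x hx], h1, h2⟩
  have hadj : ∀ k, k + 1 ≤ N → a k ≠ a (k+1) := by
    intro k hk he
    have h1 := H k (by omega)
    obtain ⟨w, g1, g2⟩ := h1.2.2.2.2.2.2 0 (by simp)
    obtain ⟨v, g0, g3, g4⟩ := hmid (k+1) hk 0 (by simp)
    have := hex 0 (by simp)
    exact h1.2.2.1 (he.trans (h1.2.2.2.2.1.a_eq (hT _ hk) h1.2.1 (hS _ hk) G.sep (w := w) (v := v) (by linarith) g0 (g1.trans g3.symm)).symm)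
  refine ⟨a, φ, fun k hk => ⟨hS k hk, hT k hk⟩, ?_⟩
  intro k j hk1 hkj hjN w v hw hv he
  have haa := (hT k (by omega)).a_eq (hT j hjN) (hS k (by omega)) (hS j hjN) G.sep hw hv he
  have hkj2 : k + 2 ≤ j := by
    by_contra h
    have : j = k + 1 := by omega
    subst this
    exact hadj k hjN haa
  have hkN : k ≤ N := by omega
  obtain ⟨m, hm⟩ := (hT k hkN).same (haa ▸ hT j hjN) G.L (hS k hkN) G.sep hw hv he
  have hcast : (k:ℝ) + 2 ≤ j := by exact_mod_cast hkj2
  have hk1' : (1:ℝ) ≤ k := by exact_mod_cast hk1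
  have hjN' : (j:ℝ) ≤ N := by exact_mod_cast hjN
  -- mid points
  have hmidj : ∀ x ∈ Icc (0:ℝ) 2, ∃ w, w.re < τ ∧ φ k w = x + (mid j : ℝ) * Complex.I ∧
      w.re + l * (4 * Real.exp (x / 2) - 1/10) ≤ τ := by
    intro x hx
    obtain ⟨w, h1, h2, h3⟩ := hmid j hjN x hx
    refine ⟨w + m * (2 * Real.pi * Complex.I), by simpa using h1, ?_, by simpa using h3⟩
    rw [← hm w h1, h2]
  obtain ⟨A2, hA2, hA2', hA2''⟩ := hmid k hkN 2 (by norm_num)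
  obtain ⟨B2, hB2, hB2', hB2''⟩ := hmidj 2 (by norm_num)
  set t := Real.exp (1 / 2) with ht
  have ht15 : 1.5 ≤ t := by have := Real.add_one_le_exp (1/2 : ℝ); rw [ht]; linarith
  have htt : Real.exp (2 / 2) = t ^ 2 := by rw [ht, ← Real.exp_nat_mul]; norm_num
  -- the sets
  set K1 : Set ℂ := (fun x : ℝ => (x + (mid k : ℝ) * Complex.I : ℂ)) '' Icc 0 2 with hK1
  set Hj : Set ℂ := (fun x : ℝ => (x + (mid j : ℝ) * Complex.I : ℂ)) '' Icc 0 2 with hHj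
  set V : Set ℂ := (fun y : ℝ => ((0:ℝ) + y * Complex.I : ℂ)) '' Icc (mid k) (mid j) with hV
  set Ph : Set ℂ := φ k '' segment ℝ A2 B2 with hPh
  have hdeep : ∀ u ∈ segment ℝ A2 B2, u.re + l * (4 * t ^ 2 - 1/10) ≤ τ := by
    intro u hu
    rw [htt] at hA2'' hB2''
    have hc : Convex ℝ {u : ℂ | u.re ≤ τ - l * (4 * t ^ 2 - 1/10)} := convex_halfSpace_re_le _
    have := hc.segment_subset (x := A2) (y := B2) (by simp only [mem_ofPred_eq]; linarith) (by simp only [mem_ofPred_eq]; linarith) hu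
    simp only [mem_ofPred_eq] at this; linarith
  have hdp : 0 < l * (4 * t ^ 2 - 1/10) := mul_pos hl (by nlinarith)
  have hmk : mid k ≤ mid j := by simp only [mid]; nlinarith
  have cPh : ContinuousOn (φ k) (segment ℝ A2 B2) := (hT k hkN).diff.continuousOn.mono (fun u hu => by
    simp only [mem_ofPred_eq]; linarith [hdeep u hu])
  have conK1 : IsPreconnected K1 := isPreconnected_Icc.image _ (by fun_prop)
  have conHj : IsPreconnected Hj := isPreconnected_Icc.image _ (by fun_prop)
  have conV : IsPreconnected V := isPreconnected_Icc.image _ (by fun_prop)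
  have conPh : IsPreconnected Ph := (convex_segment A2 B2).isPreconnected.image _ cPh
  have j1 : ((0:ℝ) + (mid j : ℝ) * Complex.I : ℂ) ∈ V ∩ Hj := ⟨⟨mid j, ⟨hmk, le_rfl⟩, rfl⟩, ⟨0, by norm_num, rfl⟩⟩
  have j2 : ((2:ℝ) + (mid j : ℝ) * Complex.I : ℂ) ∈ Hj ∩ Ph := ⟨⟨2, by norm_num, rfl⟩, ⟨B2, right_mem_segment _ _ _, hB2'⟩⟩
  have conK2 : IsPreconnected (V ∪ Hj ∪ Ph) := (conV.union _ j1.1 j1.2 conHj).union _ (Or.inr j2.1) j2.2 conPh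
  have cK1 : IsCompact K1 := isCompact_Icc.image (by fun_prop)
  have cK2 : IsCompact (V ∪ Hj ∪ Ph) := ((isCompact_Icc.image (by fun_prop)).union (isCompact_Icc.image (by fun_prop))).union
    ((by
      rw [segment_eq_image_lineMap]; exact isCompact_Icc.image (by fun_prop) : IsCompact (segment ℝ A2 B2)).image_of_continuousOn cPh)
  -- points in tract k
  have inK : ∀ z ∈ K1 ∪ (V ∪ Hj ∪ Ph), (∃ u : ℂ, u.re < τ ∧ φ k u = z) ∨ z ∈ V := by
    rintro z (⟨x, hx, rfl⟩ | (hz | ⟨x, hx, rfl⟩) | ⟨u, hu, rfl⟩)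
    · obtain ⟨w, h1, h2, -⟩ := hmid k hkN x hx; exact Or.inl ⟨w, h1, h2⟩
    · exact Or.inr hz
    · obtain ⟨w, h1, h2, -⟩ := hmidj x hx; exact Or.inl ⟨w, h1, h2⟩
    · exact Or.inl ⟨u, by linarith [hdeep u hu], rfl⟩
  have hm0 : mid 0 ≤ mid k := by simp only [mid]; push_cast; nlinarith
  have hmN : mid j < mid (N + 1) := by simp only [mid]; push_cast; nlinarith
  -- the escape sets
  have esc : ∀ i ≤ N, a i ≠ a k → ∃ E : Set ℂ, IsPreconnected E ∧ (∀ R : ℝ, ∃ q ∈ E, R < ‖q‖) ∧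
      ((1:ℝ) + (mid i : ℝ) * Complex.I : ℂ) ∈ E ∧ Disjoint E (K1 ∪ (V ∪ Hj ∪ Ph)) := by
    intro i hi hne
    obtain ⟨u, h1, h2, h3⟩ := hmid i hi 1 (by norm_num)
    have hsub : {w : ℂ | w.re ≤ u.re} ⊆ {w | w.re < τ} := fun w hw => lt_of_le_of_lt hw h1
    refine ⟨φ i '' {w | w.re ≤ u.re}, ?_, ?_, ⟨u, le_refl u.re, h2⟩, ?_⟩
    · exact (convex_halfSpace_re_le _).isPreconnected.image _ ((hT i hi).diff.continuousOn.mono hsub)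
    · intro R
      obtain ⟨s, hs⟩ := (hT i hi).inf R
      exact ⟨_, ⟨((min (s - 1) u.re : ℝ) : ℂ), by simp, rfl⟩, hs _ (by rw [Complex.ofReal_re]; linarith [min_le_left (s-1) u.re])⟩
    · rw [Set.disjoint_left]
      rintro _ ⟨w', hw', rfl⟩ hz
      rcases inK _ hz with ⟨u', hu', he'⟩ | ⟨y, hy, he'⟩
      · exact hne ((hT k hkN).a_eq (hT i hi) (hS k hkN) (hS i hi) G.sep hu' (hsub hw') he').symm
      · have := G.W (hT i hi) (hsub hw') he'.symm (by simp) (hm0.trans hy.1) (hy.2.trans_lt hmN)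
        rw [zero_div, Real.exp_zero] at this
        have hw'' : w'.re ≤ u.re := hw'
        nlinarith
  obtain ⟨k', rfl⟩ : ∃ k', k = k' + 1 := ⟨k - 1, by omega⟩
  obtain ⟨Ep, p1, p2, p3, p4⟩ := esc (k' + 1 + 1) (by omega) (hadj _ (by omega)).symm
  obtain ⟨Em, m1, m2, m3, m4⟩ := esc k' (by omega) (hadj _ (by omega))
  have ep : mid (k' + 1 + 1) = mid (k' + 1) + 2 * Real.pi := by simp only [mid]; push_cast; ring
  have em : mid k' = mid (k' + 1) - 2 * Real.pi := by simp only [mid]; push_cast; ring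
  rw [ep] at p3
  rw [em] at m3
  have hmj : mid (k' + 1) + 4 * Real.pi ≤ mid j := by simp only [mid]; push_cast; push_cast at hcast; nlinarith
  refine index_contra p1 m1 p2 m2 p3 m3 conK1 conK2 cK1 cK2 p4 m4 (A := (0:ℝ) + (mid (k'+1) : ℝ) * Complex.I)
    (B := (2:ℝ) + (mid (k'+1) : ℝ) * Complex.I) ⟨0, by norm_num, rfl⟩ (Or.inl (Or.inl ⟨mid (k'+1), ⟨le_rfl, hmk⟩, rfl⟩))
    ⟨2, by norm_num, rfl⟩ (Or.inr ⟨A2, left_mem_segment _ _ _, hA2'⟩) ?_ ?_ ?_ ?_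
  · rintro _ ⟨x, hx, rfl⟩
    simp only []
    rw [R_val, Complex.mem_slitPlane_iff]
    left
    simp only [Complex.neg_re, Complex.add_re, Complex.ofReal_re, Complex.re_ofReal_mul, Complex.I_re, mul_zero, add_zero]
    rw [neg_pos]
    apply div_neg_of_neg_of_pos
    · nlinarith [hx.1, hx.2, Real.pi_gt_three]
    · positivity
  · rintro z hz
    apply slit_R
    rintro hre ⟨hi1, hi2⟩
    rcases hz with (⟨y, hy, rfl⟩ | ⟨x, hx, rfl⟩) | ⟨u, hu, rfl⟩
    · simp at hre
    · simp at hi2; linarith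
    · have hu' := hdeep u hu
      have := G.W (hT _ hkN) (w := u) (x := 1) (y := (φ (k'+1) u).im) (by linarith)
        (by rw [← hre]; exact (Complex.re_add_im _).symm) (by simp) (by
          refine le_trans ?_ hi1; rw [← em]; simp only [mid]; push_cast; nlinarith [(Nat.cast_nonneg k' : (0:ℝ) ≤ k')])
        (hi2.trans_lt (by linarith))
      rw [← ht] at this
      have h4 : l * (4 * t + 1 / 2000) < l * (4 * t ^ 2 - 1/10) := mul_lt_mul_of_pos_left (by nlinarith) hl
      linarith
  · rw [R_val]
    simp only [Complex.add_im, Complex.ofReal_im, Complex.im_ofReal_mul, Complex.I_im, mul_one, zero_add]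
    apply div_pos <;> nlinarith [Real.pi_gt_three]
  · rw [R_val]
    simp only [Complex.add_im, Complex.ofReal_im, Complex.im_ofReal_mul, Complex.I_im, mul_one, zero_add]
    apply div_neg_of_neg_of_pos <;> nlinarith [Real.pi_gt_three]
end V4

end PartV3

section PartD1

lemma inv_schw {f ψ : ℂ → ℂ} {v : ℂ} {u : ℝ} (hu : 0 < u) (hψ : DifferentiableOn ℂ ψ (Metric.ball v u))
    (ha : AnalyticAt ℂ f (ψ v)) (he : ∀ x ∈ Metric.ball v u, f (ψ x) = x) :
    ‖schwarzian f (ψ v)‖ ≤ 64 / u ^ 2 * ‖deriv f (ψ v)‖ ^ 2 := by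
  have hv := Metric.ball_mem_nhds v hu
  have hψa := hψ.analyticAt hv
  have e : (fun x => f (ψ x)) =ᶠ[𝓝 v] fun x => x := by filter_upwards [hv] with x hx using he x hx
  have h1 : HasDerivAt (fun x => f (ψ x)) (deriv f (ψ v) * deriv ψ v) v :=
    ha.differentiableAt.hasDerivAt.comp v hψa.differentiableAt.hasDerivAt
  have h2 : deriv f (ψ v) * deriv ψ v = 1 := h1.unique ((hasDerivAt_id v).congr_of_eventuallyEq e)
  have h0 : deriv f (ψ v) * deriv ψ v ≠ 0 := by rw [h2]; exact one_ne_zero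
  have h3 := schw_comp ha hψa (left_ne_zero_of_mul h0) (right_ne_zero_of_mul h0)
  have h5 : schwarzian (fun x : ℂ => x) v = 0 := schw_id v
  rw [schw_congr e, h5] at h3
  have h4 : schwarzian f (ψ v) = -schwarzian ψ v * deriv f (ψ v) ^ 2 := by
    linear_combination (-deriv f (ψ v) ^ 2) * h3 - schwarzian f (ψ v) * (1 + deriv f (ψ v) * deriv ψ v) * h2
  rw [h4, norm_mul, norm_neg, norm_pow]
  refine mul_le_mul_of_nonneg_right (koebe_schw hu hψ ?_ (right_ne_zero_of_mul h0)) (by positivity)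
  intro x hx y hy hxy
  rw [← he x hx, ← he y hy, hxy]

lemma LiftData.schw_le {f : ℂ → ℂ} {P S : Set ℂ} (L : LiftData f P S) {z : ℂ} {u : ℝ} (hz : z ∉ P) (hu : 0 < u)
    (hS : ∀ v ∈ Metric.ball (f z) u, v ∉ S) : ‖schwarzian f z‖ ≤ 64 / u ^ 2 * ‖deriv f z‖ ^ 2 := by
  obtain ⟨ψ, h1, h2, h3⟩ := L.lift (convex_ball (f z) u) Metric.isOpen_ball (h := fun x => x) differentiableOn_id hS
    (Metric.mem_ball_self hu) hz rfl
  have := inv_schw (f := f) hu h1 (by rw [h2]; exact L.an z hz) (fun x hx => (h3 x hx).2)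
  rwa [h2] at this

lemma merom_of_pole {g : ℂ → ℂ} {p : ℂ} (ha : ∀ᶠ z in 𝓝[≠] p, AnalyticAt ℂ g z)
    (hp : Tendsto (fun z => ‖g z‖) (𝓝[≠] p) atTop) : MeromorphicAt g p := by
  have h0 : ∀ᶠ z in 𝓝[≠] p, g z ≠ 0 := by
    filter_upwards [hp.eventually_gt_atTop 0] with z hz using norm_pos_iff.1 hz
  have h1 : Tendsto (fun z => (g z)⁻¹) (𝓝[≠] p) (𝓝 0) := by
    rw [tendsto_zero_iff_norm_tendsto_zero]
    simp only [norm_inv]; exact hp.inv_tendsto_atTop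
  have h2 : AnalyticAt ℂ (Function.update (fun z => (g z)⁻¹) p 0) p := by
    refine Complex.analyticAt_of_differentiable_on_punctured_nhds_of_continuousAt ?_ (continuousAt_update_same.2 h1)
    filter_upwards [ha, h0, self_mem_nhdsWithin] with z h1 h2 h3
    refine (h1.inv h2).differentiableAt.congr_of_eventuallyEq ?_
    filter_upwards [isOpen_ne.mem_nhds h3] with x hx
    simp [Function.update_of_ne hx]
  refine (h2.meromorphicAt.inv).congr ?_
  filter_upwards [self_mem_nhdsWithin] with z hz
  simp [Function.update_of_ne hz]

lemma isPreconnected_outside {R : ℝ} (hR : 0 < R) : IsPreconnected {z : ℂ | R < ‖z‖} := by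
  have : {z : ℂ | R < ‖z‖} = Complex.exp '' {w | Real.log R < w.re} := by
    ext z; simp only [mem_ofPred_eq, mem_image]
    constructor
    · intro h
      have h0 : z ≠ 0 := norm_pos_iff.1 (hR.trans h)
      exact ⟨Complex.log z, by rw [Complex.log_re]; exact Real.log_lt_log hR h, Complex.exp_log h0⟩
    · rintro ⟨w, hw, rfl⟩
      rw [Complex.norm_exp]; exact (Real.log_lt_iff_lt_exp hR).1 hw
  rw [this]
  exact (convex_halfSpace_re_gt _).isPreconnected.image _ Complex.continuous_exp.continuousOn

structure Br (g : ℂ → ℂ) (P S : Set ℂ) (φ : ℂ → ℂ) (a : ℂ) (τ : ℝ) : Prop where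
  diff : DifferentiableOn ℂ φ {w | w.re < τ}
  reg : ∀ w, w.re < τ → φ w ∈ regE g P S
  val : ∀ w, w.re < τ → g (φ w) = a + Complex.exp w

section D1
variable {g φ : ℂ → ℂ} {P S : Set ℂ} {a : ℂ} {τ : ℝ}

lemma Br.open_image (B : Br g P S φ a τ) (L : LiftData g P S) {U : Set ℂ} (hU : IsOpen U) (hs : U ⊆ {w | w.re < τ}) :
    IsOpen (φ '' U) := by
  rw [isOpen_iff_mem_nhds]
  rintro _ ⟨w, hw, rfl⟩
  have hφ : AnalyticAt ℂ φ w := B.diff.analyticAt ((isOpen_reLt τ).mem_nhds (hs hw))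
  have h1 : HasDerivAt (fun x => g (φ x)) (deriv g (φ w) * deriv φ w) w :=
    (L.an _ (B.reg w (hs hw)).1).differentiableAt.hasDerivAt.comp w hφ.differentiableAt.hasDerivAt
  have h2 : (fun x => g (φ x)) =ᶠ[𝓝 w] fun x => a + Complex.exp x := by
    filter_upwards [(isOpen_reLt τ).mem_nhds (hs hw)] with x hx using B.val x hx
  have h3 := h1.unique (((Complex.hasDerivAt_exp w).const_add a).congr_of_eventuallyEq h2)
  have h4 : deriv φ w ≠ 0 := fun h => Complex.exp_ne_zero w (by rw [← h3, h, mul_zero])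
  rw [← hφ.hasStrictDerivAt.map_nhds_eq h4]
  exact image_mem_map (hU.mem_nhds hw)

/-- periodicity from one coincidence -/
lemma Br.shift (B : Br g P S φ a τ) (L : LiftData g P S) {c : ℂ} (hc : c.re = 0) (he : Complex.exp c = 1) {w₀ : ℂ}
    (hw₀ : w₀.re < τ) (h : φ (w₀ + c) = φ w₀) (w : ℂ) (hw : w.re < τ) : φ (w + c) = φ w := by
  have hre : ∀ u : ℂ, (u + c).re = u.re := by intro u; simp [hc]
  refine L.uniq (convex_halfSpace_re_lt τ).isPreconnected (g₁ := fun u => φ (u + c))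
    (B.diff.continuousOn.comp (by fun_prop) (fun u hu => by simpa [hre] using hu)) B.diff.continuousOn
    (fun u hu => B.reg _ (by rw [hre]; exact hu)) (fun u hu => B.reg _ hu) ?_ hw₀ h hw
  intro u hu
  rw [B.val _ (by rw [hre]; exact hu), B.val u hu, Complex.exp_add, he, mul_one]

lemma Br.not_per (B : Br g P S φ a τ) (L : LiftData g P S) (Pc : ∀ K, IsCompact K → (P ∩ K).Finite)
    (nr : ¬∃ p q : Polynomial ℂ, q ≠ 0 ∧ ∀ z ∉ P, q.eval z ≠ 0 → g z = p.eval z / q.eval z)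
    (inf : ∀ R : ℝ, ∃ s : ℝ, ∀ w, w.re < s → R < ‖φ w‖) {y : ℝ} (hy : 0 < y)
    (per : ∀ w, w.re < τ → φ (w + y * Complex.I) = φ w) : False := by
  have perz : ∀ n : ℤ, ∀ w, w.re < τ → φ (w + n * (y * Complex.I)) = φ w := by
    intro n
    induction n with
    | zero => intro w _; simp
    | succ n ih =>
      intro w hw
      rw [← ih w hw, ← per (w + (n:ℤ) * (y * Complex.I)) (by simpa using hw)]; congr 1; push_cast; ring
    | pred n ih =>
      intro w hw
      rw [← ih w hw, ← per _ (by simpa using hw)]; congr 1; push_cast; ring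
  have red : ∀ w : ℂ, w.re < τ → ∃ w' : ℂ, w'.re = w.re ∧ w'.im ∈ Icc 0 y ∧ φ w' = φ w := by
    intro w hw
    refine ⟨w + (-⌊w.im / y⌋ : ℤ) * (y * Complex.I), by simp, ?_, perz _ w hw⟩
    have h1 := Int.floor_le (w.im / y)
    have h2 := (Int.lt_floor_add_one (w.im / y)).le
    rw [le_div_iff₀ hy] at h1
    rw [div_le_iff₀ hy] at h2
    simp
    constructor <;> linarith
  set s := τ - 1 with hs
  have box : ∀ s0, IsCompact (φ '' (Icc s0 s ×ℂ Icc 0 y)) := fun s0 =>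
    (isCompact_Icc.reProdIm isCompact_Icc).image_of_continuousOn (B.diff.continuousOn.mono (fun w hw => by
      have := hw.1.2; simp only [mem_ofPred_eq]; linarith))
  obtain ⟨R, hR⟩ := (box s).isBounded.exists_norm_le
  set R' := max R 1
  have hR1 : 1 ≤ R' := le_max_right _ _
  have hsub : {w : ℂ | w.re < s} ⊆ {w | w.re < τ} := fun w hw => by simp only [mem_ofPred_eq] at hw ⊢; linarith
  have main : {z : ℂ | R' < ‖z‖} ⊆ φ '' {w | w.re < s} := by
    have hcl : {z : ℂ | R' < ‖z‖} ∩ closure (φ '' {w | w.re < s}) ⊆ φ '' {w | w.re < s} := by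
      rintro z ⟨hz, hc⟩
      obtain ⟨s0, hs0⟩ := inf (‖z‖ + 1)
      have h1 : z ∈ closure (φ '' {w | w.re < s} ∩ Metric.ball z 1) := by
        rw [Set.inter_comm]
        exact Metric.isOpen_ball.inter_closure ⟨Metric.mem_ball_self one_pos, hc⟩
      have h2 : φ '' {w | w.re < s} ∩ Metric.ball z 1 ⊆ φ '' (Icc s0 s ×ℂ Icc 0 y) := by
        rintro _ ⟨⟨w, hw, rfl⟩, hb⟩
        obtain ⟨w', e1, e2, e3⟩ := red w (hsub hw)
        refine ⟨w', ⟨⟨?_, ?_⟩, e2⟩, e3⟩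
        · by_contra hlt
          have := hs0 w (by rw [← e1]; exact not_le.1 hlt)
          rw [Metric.mem_ball, dist_eq_norm] at hb
          linarith [norm_sub_norm_le (φ w) z]
        · rw [e1]; exact le_of_lt hw
      obtain ⟨w, hw, rfl⟩ := (box s0).isClosed.closure_subset_iff.2 h2 h1
      refine ⟨w, lt_of_le_of_ne hw.1.2 (fun he => ?_), rfl⟩
      have := hR _ ⟨w, ⟨⟨he.ge, he.le⟩, hw.2⟩, rfl⟩
      exact absurd hz (not_lt.2 (this.trans (le_max_left _ _)))
    have hop := B.open_image L (isOpen_reLt s) hsub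
    refine (isPreconnected_outside (by linarith)).subset_left_of_subset_union hop isClosed_closure.isOpen_compl
      (disjoint_compl_right.mono_left subset_closure) (fun z hz => ?_) ?_
    · by_cases h : z ∈ closure (φ '' {w | w.re < s})
      · exact Or.inl (hcl ⟨hz, h⟩)
      · exact Or.inr h
    · obtain ⟨s0, hs0⟩ := inf R'
      refine ⟨φ ((min s0 s - 1 : ℝ) : ℂ), hs0 _ ?_, _, ?_, rfl⟩
      · rw [Complex.ofReal_re]; linarith [min_le_left s0 s]
      · simp only [mem_ofPred_eq, Complex.ofReal_re]; linarith [min_le_right s0 s]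
  have hPb : P ⊆ Metric.closedBall 0 R' := by
    intro p hp
    rw [mem_closedBall_zero_iff]
    by_contra h
    obtain ⟨w, hw, rfl⟩ := main (not_le.1 h)
    exact (B.reg w (hsub hw)).1 hp
  have hPf : P.Finite := by
    have := Pc _ (isCompact_closedBall (0:ℂ) R')
    rwa [inter_eq_left.2 hPb] at this
  apply nr
  obtain ⟨p, q, hq, h⟩ := rational_of_poly hPf.toFinset (g := g) (fun z hz => L.an z (by simpa using hz)) (fun z => by
    by_cases hz : z ∈ P
    · refine merom_of_pole ?_ (L.pole z hz)
      have : (P \ {z})ᶜ ∈ 𝓝 z := (hPf.sdiff).isClosed.isOpen_compl.mem_nhds (by simp)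
      filter_upwards [nhdsWithin_le_nhds this, self_mem_nhdsWithin] with x h1 h2
      exact L.an x (fun hx => h1 ⟨hx, h2⟩)
    · exact (L.an z hz).meromorphicAt) (K := 0) (C := ‖a‖ + Real.exp τ) (R := R' + 1) (by linarith) (fun z hz => by
      obtain ⟨w, hw, rfl⟩ := main (show R' < ‖z‖ by linarith)
      rw [B.val w (hsub hw), pow_zero, mul_one]
      refine (norm_add_le _ _).trans ?_
      rw [Complex.norm_exp]
      linarith [Real.exp_lt_exp.2 (show w.re < τ from hsub hw)])
  exact ⟨p, q, hq, fun z hz _ => h z (by simpa using hz)⟩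

lemma Br.tract (B : Br g P S φ a τ) (L : LiftData g P S) (Pc : ∀ K, IsCompact K → (P ∩ K).Finite)
    (nr : ¬∃ p q : Polynomial ℂ, q ≠ 0 ∧ ∀ z ∉ P, q.eval z ≠ 0 → g z = p.eval z / q.eval z)
    (inf : ∀ R : ℝ, ∃ s : ℝ, ∀ w, w.re < s → R < ‖φ w‖) : IsTract g φ a τ := by
  refine ⟨B.diff, ?_, B.val, fun w hw => L.an _ (B.reg w hw).1, inf⟩
  have key : ∀ w v : ℂ, w.re < τ → v.re < τ → φ w = φ v → w ≠ v → w.im ≤ v.im → False := by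
    intro w v hw hv he hne hle
    have h2 := B.val w hw
    rw [he, B.val v hv] at h2
    obtain ⟨m, hm⟩ := Complex.exp_eq_exp_iff_exists_int.1 (add_left_cancel h2)
    have h3 : v = w + ((m * (2 * Real.pi) : ℝ) : ℂ) * Complex.I := by rw [hm]; push_cast; ring
    have h4 : 0 < (m * (2 * Real.pi) : ℝ) := by
      refine lt_of_le_of_ne ?_ (fun h => hne (by rw [h3, ← h]; simp))
      rw [h3] at hle; simpa using hle
    refine B.not_per L Pc nr inf h4 (B.shift L (by simp) ?_ hw (by rw [← h3, he]))
    have := Complex.exp_int_mul_two_pi_mul_I m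
    rw [← this]; congr 1; push_cast; ring
  intro w hw v hv he
  by_contra hne
  rcases le_total w.im v.im with h | h
  · exact key w v hw hv he hne h
  · exact key v w hv hw he.symm (Ne.symm hne) h

end D1

end PartD1

section PartD2

section D2
variable {g φ : ℂ → ℂ} {P S : Set ℂ} {a : ℂ} {τ : ℝ}

lemma Br.disk (B : Br g P S φ a τ) (L : LiftData g P S) {d : ℂ} (had : AnalyticAt ℂ g d) (hga : g d = a)
    (hd : deriv g d ≠ 0)
    (conn : ∀ r c : ℝ, 0 < r → 0 < c → (∀ z ∈ Metric.sphere d r, c ≤ ‖g z - a‖) →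
      ∀ w : ℂ, w.re < τ → Real.exp w.re < c → φ w ∈ Metric.ball d r) :
    ∃ ψ : ℂ → ℂ, DifferentiableOn ℂ ψ (Metric.ball a (Real.exp τ)) ∧
      (∀ v ∈ Metric.ball a (Real.exp τ), AnalyticAt ℂ g (ψ v) ∧ g (ψ v) = v) ∧ ∀ w, w.re < τ → ψ (a + Complex.exp w) = φ w := by
  obtain ⟨e, he1, -, he⟩ := locinv had hd isOpen_univ (mem_univ d)
  have hea : e d = a := by rw [he, hga]
  have hat : a ∈ e.target := hea ▸ e.map_source he1
  have hsa : e.symm a = d := by rw [← hea, e.left_inv he1]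
  obtain ⟨r, hr, hrs⟩ := Metric.nhds_basis_closedBall.mem_iff.1 (e.open_source.mem_nhds he1)
  have hcb : ∀ᶠ v in 𝓝 a, e.symm v ∈ Metric.ball d r ∧ v ∈ e.target :=
    ((e.symm.continuousAt (x := a) (by simpa using hat)).eventually (by rw [hsa]; exact Metric.ball_mem_nhds d hr)).and
      (e.open_target.mem_nhds hat)
  obtain ⟨c, hc, hcs⟩ := Metric.eventually_nhds_iff.1 hcb
  have hball := conn r c hr hc (fun z hz => by
    by_contra hlt
    have h1 := hcs (y := g z) (by rw [dist_eq_norm]; exact not_le.1 hlt)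
    rw [← he z, e.left_inv (hrs (Metric.sphere_subset_closedBall hz))] at h1
    have h2 := h1.1
    rw [Metric.mem_ball, Metric.mem_sphere.1 hz] at h2
    exact lt_irrefl _ h2)
  have hloc : ∀ w : ℂ, w.re < τ → Real.exp w.re < c → φ w = e.symm (a + Complex.exp w) := by
    intro w h1 h2
    rw [← B.val w h1, ← he, e.left_inv (hrs (Metric.ball_subset_closedBall (hball w h1 h2)))]
  have hper : ∀ m : ℤ, ∀ w : ℂ, w.re < τ → φ (w + m * (2 * Real.pi * Complex.I)) = φ w := by
    intro m
    have hw0 : ((min τ (Real.log c) - 1 : ℝ) : ℂ).re < τ := by rw [Complex.ofReal_re]; linarith [min_le_left τ (Real.log c)]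
    have hw1 : Real.exp ((min τ (Real.log c) - 1 : ℝ) : ℂ).re < c := by
      rw [Complex.ofReal_re, ← Real.lt_log_iff_exp_lt hc]; linarith [min_le_right τ (Real.log c)]
    refine B.shift L (by simp) (Complex.exp_int_mul_two_pi_mul_I m) hw0 ?_
    rw [hloc _ hw0 hw1, hloc, Complex.exp_add, Complex.exp_int_mul_two_pi_mul_I, mul_one]
    · simpa using hw0
    · simpa using hw1
  set ψ : ℂ → ℂ := fun v => if v = a then d else φ (Complex.log (v - a)) with hψ
  have hψφ : ∀ w : ℂ, w.re < τ → ψ (a + Complex.exp w) = φ w := by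
    intro w hw
    have h0 : a + Complex.exp w ≠ a := by simp [Complex.exp_ne_zero]
    simp only [hψ, if_neg h0, add_sub_cancel_left]
    obtain ⟨m, hm⟩ := Complex.exp_eq_exp_iff_exists_int.1 (Complex.exp_log (Complex.exp_ne_zero w))
    rw [hm, hper m w hw]
  have hlog : ∀ v ∈ Metric.ball a (Real.exp τ), v ≠ a → (Complex.log (v - a)).re < τ := by
    intro v hv hne
    rw [Complex.log_re, Real.log_lt_iff_lt_exp (norm_pos_iff.2 (sub_ne_zero.2 hne)), ← dist_eq_norm]
    exact hv
  refine ⟨ψ, ?_, ?_, hψφ⟩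
  · intro v hv
    refine DifferentiableAt.differentiableWithinAt ?_
    by_cases hva : v = a
    · subst hva
      have h1 : DifferentiableAt ℂ e.symm v := by
        refine (e.hasDerivAt_symm hat hd ?_).differentiableAt
        rw [hsa]
        exact had.differentiableAt.hasDerivAt.congr_of_eventuallyEq (Eventually.of_forall he)
      refine h1.congr_of_eventuallyEq ?_
      filter_upwards [Metric.ball_mem_nhds v hc, Metric.ball_mem_nhds v (Real.exp_pos τ)] with x hx hx'
      by_cases hxv : x = v
      · simp [hψ, hxv, hsa]
      · simp only [hψ, if_neg hxv]
        rw [hloc _ (hlog x hx' hxv), Complex.exp_log (sub_ne_zero.2 hxv), add_sub_cancel]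
        rw [Complex.log_re, Real.exp_log (norm_pos_iff.2 (sub_ne_zero.2 hxv)), ← dist_eq_norm]
        exact hx
    · have hne := sub_ne_zero.2 hva
      have hw0 := hlog v hv hva
      set w0 := Complex.log (v - a) with hw0d
      have h1 : DifferentiableAt ℂ (fun x => w0 + Complex.log ((x - a) / (v - a))) v := by
        refine DifferentiableAt.const_add _ (DifferentiableAt.clog (by fun_prop) ?_)
        rw [div_self hne]; exact Complex.one_mem_slitPlane
      have h2 : w0 + Complex.log ((v - a) / (v - a)) = w0 := by rw [div_self hne, Complex.log_one, add_zero]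
      have h3 : DifferentiableAt ℂ (fun x => φ (w0 + Complex.log ((x - a) / (v - a)))) v := by
        refine DifferentiableAt.comp v (g := φ) ?_ h1
        rw [h2]; exact B.diff.differentiableAt ((isOpen_reLt τ).mem_nhds hw0)
      refine h3.congr_of_eventuallyEq ?_
      have h4 : ∀ᶠ x in 𝓝 v, (w0 + Complex.log ((x - a) / (v - a))).re < τ :=
        h1.continuousAt.eventually (p := fun x => x.re < τ) (by simp only [h2]; exact (isOpen_reLt τ).mem_nhds hw0)
      filter_upwards [h4, isOpen_ne.mem_nhds hva] with x hx hxa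
      rw [← hψφ _ hx, Complex.exp_add, Complex.exp_log hne, Complex.exp_log (div_ne_zero (sub_ne_zero.2 hxa) hne),
        mul_div_cancel₀ _ hne, add_sub_cancel]
  · intro v hv
    by_cases hva : v = a
    · simp [hψ, hva, had, hga]
    · have h1 := hlog v hv hva
      simp only [hψ, if_neg hva]
      exact ⟨L.an _ (B.reg _ h1).1, by rw [B.val _ h1, Complex.exp_log (sub_ne_zero.2 hva), add_sub_cancel]⟩

theorem Br.dich (B : Br g P S φ a τ) (L : LiftData g P S) (Pc : ∀ K, IsCompact K → (P ∩ K).Finite)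
    (nr : ¬∃ p q : Polynomial ℂ, q ≠ 0 ∧ ∀ z ∉ P, q.eval z ≠ 0 → g z = p.eval z / q.eval z) :
    IsTract g φ a τ ∨ (∃ ψ : ℂ → ℂ, DifferentiableOn ℂ ψ (Metric.ball a (Real.exp τ)) ∧
      (∀ v ∈ Metric.ball a (Real.exp τ), AnalyticAt ℂ g (ψ v) ∧ g (ψ v) = v) ∧ ∀ w, w.re < τ → ψ (a + Complex.exp w) = φ w) ∨
    ∃ d, d ∉ P ∧ g d = a ∧ deriv g d = 0 ∧ ∀ r c : ℝ, 0 < r → Real.exp τ ≤ c → (∀ z ∈ Metric.sphere d r, c ≤ ‖g z - a‖) →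
      ∀ w : ℂ, w.re < τ → φ w ∈ Metric.ball d r := by
  by_cases inf : ∀ R : ℝ, ∃ s : ℝ, ∀ w, w.re < s → R < ‖φ w‖
  · exact Or.inl (B.tract L Pc nr inf)
  right
  push Not at inf
  obtain ⟨R, hR⟩ := inf
  obtain ⟨d, -, hd⟩ := (isCompact_closedBall (0:ℂ) R).exists_mapClusterPt_of_frequently (f := φ) (l := comap Complex.re atBot) (by
    rw [Filter.frequently_iff]
    intro U hU
    obtain ⟨T, hT, hTU⟩ := mem_comap.1 hU
    obtain ⟨s, hs⟩ := mem_atBot_sets.1 hT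
    obtain ⟨w, h1, h2⟩ := hR s
    exact ⟨w, hTU (hs _ h1.le), by simpa using h2⟩)
  have clus : ∀ U ∈ 𝓝 d, ∀ s : ℝ, ∃ w : ℂ, w.re < s ∧ φ w ∈ U := by
    intro U hU s
    have h1 := (mapClusterPt_iff_frequently.1 hd) U hU
    have h2 : ∀ᶠ w : ℂ in comap Complex.re atBot, w.re < s := (eventually_lt_atBot s).comap _
    obtain ⟨w, h3, h4⟩ := (h1.and_eventually h2).exists
    exact ⟨w, h4, h3⟩
  have hdP : d ∉ P := by
    intro hP
    have h1 := (L.pole d hP).eventually_gt_atTop (‖a‖ + 1)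
    rw [eventually_nhdsWithin_iff] at h1
    obtain ⟨w, h2, h3⟩ := clus _ h1 (min τ 0)
    have hw := h2.trans_le (min_le_left _ _)
    have h4 := h3 (fun h => (B.reg w hw).1 (by rw [mem_singleton_iff.1 h]; exact hP))
    rw [B.val w hw] at h4
    have h5 := norm_add_le a (Complex.exp w)
    rw [Complex.norm_exp] at h5
    linarith [Real.exp_lt_one_iff.2 (h2.trans_le (min_le_right _ _))]
  have had := L.an d hdP
  have hga : g d = a := by
    by_contra hne
    have h0 := norm_pos_iff.2 (sub_ne_zero.2 hne)
    have h1 : ∀ᶠ z in 𝓝 d, ‖g d - a‖ / 2 < ‖g z - a‖ :=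
      (had.continuousAt.sub continuousAt_const).norm.eventually (lt_mem_nhds (show ‖g d - a‖ / 2 < ‖g d - a‖ by linarith))
    obtain ⟨w, h2, h3⟩ := clus _ h1 (min τ (Real.log (‖g d - a‖ / 2)))
    have hw := h2.trans_le (min_le_left _ _)
    simp only [mem_ofPred_eq] at h3
    rw [B.val w hw, add_sub_cancel_left, Complex.norm_exp] at h3
    have := (Real.lt_log_iff_exp_lt (by linarith)).1 (h2.trans_le (min_le_right _ _))
    linarith
  have conn : ∀ r c : ℝ, 0 < r → 0 < c → (∀ z ∈ Metric.sphere d r, c ≤ ‖g z - a‖) →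
      ∀ w : ℂ, w.re < τ → Real.exp w.re < c → φ w ∈ Metric.ball d r := by
    intro r c hr hc hs w hw hwc
    set m := min τ (Real.log c)
    have hm : {w : ℂ | w.re < m} ⊆ {w | w.re < τ} := fun u hu => lt_of_lt_of_le (show u.re < m from hu) (min_le_left _ _)
    have hpc : IsPreconnected (φ '' {w | w.re < m}) :=
      (convex_halfSpace_re_lt m).isPreconnected.image _ (B.diff.continuousOn.mono hm)
    refine hpc.subset_left_of_subset_union Metric.isOpen_ball Metric.isClosed_closedBall.isOpen_compl
      (disjoint_compl_right.mono_left Metric.ball_subset_closedBall) ?_ ?_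
      ⟨w, lt_min hw ((Real.lt_log_iff_exp_lt hc).2 hwc), rfl⟩
    · rintro _ ⟨u, hu, rfl⟩
      by_cases h1 : φ u ∈ Metric.closedBall d r
      · left
        refine Metric.mem_ball.2 (lt_of_le_of_ne (Metric.mem_closedBall.1 h1) (fun h2 => ?_))
        have h3 := hs _ h2
        rw [B.val u (hm hu), add_sub_cancel_left, Complex.norm_exp] at h3
        exact absurd ((Real.lt_log_iff_exp_lt hc).1 (lt_of_lt_of_le hu (min_le_right _ _))) (not_lt.2 h3)
      · exact Or.inr h1
    · obtain ⟨u, h1, h2⟩ := clus _ (Metric.ball_mem_nhds d hr) m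
      exact ⟨φ u, ⟨u, h1, rfl⟩, h2⟩
  by_cases h0 : deriv g d = 0
  · exact Or.inr ⟨d, hdP, hga, h0, fun r c hr hc hs w hw => conn r c hr ((Real.exp_pos τ).trans_le hc) hs w hw
      ((Real.exp_lt_exp.2 hw).trans_le hc)⟩
  · exact Or.inl (B.disk L had hga h0 conn)

end D2

end PartD2

section PartD3

section D3
variable {g q : ℂ → ℂ} {P Q S Sq : Set ℂ}

lemma Nn_le {z : ℂ} {X : ℝ} (hg : ‖g z‖ ≤ 1) (hd : deriv g z ≠ 0) (h : ‖schwarzian g z‖ ≤ X * ‖deriv g z‖ ^ 2) :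
    (Nn g 0 1 1 z) ^ 2 * ‖schwarzian g z / 2‖ ≤ 2 * X := by
  have hd' := norm_pos_iff.2 hd
  unfold Nn
  rw [norm_div, Complex.norm_two, sub_zero, one_mul, mul_pow, inv_pow]
  have h2 : (‖g z‖ ^ 2 + 1) ^ 2 ≤ 4 := by nlinarith [norm_nonneg (g z), sq_nonneg ‖g z‖, pow_le_one₀ (n := 2) (norm_nonneg _) hg]
  have h1 : (‖deriv g z‖ ^ 2)⁻¹ * ‖schwarzian g z‖ ≤ X := by
    rw [inv_mul_le_iff₀ (by positivity), mul_comm]; exact h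
  calc (‖g z‖ ^ 2 + 1) ^ 2 * (‖deriv g z‖ ^ 2)⁻¹ * (‖schwarzian g z‖ / 2)
      = (‖g z‖ ^ 2 + 1) ^ 2 * ((‖deriv g z‖ ^ 2)⁻¹ * ‖schwarzian g z‖) / 2 := by ring
    _ ≤ 4 * X / 2 := by
        have : 0 ≤ (‖deriv g z‖ ^ 2)⁻¹ * ‖schwarzian g z‖ := by positivity
        gcongr
    _ = 2 * X := by ring

lemma big_le (Lq : LiftData q Q Sq) (Sq2 : ∀ a ∈ Sq, 2 ≤ ‖a‖) {z : ℂ} (ha : AnalyticAt ℂ g z) (hd : deriv g z ≠ 0)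
    (hg : 1 ≤ ‖g z‖) (hQ : z ∉ Q) (hq : ∀ᶠ w in 𝓝 z, q w = (g w)⁻¹) :
    (Nn g 0 1 1 z) ^ 2 * ‖schwarzian g z / 2‖ ≤ 128 := by
  have hg0 : 0 < ‖g z‖ := by linarith
  have hne := norm_pos_iff.1 hg0
  have hqz : ‖q z‖ ≤ 1 := by rw [hq.self_of_nhds, norm_inv]; exact inv_le_one_of_one_le₀ hg
  have h1 := Lq.schw_le hQ one_pos (fun v hv hS => by
    have := Sq2 v hS
    rw [Metric.mem_ball, dist_eq_norm] at hv
    linarith [norm_sub_norm_le v (q z)])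
  have h2 : deriv q z = -deriv g z / g z ^ 2 := by
    rw [EventuallyEq.deriv_eq hq]; exact (ha.differentiableAt.hasDerivAt.fun_inv hne).deriv
  rw [schw_congr hq, schw_inv_comp ha hne hd, h2, norm_div, norm_neg, norm_pow] at h1
  have hd' := norm_pos_iff.2 hd
  unfold Nn
  rw [norm_div, Complex.norm_two, sub_zero, one_mul, mul_pow, inv_pow]
  have h3 : (‖g z‖ ^ 2 + 1) ^ 2 ≤ 4 * (‖g z‖ ^ 2) ^ 2 := by nlinarith [one_le_pow₀ (n := 2) hg]
  calc (‖g z‖ ^ 2 + 1) ^ 2 * (‖deriv g z‖ ^ 2)⁻¹ * (‖schwarzian g z‖ / 2)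
      ≤ 4 * (‖g z‖ ^ 2) ^ 2 * (‖deriv g z‖ ^ 2)⁻¹ * ((64 / 1 ^ 2 * (‖deriv g z‖ / ‖g z‖ ^ 2) ^ 2) / 2) := by gcongr
    _ = 128 := by field_simp; norm_num

theorem HD_of (L : LiftData g P S) (Lq : LiftData q Q Sq) (finS : S.Finite)
    (Sq2 : ∀ a ∈ Sq, 2 ≤ ‖a‖) (rel : ∀ z ∉ P, g z ≠ 0 → z ∉ Q ∧ ∀ᶠ w in 𝓝 z, q w = (g w)⁻¹)
    (Dm : {z | z ∉ P ∧ deriv g z = 0}.Finite) (Pc : ∀ K, IsCompact K → (P ∩ K).Finite)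
    (nr : ¬∃ p q : Polynomial ℂ, q ≠ 0 ∧ ∀ z ∉ P, q.eval z ≠ 0 → g z = p.eval z / q.eval z) :
    ∃ τ C0 R1 : ℝ, τ ≤ 0 ∧ 0 ≤ C0 ∧ (∀ a ∈ S, ∀ b ∈ S, a ≠ b → 2 * Real.exp τ ≤ ‖a - b‖) ∧
      HDs g S τ C0 {z | R1 < ‖z‖} := by
  have hexp : ∀ c : ℝ, 0 < c → ∀ᶠ τ in atBot, Real.exp τ ≤ c := fun c hc =>
    Real.tendsto_exp_atBot.eventually (ge_mem_nhds hc)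
  have E1 : ∀ᶠ τ in atBot, ∀ d ∈ {z | z ∉ P ∧ deriv g z = 0}, ∃ r : ℝ, 0 < r ∧ r ≤ 1 ∧
      ∀ z ∈ Metric.sphere d r, Real.exp τ ≤ ‖g z - g d‖ := by
    rw [eventually_all_finite Dm]
    rintro d ⟨hdP, -⟩
    have had := L.an d hdP
    have hnear : ∀ᶠ z in 𝓝 d, z ∉ P := L.clP.isOpen_compl.mem_nhds hdP
    have hne : ∀ᶠ z in 𝓝[≠] d, g z - g d ≠ 0 := by
      refine (had.sub analyticAt_const).eventually_eq_zero_or_eventually_ne_zero.resolve_left (fun h0 => ?_)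
      refine (infinite_of_mem_nhds d ?_) Dm
      filter_upwards [hnear, h0.eventually_nhds] with z h1 h2
      refine ⟨h1, ?_⟩
      have : g =ᶠ[𝓝 z] fun _ => g d := by filter_upwards [h2] with x hx using sub_eq_zero.1 hx
      rw [this.deriv_eq]; simp
    rw [eventually_nhdsWithin_iff] at hne
    obtain ⟨r, hr, hrs⟩ := Metric.nhds_basis_closedBall.mem_iff.1 (hne.and hnear)
    set r' := min r 1
    have hr' : 0 < r' := lt_min hr one_pos
    have hsub : Metric.sphere d r' ⊆ Metric.closedBall d r :=
      Metric.sphere_subset_closedBall.trans (Metric.closedBall_subset_closedBall (min_le_left _ _))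
    obtain ⟨x, hx, hmin⟩ := (isCompact_sphere d r').exists_isMinOn (f := fun z => ‖g z - g d‖)
      (NormedSpace.sphere_nonempty.2 hr'.le) (fun z hz =>
        ((L.an z (hrs (hsub hz)).2).continuousAt.sub continuousAt_const).norm.continuousWithinAt)
    have hxd : x ≠ d := fun h => by rw [h, Metric.mem_sphere, dist_self] at hx; exact hr'.ne hx
    filter_upwards [hexp _ (norm_pos_iff.2 ((hrs (hsub hx)).1 hxd))] with τ hτ
    exact ⟨r', hr', min_le_right _ _, fun z hz => hτ.trans (hmin hz)⟩
  have E2 : ∀ᶠ τ in atBot, ∀ a ∈ S, ∀ b ∈ S, a ≠ b → 2 * Real.exp τ ≤ ‖a - b‖ := by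
    rw [eventually_all_finite finS]; intro a _
    rw [eventually_all_finite finS]; intro b _
    by_cases h : a = b
    · simp [h]
    · filter_upwards [hexp _ (half_pos (norm_pos_iff.2 (sub_ne_zero.2 h)))] with τ hτ _
      linarith
  obtain ⟨τ, ⟨h1, sep⟩, hτ⟩ := ((E1.and E2).and (eventually_le_atBot 0)).exists
  obtain ⟨R, hR⟩ := Dm.isBounded.exists_norm_le
  have hT := Real.exp_pos τ
  have hT1 : Real.exp τ ≤ 1 := Real.exp_le_one_iff.2 hτ
  set T := Real.exp τ with hTd
  refine ⟨τ, 600 / T ^ 2, R + 1, hτ, by positivity, sep, ?_⟩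
  intro z hz ha hS hd
  have hzP : z ∉ P := fun hP => not_tendsto_nhds_of_tendsto_atTop (L.pole _ hP) _
    (ha.continuousAt.norm.tendsto.mono_left (nhdsWithin_le_nhds (s := {z}ᶜ)))
  have h600 : 128 ≤ 600 / T ^ 2 := by
    rw [le_div_iff₀ (by positivity)]; nlinarith
  have h512 : 2 * (64 / (T / 2) ^ 2) ≤ 600 / T ^ 2 := by
    rw [show 2 * (64 / (T / 2) ^ 2) = 512 / T ^ 2 by field_simp; norm_num]; gcongr; norm_num
  by_cases hg1 : 1 ≤ ‖g z‖
  · obtain ⟨hQ, hq⟩ := rel z hzP (norm_pos_iff.1 (by linarith))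
    exact Or.inl ((big_le Lq Sq2 ha hd hg1 hQ hq).trans h600)
  push Not at hg1
  by_cases hfar : ∀ a ∈ S, T / 2 ≤ ‖g z - a‖
  · refine Or.inl ((Nn_le hg1.le hd (L.schw_le hzP (half_pos hT) (fun v hv hvS => ?_))).trans h512)
    rw [Metric.mem_ball, dist_comm, dist_eq_norm] at hv
    exact absurd (hfar v hvS) (not_le.2 hv)
  push Not at hfar
  obtain ⟨a, haS, hza⟩ := hfar
  have hne : g z - a ≠ 0 := sub_ne_zero.2 (fun h => hS (h ▸ haS))
  set w0 := Complex.log (g z - a) with hw0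
  have hw0e : Complex.exp w0 = g z - a := Complex.exp_log hne
  have hw0n : Real.exp w0.re = ‖g z - a‖ := by rw [← Complex.norm_exp, hw0e]
  have hw0r : w0.re + 69/100 ≤ τ := by
    have h2 : Real.exp (w0.re + Real.log 2) < T := by rw [Real.exp_add, hw0n, Real.exp_log two_pos]; linarith
    have := Real.exp_lt_exp.1 h2
    linarith [Real.log_two_gt_d9]
  have hw0t : w0.re < τ := by linarith
  obtain ⟨φ, k1, k2, k3⟩ := L.lift (convex_halfSpace_re_lt τ) (isOpen_reLt τ) (h := fun w => a + Complex.exp w)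
    (by fun_prop) (fun w hw hwS => by
      have := sep _ hwS a haS (by simp [Complex.exp_ne_zero])
      rw [add_sub_cancel_left, Complex.norm_exp] at this
      linarith [Real.exp_lt_exp.2 (show w.re < τ from hw)]) hw0t hzP (by rw [hw0e]; ring)
  have B : Br g P S φ a τ := ⟨k1, fun w hw => (k3 w hw).1, fun w hw => (k3 w hw).2⟩
  rcases B.dich L Pc nr with ht | ⟨ψ, p1, p2, p3⟩ | ⟨d, d1, d2, d3, d4⟩
  · refine Or.inr ⟨a, haS, φ, w0, ht, hw0t, k2, ?_⟩
    obtain ⟨s1, s2⟩ := ht.schw hw0t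
    have s3 := ht.deriv_mul hw0t
    rw [k2] at s1 s3
    have hφ0 := (ht.deriv_ne hw0t).2
    have s4 : ‖schwarzian φ w0‖ ≤ 140 := s2.trans (by
      rw [div_le_iff₀ (by apply pow_pos; linarith)]; nlinarith)
    have s5 : ‖schwarzian g z‖ * ‖deriv φ w0‖ ^ 2 ≤ 141 := by
      rw [← norm_pow, ← norm_mul, s1]
      refine (norm_sub_le _ _).trans ?_
      have : ‖(-1 / 2 : ℂ)‖ = 1 / 2 := by norm_num
      linarith
    have s6 : ‖deriv g z‖ * ‖deriv φ w0‖ = Real.exp w0.re := by rw [← norm_mul, s3, Complex.norm_exp]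
    have hp := norm_pos_iff.2 hφ0
    have s7 : ‖schwarzian g z‖ ≤ 141 / Real.exp w0.re ^ 2 * ‖deriv g z‖ ^ 2 := by
      rw [div_mul_eq_mul_div, le_div_iff₀ (by positivity), ← s6]
      nlinarith [mul_le_mul_of_nonneg_right s5 (sq_nonneg ‖deriv g z‖)]
    refine (Nn_le hg1.le hd s7).trans ?_
    have s8 : Real.exp (2 * (τ - w0.re)) = T ^ 2 / Real.exp w0.re ^ 2 := by
      rw [hTd, ← Real.exp_nat_mul, ← Real.exp_nat_mul, ← Real.exp_sub]; congr 1; push_cast; ring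
    rw [s8, show 600 / T ^ 2 * (T ^ 2 / Real.exp w0.re ^ 2) = 600 / Real.exp w0.re ^ 2 by field_simp,
      ← mul_div_assoc]
    gcongr; norm_num
  · left
    have hv : Metric.ball (g z) (T / 2) ⊆ Metric.ball a T := Metric.ball_subset_ball' (by rw [dist_eq_norm]; linarith)
    have hz' : ψ (g z) = z := by have := p3 w0 hw0t; rwa [hw0e, add_sub_cancel, k2] at this
    have := inv_schw (f := g) (half_pos hT) (p1.mono hv) (by rw [hz']; exact ha) (fun x hx => (p2 x (hv hx)).2)
    rw [hz'] at this
    exact (Nn_le hg1.le hd this).trans h512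
  · exfalso
    obtain ⟨r, r1, r2, r3⟩ := h1 d ⟨d1, d3⟩
    have h4 := d4 r T r1 le_rfl (fun x hx => by rw [← d2]; exact r3 x hx) w0 hw0t
    rw [k2, Metric.mem_ball, dist_eq_norm] at h4
    have h5 := hR d ⟨d1, d3⟩
    have h6 : R + 1 < ‖z‖ := hz
    linarith [norm_sub_norm_le z d]
end D3

end PartD3

section PartN1

lemma fin_of_iso {P K : Set ℂ} (h : ∀ z, ∀ᶠ w in 𝓝[≠] z, w ∉ P) (hK : IsCompact K) : (P ∩ K).Finite := by
  by_contra hinf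
  obtain ⟨x, -, hx⟩ := Set.Infinite.exists_accPt_of_subset_isCompact hinf hK inter_subset_right
  obtain ⟨y, hy1, hy2⟩ := ((accPt_iff_frequently_nhdsNE.1 hx).and_eventually (h x)).exists
  exact hy2 hy1.1

lemma count_of_fin {P : Set ℂ} (h : ∀ K, IsCompact K → (P ∩ K).Finite) : P.Countable := by
  have : P = ⋃ n : ℕ, P ∩ Metric.closedBall 0 n := by
    rw [← inter_iUnion, Metric.iUnion_closedBall_nat, inter_univ]
  rw [this]
  exact countable_iUnion (fun n => (h _ (isCompact_closedBall _ _)).countable)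

lemma iso_of_fin {P : Set ℂ} (h : ∀ K, IsCompact K → (P ∩ K).Finite) (z : ℂ) : ∀ᶠ w in 𝓝[≠] z, w ∉ P := by
  have h1 := (h _ (isCompact_closedBall z 1)).sdiff (t := {z})
  filter_upwards [nhdsWithin_le_nhds (h1.isClosed.isOpen_compl.mem_nhds (by simp : z ∈ _)), self_mem_nhdsWithin,
    nhdsWithin_le_nhds (Metric.closedBall_mem_nhds z one_pos)] with w a b c hP
  exact a ⟨⟨hP, c⟩, b⟩

structure Nm (f : ℂ → ℂ) (Pf : Set ℂ) (V : Set (Option ℂ)) (c κ : ℂ) : Prop where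
  clP : IsClosed Pf
  an : ∀ z ∉ Pf, AnalyticAt ℂ f z
  pole : ∀ p ∈ Pf, Tendsto (fun z => ‖f z‖) (𝓝[≠] p) atTop
  iso : ∀ z b, ∀ᶠ w in 𝓝[≠] z, w ∉ Pf ∧ f w ≠ b
  mult : {z | MultiplePoint f z}.Finite
  cmul : ∀ z ∉ Pf, deriv f z = 0 → MultiplePoint f z
  finV : V.Finite
  critV : ∀ z, MultiplePoint f z → valueAt f Pf z ∈ V
  asyV : ∀ γ b, AsymptoticPath f Pf b γ → b ∈ V
  κ0 : κ ≠ 0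
  far : ∀ v, some v ∈ V → 4 * ‖κ‖ ≤ ‖v - c‖
  nr : ¬RationalFn f Pf

theorem exists_Nm {f : ℂ → ℂ} {Pf : Set ℂ} (hf : TranscMeroPlane f Pf) (hmp : {z : ℂ | MultiplePoint f z}.Finite)
    (hsing : FinitelyManyTranscSing f Pf) : ∃ V c κ, Nm f Pf V c κ := by
  obtain ⟨⟨Pc, an, pole0⟩, nr⟩ := hf
  have isoP := iso_of_fin Pc
  have clP : IsClosed Pf := by
    refine isClosed_of_closure_subset (fun z hz => ?_)
    by_contra hzP
    rw [mem_closure_iff_frequently] at hz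
    obtain ⟨w, h1, h2⟩ := (hz.and_eventually (eventually_nhdsWithin_iff.1 (isoP z))).exists
    exact h2 (fun h => hzP (by rwa [← mem_singleton_iff.1 h])) h1
  have pole : ∀ p ∈ Pf, Tendsto (fun z => ‖f z‖) (𝓝[≠] p) atTop := fun p hp =>
    (pole0 p hp).mono_left (le_inf (nhdsWithin_le_nhds) (le_principal_iff.2 (isoP p)))
  have conP : IsPreconnected Pfᶜ :=
    ((count_of_fin Pc).isConnected_compl_of_one_lt_rank (by rw [Complex.rank_real_complex]; norm_num)).isPreconnected
  have nc : ∀ z ∉ Pf, ∀ b, ¬∀ᶠ w in 𝓝 z, f w = b := by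
    intro z hz b h
    have := AnalyticOnNhd.eqOn_of_preconnected_of_eventuallyEq (f := f) (g := fun _ => b) (fun w hw => an w hw)
      (fun w _ => analyticAt_const) conP hz h
    exact nr ⟨Polynomial.C b, 1, one_ne_zero, fun w hw _ => by simpa using this hw⟩
  have iso : ∀ z b, ∀ᶠ w in 𝓝[≠] z, w ∉ Pf ∧ f w ≠ b := by
    intro z b
    refine (isoP z).and ?_
    by_cases hz : z ∈ Pf
    · filter_upwards [(pole z hz).eventually_gt_atTop ‖b‖] with w hw h
      rw [h] at hw; exact lt_irrefl _ hw
    · refine (((an z hz).sub analyticAt_const).eventually_eq_zero_or_eventually_ne_zero.resolve_left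
        (fun h => nc z hz b ?_)).mono (fun w hw h => hw (sub_eq_zero.2 h))
      exact h.mono (fun w hw => sub_eq_zero.1 hw)
  have cmul : ∀ z ∉ Pf, deriv f z = 0 → MultiplePoint f z := by
    intro z hz h0
    have hnz : ¬∀ᶠ w in 𝓝 z, deriv f w = 0 := by
      intro h
      obtain ⟨r, hr, hrs⟩ := Metric.eventually_nhds_iff_ball.1 (h.and (clP.isOpen_compl.mem_nhds hz))
      refine nc z hz (f z) ?_
      filter_upwards [Metric.ball_mem_nhds z hr] with w hw
      exact (convex_ball z r).is_const_of_fderivWithin_eq_zero (𝕜 := ℂ) (f := f)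
        (fun x hx => (an x (hrs x hx).2).differentiableAt.differentiableWithinAt) (fun x hx => by
          rw [fderivWithin_of_isOpen Metric.isOpen_ball hx]
          ext; simp [(hrs x hx).1]) hw (Metric.mem_ball_self hr)
    obtain ⟨m, k, h1, h2, h3⟩ := (an z hz).deriv.exists_eventuallyEq_pow_smul_nonzero_iff.2 hnz
    have hm : m ≠ 0 := by
      rintro rfl
      have := h3.self_of_nhds
      rw [h0] at this; simp at this; exact h2 this.symm
    exact ⟨m + 1, by omega, Or.inr ⟨an z hz, by simpa using Nat.pos_of_ne_zero hm, k, h1, h2, by simpa using h3⟩⟩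
  have finA : {b | ∃ γ, AsymptoticPath f Pf b γ}.Finite := by
    by_contra hinf
    obtain ⟨n, hn⟩ := hsing
    let e := Set.Infinite.natEmbedding _ hinf
    have := hn (n + 1) (fun i => (e i).1) (fun i => (e i).2.choose) (fun i => (e i).2.choose_spec) (fun i j hij => Or.inl
      (fun h => hij (Fin.ext (e.injective (Subtype.ext h)))))
    omega
  set V := {b | ∃ γ, AsymptoticPath f Pf b γ} ∪ valueAt f Pf '' {z | MultiplePoint f z} with hV
  have finV : V.Finite := finA.union (hmp.image _)
  have finW : (some ⁻¹' V).Finite := finV.preimage (Option.some_injective _).injOn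
  obtain ⟨c, hc⟩ := finW.infinite_compl.nonempty
  obtain ⟨r, hr, hrs⟩ := Metric.nhds_basis_ball.mem_iff.1 (finW.isClosed.isOpen_compl.mem_nhds hc)
  refine ⟨V, c, (r / 4 : ℝ), clP, an, pole, iso, hmp, cmul, finV, fun z hz => Or.inr ⟨z, hz, rfl⟩,
    fun γ b h => Or.inl ⟨γ, h⟩, ?_, fun v hv => ?_, nr⟩
  · norm_cast; positivity
  · rw [Complex.norm_real, Real.norm_of_nonneg (by positivity)]
    by_contra h
    exact hrs (show v ∈ Metric.ball c r by rw [Metric.mem_ball, dist_eq_norm]; linarith) hv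

end PartN1

section PartN2

open scoped Classical in
def gN (f : ℂ → ℂ) (Pf : Set ℂ) (c κ z : ℂ) : ℂ := if z ∈ Pf then 0 else κ / (f z - c)
def PN (f : ℂ → ℂ) (Pf : Set ℂ) (c : ℂ) : Set ℂ := {z | z ∉ Pf ∧ f z = c}
def qN (f : ℂ → ℂ) (c κ z : ℂ) : ℂ := (f z - c) / κ
open scoped Classical in
def BN (c κ a : ℂ) : Option ℂ := if a = 0 then none else some (c + κ / a)
def SN (V : Set (Option ℂ)) (c κ : ℂ) : Set ℂ := {a | BN c κ a ∈ V}
def SqN (V : Set (Option ℂ)) (c κ : ℂ) : Set ℂ := {a | some (c + κ * a) ∈ V}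

section NmSec
variable {f : ℂ → ℂ} {Pf : Set ℂ} {V : Set (Option ℂ)} {c κ : ℂ}

lemma BN_inj (hκ : κ ≠ 0) : Function.Injective (BN c κ) := by
  intro a b h
  unfold BN at h
  split_ifs at h with h1 h2 h2
  · rw [h1, h2]
  · have := add_left_cancel (Option.some.inj h)
    field_simp at this
    exact this.symm

lemma vB (hκ : κ ≠ 0) {z : ℂ} (hz : z ∉ PN f Pf c) : valueAt f Pf z = BN c κ (gN f Pf c κ z) := by
  unfold valueAt BN gN
  by_cases h : z ∈ Pf
  · simp [h]
  · have : f z - c ≠ 0 := fun h' => hz ⟨h, sub_eq_zero.1 h'⟩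
    simp [h, hκ, this]

lemma Nm.gn (h : Nm f Pf V c κ) {z : ℂ} (hz : z ∉ Pf) : gN f Pf c κ =ᶠ[𝓝 z] fun w => κ / (f w - c) := by
  filter_upwards [h.clP.isOpen_compl.mem_nhds hz] with w hw
  simp [gN, show w ∉ Pf from hw]

lemma Nm.gan (h : Nm f Pf V c κ) {z : ℂ} (hz : z ∉ PN f Pf c) : AnalyticAt ℂ (gN f Pf c κ) z := by
  by_cases hp : z ∈ Pf
  · apply Complex.analyticAt_of_differentiable_on_punctured_nhds_of_continuousAt
    · filter_upwards [h.iso z c] with w hw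
      exact ((analyticAt_const.div ((h.an w hw.1).sub analyticAt_const) (sub_ne_zero.2 hw.2)).congr
        (h.gn hw.1).symm).differentiableAt
    · rw [← continuousWithinAt_compl_self]
      have h1 : Tendsto (fun w => f w - c) (𝓝[≠] z) (cobounded ℂ) := by
        rw [← tendsto_norm_atTop_iff_cobounded]
        refine tendsto_atTop_mono (fun w => norm_sub_norm_le _ _) ?_
        exact tendsto_atTop_add_const_right _ (-‖c‖) (h.pole z hp)
      have h2 := (tendsto_inv₀_cobounded.comp h1).const_mul κ
      have h0 : gN f Pf c κ z = 0 := by simp [gN, hp]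
      rw [ContinuousWithinAt, h0]
      rw [mul_zero] at h2
      refine h2.congr' ?_
      filter_upwards [h.iso z c] with w hw
      simp [gN, hw.1, div_eq_mul_inv]
  · exact (analyticAt_const.div ((h.an z hp).sub analyticAt_const)
      (sub_ne_zero.2 fun h' => hz ⟨hp, h'⟩)).congr (h.gn hp).symm

lemma Nm.gpole (h : Nm f Pf V c κ) : ∀ p ∈ PN f Pf c, Tendsto (fun z => ‖gN f Pf c κ z‖) (𝓝[≠] p) atTop := by
  intro p hp
  have h1 : Tendsto (fun w => f w - c) (𝓝[≠] p) (𝓝[≠] 0) := by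
    refine tendsto_nhdsWithin_iff.2 ⟨?_, ?_⟩
    · have := ((h.an p hp.1).continuousAt.tendsto.sub_const c).mono_left (nhdsWithin_le_nhds (s := {p}ᶜ))
      rwa [hp.2, sub_self] at this
    · filter_upwards [h.iso p c] with w hw
      exact sub_ne_zero.2 hw.2
  have h2 := (tendsto_norm_cobounded_atTop.comp (tendsto_inv₀_nhdsNE_zero.comp h1)).const_mul_atTop (norm_pos_iff.2 h.κ0)
  refine h2.congr' ?_
  filter_upwards [h.iso p c] with w hw
  simp [gN, hw.1, div_eq_mul_inv]

lemma clo_of_iso {P : Set ℂ} (h : ∀ z, ∀ᶠ w in 𝓝[≠] z, w ∉ P) : IsClosed P := by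
  refine isClosed_of_closure_subset (fun z hz => ?_)
  by_contra hzP
  rw [mem_closure_iff_frequently] at hz
  obtain ⟨w, h1, h2⟩ := (hz.and_eventually (eventually_nhdsWithin_iff.1 (h z))).exists
  exact h2 (fun h => hzP (by rwa [← mem_singleton_iff.1 h])) h1

lemma Nm.isoPN (h : Nm f Pf V c κ) (z : ℂ) : ∀ᶠ w in 𝓝[≠] z, w ∉ PN f Pf c :=
  (h.iso z c).mono fun _ hw h' => hw.2 h'.2

lemma Nm.gcrit (h : Nm f Pf V c κ) {z : ℂ} (hz : z ∉ PN f Pf c) (hd : deriv (gN f Pf c κ) z = 0) :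
    MultiplePoint f z := by
  have ha := h.gan hz
  by_cases hp : z ∈ Pf
  · have hne : ¬∀ᶠ w in 𝓝 z, gN f Pf c κ w = 0 := by
      intro h'
      obtain ⟨w, h1, h2⟩ := ((h'.filter_mono nhdsWithin_le_nhds).and (h.iso z c)).exists
      simp [gN, h2.1, h.κ0, sub_ne_zero.2 h2.2] at h1
    obtain ⟨m, k, hk, hk0, hm⟩ := ha.exists_eventuallyEq_pow_smul_nonzero_iff.2 hne
    have hz0 : gN f Pf c κ z = 0 := by simp [gN, hp]
    have hm2 : 2 ≤ m := by
      by_contra hlt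
      interval_cases m
      · have := hm.self_of_nhds
        simp [hz0] at this
        exact hk0 this.symm
      · have h1 : HasDerivAt (fun w => (w - z) ^ 1 • k w) (k z) z := by
          have := ((hasDerivAt_id z).sub_const z).mul hk.differentiableAt.hasDerivAt
          refine (this.congr_deriv (by simp)).congr_of_eventuallyEq (Eventually.of_forall fun w => ?_)
          simp
        rw [EventuallyEq.deriv_eq hm, h1.deriv] at hd
        exact hk0 hd
    refine ⟨m, hm2, Or.inl ⟨by omega, fun w => (c * ((w - z) ^ m * k w) + κ) / k w, ?_, ?_, ?_⟩⟩
    · fun_prop (disch := exact hk0)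
    · simp [show m ≠ 0 by omega, h.κ0, hk0]
    · filter_upwards [h.iso z c, hm.filter_mono nhdsWithin_le_nhds, self_mem_nhdsWithin,
        (hk.continuousAt.eventually_ne hk0).filter_mono nhdsWithin_le_nhds] with w h1 h2 h3 h4
      have h3' : w - z ≠ 0 := sub_ne_zero.2 h3
      have h5 := sub_ne_zero.2 h1.2
      simp only [gN, h1.1, if_false, smul_eq_mul] at h2
      rw [← h2]
      rw [div_eq_iff h5] at h2
      field_simp
      linear_combination -(f w) * h2
  · refine h.cmul z hp ?_
    have h5 : f z - c ≠ 0 := sub_ne_zero.2 fun h' => hz ⟨hp, h'⟩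
    have h1 := ((h.an z hp).differentiableAt.hasDerivAt.sub_const c).fun_inv h5 |>.const_mul κ
    rw [((h.gn hp).trans (Eventually.of_forall fun w => div_eq_mul_inv _ _)).deriv_eq, h1.deriv] at hd
    simpa [h.κ0, h5] using hd

lemma chord_le (z w : ℂ) : chordal (some z) (some w) ≤ ‖z - w‖ := by
  refine div_le_self (norm_nonneg _) (Real.one_le_sqrt.2 ?_)
  nlinarith [sq_nonneg ‖z‖, sq_nonneg ‖w‖, mul_nonneg (sq_nonneg ‖z‖) (sq_nonneg ‖w‖)]

lemma chord_nn (a b : Option ℂ) : 0 ≤ chordal a b := by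
  rcases a with _ | a <;> rcases b with _ | b <;> simp only [chordal] <;> positivity

lemma chord_tend (hκ : κ ≠ 0) {u : ℝ → ℂ} {a : ℂ} (hu : Tendsto u atTop (𝓝 a)) :
    Tendsto (fun t => chordal (BN c κ (u t)) (BN c κ a)) atTop (𝓝 0) := by
  by_cases ha : a = 0
  · subst ha
    have h1 : Tendsto (fun t => ‖u t‖ / ‖c * u t + κ‖) atTop (𝓝 0) := by
      have : Tendsto (fun t => ‖u t‖ / ‖c * u t + κ‖) atTop (𝓝 (‖(0:ℂ)‖ / ‖c * 0 + κ‖)) :=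
        hu.norm.div ((hu.const_mul c).add_const κ).norm (by simpa using hκ)
      simpa using this
    have h2 : ∀ᶠ t in atTop, c * u t + κ ≠ 0 :=
      ((hu.const_mul c).add_const κ).eventually_ne (by simpa using hκ)
    refine squeeze_zero' (Eventually.of_forall fun t => chord_nn _ _) ?_ h1
    filter_upwards [h2] with t ht
    by_cases h0 : u t = 0
    · simp [BN, h0, chordal]
    · simp only [BN, h0, if_false, if_true, chordal]
      have h3 : c + κ / u t = (c * u t + κ) / u t := by field_simp
      rw [h3, norm_div, div_le_div_iff₀ (by positivity) (norm_pos_iff.2 ht), one_mul]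
      have h4 : ‖c * u t + κ‖ / ‖u t‖ ≤ √(1 + (‖c * u t + κ‖ / ‖u t‖) ^ 2) :=
        Real.le_sqrt_of_sq_le (by linarith)
      rw [div_le_iff₀ (norm_pos_iff.2 h0)] at h4
      linarith
  · have h1 : Tendsto (fun t => ‖(c + κ / u t) - (c + κ / a)‖) atTop (𝓝 0) := by
      have := (((tendsto_const_nhds (x := κ)).div hu ha).const_add c).sub_const (c + κ / a)
      simpa using this.norm
    refine squeeze_zero' (Eventually.of_forall fun t => chord_nn _ _) ?_ h1
    filter_upwards [hu.eventually_ne ha] with t ht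
    simp only [BN, ha, ht, if_false]
    exact chord_le _ _

lemma Nm.finS (h : Nm f Pf V c κ) : (SN V c κ).Finite := h.finV.preimage (BN_inj h.κ0).injOn
lemma Nm.finSq (h : Nm f Pf V c κ) : (SqN V c κ).Finite := by
  refine h.finV.preimage (f := fun a => some (c + κ * a)) (Function.Injective.injOn fun a b hab => ?_)
  simpa [h.κ0] using hab

lemma Nm.gL (h : Nm f Pf V c κ) : LiftData (gN f Pf c κ) (PN f Pf c) (SN V c κ) where
  clP := clo_of_iso h.isoPN
  an := fun z hz => h.gan hz
  pole := h.gpole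
  clS := h.finS.isClosed
  crit := fun z hz hd => by
    have := h.critV z (h.gcrit hz hd)
    rwa [vB h.κ0 hz] at this
  asy := fun γ a h1 h2 h3 h4 => by
    refine h.asyV γ _ ⟨h1, h2, (chord_tend (c := c) h.κ0 h4).congr' ?_⟩
    filter_upwards [eventually_ge_atTop 0] with t ht
    rw [vB h.κ0 (h3 t ht)]

lemma Nm.qd (h : Nm f Pf V c κ) {z : ℂ} (hz : z ∉ Pf) : deriv (qN f c κ) z = deriv f z / κ :=
  (((h.an z hz).differentiableAt.hasDerivAt.sub_const c).div_const κ).deriv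

lemma Nm.qL (h : Nm f Pf V c κ) : LiftData (qN f c κ) Pf (SqN V c κ) where
  clP := h.clP
  an := fun z hz => ((h.an z hz).sub analyticAt_const).div analyticAt_const h.κ0
  pole := fun p hp => by
    have h1 : Tendsto (fun w => (‖f w‖ - ‖c‖) / ‖κ‖) (𝓝[≠] p) atTop :=
      (tendsto_atTop_add_const_right _ (-‖c‖) (h.pole p hp)).atTop_div_const (norm_pos_iff.2 h.κ0)
    refine tendsto_atTop_mono (fun w => ?_) h1
    rw [qN, norm_div]
    gcongr
    exact norm_sub_norm_le _ _
  clS := h.finSq.isClosed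
  crit := fun z hz hd => by
    rw [h.qd hz] at hd
    have := h.critV z (h.cmul z hz (by simpa [h.κ0] using hd))
    simp only [valueAt, hz, if_false] at this
    simp only [SqN, qN, mem_ofPred_eq]
    rwa [mul_div_cancel₀ _ h.κ0, add_sub_cancel]
  asy := fun γ a h1 h2 h3 h4 => by
    refine h.asyV γ _ ⟨h1, h2, ?_⟩
    have h5 : Tendsto (fun t => ‖c + κ * qN f c κ (γ t) - (c + κ * a)‖) atTop (𝓝 0) := by
      have := ((h4.const_mul κ).const_add c).sub_const (c + κ * a)
      simpa using this.norm
    refine squeeze_zero' (Eventually.of_forall fun t => chord_nn _ _) ?_ h5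
    filter_upwards [eventually_ge_atTop 0] with t ht
    simp only [valueAt, h3 t ht, if_false]
    refine (chord_le _ _).trans (le_of_eq ?_)
    rw [qN, mul_div_cancel₀ _ h.κ0, add_sub_cancel]

lemma Nm.Sq2 (h : Nm f Pf V c κ) : ∀ a ∈ SqN V c κ, 2 ≤ ‖a‖ := by
  intro a ha
  have := h.far _ ha
  rw [add_sub_cancel_left, norm_mul] at this
  have h0 := norm_pos_iff.2 h.κ0
  nlinarith

lemma Nm.rel (h : Nm f Pf V c κ) : ∀ z ∉ PN f Pf c, gN f Pf c κ z ≠ 0 → z ∉ Pf ∧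
    ∀ᶠ w in 𝓝 z, qN f c κ w = (gN f Pf c κ w)⁻¹ := by
  intro z hz h0
  have hz' : z ∉ Pf := fun h' => h0 (by simp [gN, h'])
  refine ⟨hz', (h.gn hz').mono fun w hw => ?_⟩
  rw [hw, inv_div, qN]

lemma Nm.Dm (h : Nm f Pf V c κ) : {z | z ∉ PN f Pf c ∧ deriv (gN f Pf c κ) z = 0}.Finite :=
  h.mult.subset fun _ hz => h.gcrit hz.1 hz.2

lemma Nm.isoE (h : Nm f Pf V c κ) (z : ℂ) : ∀ᶠ w in 𝓝[≠] z, w ∉ (regE (gN f Pf c κ) (PN f Pf c) (SN V c κ))ᶜ := by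
  have h1 : ∀ᶠ w in 𝓝[≠] z, ∀ a ∈ SN V c κ, f w ≠ c + κ / a :=
    (eventually_all_finite h.finS).2 fun a _ => (h.iso z _).mono fun w hw => hw.2
  filter_upwards [h1, h.iso z c] with w hw h2
  rw [mem_compl_iff, not_not]
  refine ⟨fun h' => h2.2 h'.2, fun h' => hw _ h' ?_⟩
  simp [gN, h2.1, h.κ0]

lemma Nm.ct (h : Nm f Pf V c κ) : (regE (gN f Pf c κ) (PN f Pf c) (SN V c κ))ᶜ.Countable :=
  count_of_fin fun _ hK => fin_of_iso h.isoE hK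

lemma Nm.gnr (h : Nm f Pf V c κ) : ¬∃ p q : Polynomial ℂ, q ≠ 0 ∧ ∀ z ∉ PN f Pf c, q.eval z ≠ 0 →
    gN f Pf c κ z = p.eval z / q.eval z := by
  rintro ⟨p, r, hr, hpr⟩
  have iso0 : ∀ s : Polynomial ℂ, s ≠ 0 → ∀ z, ∀ᶠ w in 𝓝[≠] z, s.eval w ≠ 0 := fun s hs z =>
    iso_of_fin (fun K _ => (Polynomial.finite_setOfPred_isRoot hs).inter_of_left K) z
  have hp : p ≠ 0 := by
    rintro rfl
    obtain ⟨w, h1, h2⟩ := ((h.iso 0 c).and (iso0 r hr 0)).exists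
    have := hpr w (fun h' => h1.2 h'.2) h2
    simp [gN, h1.1, h.κ0, sub_ne_zero.2 h1.2] at this
  refine h.nr ⟨Polynomial.C c * p * r + Polynomial.C κ * r * r, p * r, mul_ne_zero hp hr, fun z hz hq => ?_⟩
  rw [Polynomial.eval_mul] at hq
  have hp0 := left_ne_zero_of_mul hq
  have hr0 := right_ne_zero_of_mul hq
  by_cases hc : f z = c
  · exfalso
    have h1 := h.gpole z ⟨hz, hc⟩
    have h2 : Tendsto (fun w => ‖p.eval w / r.eval w‖) (𝓝[≠] z) (𝓝 ‖p.eval z / r.eval z‖) :=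
      ((p.continuous.continuousAt.div r.continuous.continuousAt hr0).norm).tendsto.mono_left nhdsWithin_le_nhds
    refine not_tendsto_nhds_of_tendsto_atTop h1 _ (h2.congr' ?_)
    filter_upwards [h.isoPN z, iso0 r hr z] with w h3 h4
    rw [hpr w h3 h4]
  · have := hpr z (fun h' => hc h'.2) hr0
    simp only [gN, hz, if_false] at this
    rw [div_eq_div_iff (sub_ne_zero.2 hc) hr0] at this
    simp only [Polynomial.eval_add, Polynomial.eval_mul, Polynomial.eval_C]
    rw [eq_div_iff hq]
    linear_combination -r.eval z * this

end NmSec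

end PartN2

section PartN3

lemma schw_an {g : ℂ → ℂ} {z : ℂ} (h : AnalyticAt ℂ g z) (h0 : deriv g z ≠ 0) : AnalyticAt ℂ (schwarzian g) z := by
  have h1 := h.deriv
  have h2 := h1.deriv
  exact (h2.deriv.div h1 h0).sub (analyticAt_const.mul ((h2.div h1 h0).pow 2))

lemma LiftData.aff {g : ℂ → ℂ} {P S : Set ℂ} (L : LiftData g P S) {z0 ρ : ℂ} (hρ : ρ ≠ 0) :
    LiftData (fun ζ => g (z0 + ρ * ζ)) {ζ | z0 + ρ * ζ ∈ P} S where
  clP := L.clP.preimage (by fun_prop)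
  an := fun z hz => (aff_an hρ).2 (L.an _ hz)
  pole := fun p hp => by
    refine (L.pole _ hp).comp (tendsto_nhdsWithin_iff.2 ⟨?_, ?_⟩)
    · exact ((by fun_prop : Continuous fun ζ => z0 + ρ * ζ).tendsto p).mono_left nhdsWithin_le_nhds
    · filter_upwards [self_mem_nhdsWithin] with w hw h
      simp [hρ] at h
      exact hw h
  clS := L.clS
  crit := fun z hz hd => by
    rw [aff_deriv] at hd
    exact L.crit _ hz ((mul_eq_zero.1 hd).resolve_left hρ)
  asy := fun γ a h1 h2 h3 h4 => by
    refine L.asy (fun t => z0 + ρ * γ t) a (by fun_prop) ?_ h3 h4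
    have h5 : Tendsto (fun t => ‖ρ‖ * ‖γ t‖ + -‖z0‖) atTop atTop :=
      tendsto_atTop_add_const_right _ _ (h2.const_mul_atTop (norm_pos_iff.2 hρ))
    refine tendsto_atTop_mono (fun t => ?_) h5
    rw [← norm_mul]
    have := norm_sub_norm_le (ρ * γ t) (-z0)
    rw [norm_neg, sub_neg_eq_add, add_comm _ z0] at this
    linarith

theorem Nm.alt {f : ℂ → ℂ} {Pf : Set ℂ} {V : Set (Option ℂ)} {c κ : ℂ} (h : Nm f Pf V c κ) :
    (∃ p q : Polynomial ℂ, q ≠ 0 ∧ ∀ z, z ∉ Pf → deriv f z ≠ 0 → q.eval z ≠ 0 →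
        schwarzian f z = p.eval z / q.eval z) ∨
    ∃ τ : ℝ, (∀ a ∈ SN V c κ, ∀ b ∈ SN V c κ, a ≠ b → 2 * Real.exp τ ≤ ‖a - b‖) ∧
      ∀ n : ℕ, ∃ (a : ℕ → ℂ) (φ : ℕ → ℂ → ℂ),
      (∀ k ≤ n, a k ∈ SN V c κ ∧ IsTract (gN f Pf c κ) (φ k) (a k) τ) ∧
      ∀ k j, 1 ≤ k → k < j → j ≤ n → ∀ w v, w.re < τ → v.re < τ → φ k w ≠ φ j v := by
  classical
  set g := gN f Pf c κ
  set q := qN f c κ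
  let A : ℂ → ℂ := fun z => if z ∈ Pf then schwarzian g z / 2 else schwarzian q z / 2
  have A1 : ∀ z ∉ PN f Pf c, deriv g z ≠ 0 → A z = schwarzian g z / 2 := by
    intro z hz hd
    by_cases hp : z ∈ Pf
    · simp [A, hp]
    · have h0 : g z ≠ 0 := by
        simp only [g, gN, hp, if_false]
        exact div_ne_zero h.κ0 (sub_ne_zero.2 fun h' => hz ⟨hp, h'⟩)
      simp only [A, hp, if_false]
      rw [schw_congr (h.rel z hz h0).2, schw_inv_comp (h.gan hz) h0 hd]
  have A2 : ∀ z ∉ Pf, A =ᶠ[𝓝 z] fun w => schwarzian q w / 2 := by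
    intro z hz
    filter_upwards [h.clP.isOpen_compl.mem_nhds hz] with w hw
    simp only [A, show w ∉ Pf from hw, if_false]
  have A3 : ∀ z, ¬MultiplePoint f z → AnalyticAt ℂ A z := by
    intro z hz
    by_cases hp : z ∈ Pf
    · have hz' : z ∉ PN f Pf c := fun h' => h'.1 hp
      have hd : deriv g z ≠ 0 := fun h' => hz (h.gcrit hz' h')
      have ha := h.gan hz'
      refine ((schw_an ha hd).div_const (c := 2)).congr ?_
      filter_upwards [ha.deriv.continuousAt.eventually_ne hd, h.gL.clP.isOpen_compl.mem_nhds hz'] with w h1 h2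
      exact (A1 w h2 h1).symm
    · refine ((schw_an (h.qL.an z hp) ?_).div_const (c := 2)).congr (A2 z hp).symm
      rw [h.qd hp]
      exact div_ne_zero (fun h' => hz (h.cmul z hp h')) h.κ0
  have A4 : ∀ z, MeromorphicAt A z := by
    intro z
    have hq : MeromorphicAt q z := by
      by_cases hp : z ∈ Pf
      · exact merom_of_pole ((h.iso z c).mono fun w hw => h.qL.an w hw.1) (h.qL.pole z hp)
      · exact (h.qL.an z hp).meromorphicAt
    have h1 : MeromorphicAt (fun w => schwarzian q w / 2) z :=
      ((hq.deriv.deriv.deriv.div hq.deriv).sub ((MeromorphicAt.const _ z).mul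
        ((hq.deriv.deriv.div hq.deriv).pow 2))).div (MeromorphicAt.const 2 z)
    refine h1.congr ((h.iso z c).mono fun w hw => ?_)
    simp only [A, hw.1, if_false]
  obtain ⟨R0, hR0⟩ : ∃ R0 : ℝ, ∀ z, MultiplePoint f z → ‖z‖ ≤ R0 := h.mult.isBounded.exists_norm_le
  set R := max 1 (R0 + 1)
  have hRm : ∀ z, R ≤ ‖z‖ → ¬MultiplePoint f z := fun z hz hm => by
    have := hR0 z hm
    have := le_max_right 1 (R0 + 1)
    linarith
  by_cases hnp : ∃ (K : ℕ) (C : ℝ), ∀ z, R ≤ ‖z‖ → ‖A z‖ ≤ C * ‖z‖ ^ K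
  · left
    obtain ⟨K, C, hC⟩ := hnp
    obtain ⟨p, r, hr, hpr⟩ := rational_of_poly h.mult.toFinset
      (fun z hz => A3 z fun h' => hz (h.mult.mem_toFinset.2 h')) A4 (le_max_left _ _) hC
    set D : Polynomial ℂ := ∏ d ∈ h.mult.toFinset, (Polynomial.X - Polynomial.C d)
    have hD : D ≠ 0 := Finset.prod_ne_zero_iff.2 fun d _ => Polynomial.X_sub_C_ne_zero d
    refine ⟨Polynomial.C 2 * p * D, r * D, mul_ne_zero hr hD, fun z hz hd hq => ?_⟩
    rw [Polynomial.eval_mul] at hq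
    have hq2 := right_ne_zero_of_mul hq
    have hz' : z ∉ h.mult.toFinset := fun h' => by
      rw [Polynomial.eval_prod, Finset.prod_ne_zero_iff] at hq2
      simpa using hq2 z h'
    have h1 := hpr z hz'
    have h2 : schwarzian q z = schwarzian f z := by
      rw [← schw_affine_comp (a := -c / κ) (b := κ⁻¹) (h.an z hz) (inv_ne_zero h.κ0) hd]
      refine schw_congr (Eventually.of_forall fun w => ?_)
      simp only [q, qN]
      ring
    simp only [A, hz, if_false] at h1
    rw [h2, div_eq_iff two_ne_zero] at h1
    simp only [Polynomial.eval_mul, Polynomial.eval_C]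
    rw [mul_div_mul_right _ _ hq2, h1]
    ring
  · right
    obtain ⟨τ, C0, R1, hτ, hC0, sep, hH⟩ := HD_of h.gL h.qL h.finS h.Sq2 h.rel h.Dm
      (fun K hK => fin_of_iso h.isoPN hK) h.gnr
    refine ⟨τ, sep, fun n => ?_⟩
    obtain ⟨ε, hε0, hε, hE⟩ : ∃ ε : ℝ, 0 < ε ∧ ε ≤ 1 / 32 ∧ 9 * ε * Real.exp (60 / 2) * 30 ≤ 1 / 10 ^ 6 := by
      refine ⟨min (1 / 32) (1 / (10 ^ 6 * 270 * Real.exp (60 / 2))), by positivity, min_le_left _ _, ?_⟩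
      calc _ ≤ 9 * (1 / (10 ^ 6 * 270 * Real.exp (60 / 2))) * Real.exp (60 / 2) * 30 := by
            gcongr; exact min_le_right _ _
        _ = 1 / 10 ^ 6 := by field_simp; norm_num
    obtain ⟨z0, ρ, l, hρ, hΛ, hl, hap⟩ := wv (le_max_left _ _) (fun z hz => A3 z (hRm z hz)) hnp
      (60 + n * (2 * Real.pi)) ε (max (10 ^ 4) (max (20000 * (1 + 128 / ε)) (1 + 2 * C0))) (max R R1) hε0
    have l1 : 10 ^ 4 ≤ l := (le_max_left _ _).trans hΛ
    have l2 : 20000 * (1 + 128 / ε) ≤ l := ((le_max_left _ _).trans (le_max_right _ _)).trans hΛ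
    have l3 : 1 + 2 * C0 ≤ l := ((le_max_right _ _).trans (le_max_right _ _)).trans hΛ
    have hμ : 128 ≤ ε * (l / 20000) ^ 2 := by
      have h1 : 1 + 128 / ε ≤ l / 20000 := by linarith
      have h2 : 0 < 128 / ε := by positivity
      have h3 : 128 / ε ≤ (l / 20000) ^ 2 := by nlinarith
      rw [div_le_iff₀ hε0] at h3
      linarith
    have nk : ∀ k : ℕ, k ≤ n → ∀ ζ : ℂ, ‖ζ‖ ≤ 60 →
        ‖((k * (2 * Real.pi) : ℝ) : ℂ) * Complex.I + ζ‖ ≤ 60 + n * (2 * Real.pi) := by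
      intro k hk ζ hζ
      have h1 : ‖((k * (2 * Real.pi) : ℝ) : ℂ) * Complex.I‖ = k * (2 * Real.pi) := by
        rw [norm_mul, Complex.norm_I, mul_one, Complex.norm_real, Real.norm_of_nonneg (by positivity)]
      have h2 : (k : ℝ) * (2 * Real.pi) ≤ n * (2 * Real.pi) := by gcongr
      linarith [norm_add_le (((k * (2 * Real.pi) : ℝ) : ℂ) * Complex.I) ζ]
    have fe : ∀ k : ℕ, (fun ζ => (fun ζ => g (z0 + ρ * ζ)) ((k * (2 * Real.pi) : ℝ) * Complex.I + 1 * ζ)) =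
        fun ζ => g ((z0 + ρ * ((k * (2 * Real.pi) : ℝ) * Complex.I)) + ρ * ζ) := fun k => by
      funext ζ
      ring_nf
    have pe : ∀ (k : ℕ) ζ, (z0 + ρ * ((k * (2 * Real.pi) : ℝ) * Complex.I)) + ρ * ζ =
        z0 + ρ * ((k * (2 * Real.pi) : ℝ) * Complex.I + ζ) := fun k ζ => by ring
    have G : GCtx (fun ζ => g (z0 + ρ * ζ)) {ζ | z0 + ρ * ζ ∈ PN f Pf c} (SN V c κ) l ε τ C0 n := by
      refine ⟨h.gL.aff hρ, sep, ?_, fun k hk => ⟨?_, hl, hε0, hε, hμ, hE, le_rfl⟩, fun k hk => ?_, l1, hC0, ?_, hτ⟩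
      · refine (h.ct.preimage (f := fun ζ => z0 + ρ * ζ) fun x y hxy => ?_)
        simpa [hρ] using hxy
      · rw [fe k]
        intro ζ hζ ha
        rw [aff_an hρ] at ha
        obtain ⟨h1, h2⟩ := hap _ (nk k hk ζ hζ)
        rw [← pe] at h1 h2
        have h3 : (z0 + ρ * ((k * (2 * Real.pi) : ℝ) * Complex.I)) + ρ * ζ ∉ PN f Pf c := fun h' =>
          not_tendsto_nhds_of_tendsto_atTop (h.gpole _ h') _ (ha.continuousAt.norm.tendsto.mono_left nhdsWithin_le_nhds)
        have h4 : deriv g ((z0 + ρ * ((k * (2 * Real.pi) : ℝ) * Complex.I)) + ρ * ζ) ≠ 0 := fun h' =>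
          hRm _ ((le_max_left R R1).trans h1.le) (h.gcrit h3 h')
        have h5 : Complex.exp (((k * (2 * Real.pi) : ℝ) : ℂ) * Complex.I + ζ) = Complex.exp ζ := by
          rw [add_comm]
          have := Complex.exp_periodic.nat_mul k ζ
          rw [← this]
          congr 1
          push_cast
          ring
        rw [A1 _ h3 h4, h5] at h2
        rw [schw_comp_affine ha hρ h4, mul_div_assoc]
        exact h2
      · rw [fe k]
        refine hH.aff hρ fun ζ hζ => ?_
        rw [pe]
        exact (le_max_right R R1).trans_lt (hap _ (nk k hk ζ hζ)).1
      · nlinarith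
    obtain ⟨a, φ, h1, h2⟩ := G.disj
    refine ⟨a, fun k w => (φ k w - (-z0 / ρ)) / ρ⁻¹, fun k hk => ⟨(h1 k hk).1, ?_⟩, ?_⟩
    · have := (h1 k hk).2.aff (z0 := -z0 / ρ) (inv_ne_zero hρ)
      convert this using 1
      funext ζ
      congr 1
      field_simp
      ring
    · intro k j hk hkj hj w v hw hv he
      refine h2 k j hk hkj hj w v hw hv ?_
      rw [div_left_inj' (inv_ne_zero hρ)] at he
      exact sub_left_injective he

end PartN3

section PartJ

lemma IsTract.clopen {g φ : ℂ → ℂ} {P S : Set ℂ} {a z : ℂ} {τ : ℝ} (h : IsTract g φ a τ) (L : LiftData g P S) (ha : a ∈ S)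
    (sep : ∀ a ∈ S, ∀ b ∈ S, a ≠ b → 2 * Real.exp τ ≤ ‖a - b‖) (hz : z ∉ P) (hr : ‖g z - a‖ < Real.exp τ)
    (hc : z ∈ closure (φ '' {w | w.re < τ})) : z ∈ φ '' {w | w.re < τ} := by
  by_cases hga : g z = a
  · exfalso
    obtain ⟨s, hs⟩ := h.inf (‖z‖ + 1)
    have h1 : ∀ᶠ y in 𝓝 z, ‖y‖ < ‖z‖ + 1 := continuous_norm.continuousAt.eventually_lt_const (lt_add_one _)
    have h2 : ∀ᶠ y in 𝓝 z, ‖g y - a‖ < Real.exp s :=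
      ((L.an z hz).continuousAt.sub continuousAt_const).norm.eventually_lt_const (by simp [hga, Real.exp_pos])
    obtain ⟨_, ⟨w, hw, rfl⟩, h3, h4⟩ := ((mem_closure_iff_frequently.1 hc).and_eventually (h1.and h2)).exists
    rw [h.val w hw, add_sub_cancel_left, Complex.norm_exp, Real.exp_lt_exp] at h4
    exact lt_asymm h3 (hs w h4)
  · have h0 := sub_ne_zero.2 hga
    have hw₀ : (Complex.log (g z - a)).re < τ := by
      rw [Complex.log_re]
      exact (Real.log_lt_iff_lt_exp (norm_pos_iff.2 h0)).2 hr
    obtain ⟨ψ, d, e, r⟩ := L.lift (h := fun w => a + Complex.exp w) (convex_halfSpace_re_lt τ) (isOpen_reLt τ)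
      (by fun_prop) (fun w hw hS => by
        have := sep a ha _ hS (by simp [Complex.exp_ne_zero])
        rw [sub_add_cancel_left, norm_neg, Complex.norm_exp] at this
        have := Real.exp_lt_exp.2 (show w.re < τ from hw)
        linarith [Real.exp_pos τ]) hw₀ hz (by rw [Complex.exp_log h0]; ring)
    have B : Br g P S ψ a τ := ⟨d, fun w hw => (r w hw).1, fun w hw => (r w hw).2⟩
    obtain ⟨_, ⟨v, hv, rfl⟩, ⟨w, hw, hwv⟩⟩ := mem_closure_iff.1 hc _ (B.open_image L (isOpen_reLt τ) subset_rfl) ⟨_, hw₀, e⟩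
    have hev : Complex.exp w = Complex.exp v := by
      have := h.val w hw
      rw [hwv, B.val v hv] at this
      exact (add_left_cancel this).symm
    obtain ⟨m, hm⟩ := Complex.exp_eq_exp_iff_exists_int.1 hev
    have hre : ∀ u : ℂ, (u + m * (2 * Real.pi * Complex.I)).re = u.re := fun u => by simp
    have key : ∀ u : ℂ, u.re < τ → φ (u + m * (2 * Real.pi * Complex.I)) = ψ u := fun u hu =>
      L.uniq (convex_halfSpace_re_lt τ).isPreconnected (g₁ := fun u => φ (u + m * (2 * Real.pi * Complex.I)))
        (h.diff.continuousOn.comp (by fun_prop) fun u hu => by rwa [mem_ofPred_eq, hre]) d.continuousOn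
        (fun u hu => h.reg L ha sep (by rwa [hre])) (fun u hu => (r u hu).1)
        (fun u hu => by
          rw [h.val _ (by rwa [hre]), (r u hu).2, Complex.exp_add]
          rw [Complex.exp_int_mul_two_pi_mul_I, mul_one]) (x₀ := v) hv (by rw [← hm, hwv]) hu
    exact ⟨_, by rwa [mem_ofPred_eq, hre], (key _ hw₀).trans e⟩

lemma chord_small {f : ℂ → ℂ} {Pf : Set ℂ} {c κ : ℂ} (hκ : κ ≠ 0) (a : ℂ) {r : ℝ} (hr : 0 < r) :
    ∃ t : ℝ, 0 < t ∧ ∀ z, chordal (valueAt f Pf z) (BN c κ a) < t → z ∉ PN f Pf c ∧ ‖gN f Pf c κ z - a‖ < r := by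
  have hκ' := norm_pos_iff.2 hκ
  by_cases ha : a = 0
  · subst ha
    refine ⟨1 / √(1 + (‖c‖ + ‖κ‖ / r) ^ 2), by positivity, fun z hz => ?_⟩
    by_cases hp : z ∈ Pf
    · exact ⟨fun h => h.1 hp, by simpa [gN, hp] using hr⟩
    · simp only [valueAt, hp, BN, if_true, if_false, chordal] at hz
      rw [one_div_lt_one_div (by positivity) (by positivity), Real.sqrt_lt_sqrt_iff (by positivity), add_lt_add_iff_left,
        sq_lt_sq₀ (by positivity) (by positivity)] at hz
      have h1 : ‖κ‖ / r < ‖f z - c‖ := by linarith [norm_sub_norm_le (f z) c]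
      have h2 : 0 < ‖f z - c‖ := lt_trans (by positivity) h1
      refine ⟨fun h => by simp [h.2] at h2, ?_⟩
      simp only [gN, hp, if_false, sub_zero, norm_div]
      rw [div_lt_iff₀ hr] at h1
      rw [div_lt_iff₀ h2]
      linarith
  · set v := c + κ / a with hv
    have hvc : v - c ≠ 0 := by simp [hv, hκ, ha]
    have h1 : ∀ᶠ w in 𝓝 v, w - c ≠ 0 ∧ ‖κ / (w - c) - a‖ < r := by
      have hc : ContinuousAt (fun w => ‖κ / (w - c) - a‖) v := by fun_prop (disch := assumption)
      refine ((by fun_prop : ContinuousAt (fun w => w - c) v).eventually_ne hvc).and (hc.eventually_lt_const ?_)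
      have : κ / (v - c) - a = 0 := by
        rw [hv, add_sub_cancel_left, div_div_cancel₀ hκ, sub_self]
      simpa only [this, norm_zero] using hr
    obtain ⟨δ, hδ, hd⟩ := Metric.eventually_nhds_iff.1 h1
    refine ⟨δ / ((1 + ‖v‖ + δ) * √(1 + ‖v‖ ^ 2)), by positivity, fun z hz => ?_⟩
    by_cases hp : z ∈ Pf
    · exfalso
      simp only [valueAt, hp, BN, ha, if_true, if_false, chordal] at hz
      rw [← hv, div_lt_div_iff₀ (by positivity) (by positivity)] at hz
      have : δ * √(1 + ‖v‖ ^ 2) ≤ (1 + ‖v‖ + δ) * √(1 + ‖v‖ ^ 2) := by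
        gcongr
        linarith [norm_nonneg v]
      linarith
    · simp only [valueAt, hp, BN, ha, if_false, chordal] at hz
      have h2 : dist (f z) v < δ := by
        by_contra hcon
        push Not at hcon
        rw [dist_eq_norm] at hcon
        have h3 : √(1 + ‖f z‖ ^ 2) ≤ 1 + ‖v‖ + ‖f z - v‖ := by
          have : ‖f z‖ ≤ ‖v‖ + ‖f z - v‖ := by linarith [norm_sub_norm_le (f z) v]
          refine Real.sqrt_le_iff.2 ⟨by positivity, ?_⟩
          nlinarith [norm_nonneg (f z)]
        rw [← hv, Real.sqrt_mul (by positivity), div_lt_div_iff₀ (by positivity) (by positivity)] at hz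
        have h4 : δ * (√(1 + ‖f z‖ ^ 2) * √(1 + ‖v‖ ^ 2)) ≤ δ * ((1 + ‖v‖ + ‖f z - v‖) * √(1 + ‖v‖ ^ 2)) := by gcongr
        have h5 : 0 ≤ (‖f z - v‖ - δ) * ((1 + ‖v‖) * √(1 + ‖v‖ ^ 2)) := mul_nonneg (by linarith) (by positivity)
        nlinarith
      obtain ⟨h3, h4⟩ := hd h2
      refine ⟨fun h => h3 (sub_eq_zero.2 h.2), ?_⟩
      simpa only [gN, hp, if_false] using h4

def pth (φ : ℂ → ℂ) (τ t : ℝ) : ℂ := φ ((τ - 1 - t : ℝ) : ℂ)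

section JSec
variable {f φ : ℂ → ℂ} {Pf : Set ℂ} {V : Set (Option ℂ)} {c κ a : ℂ} {τ : ℝ}

lemma Nm.path (h : Nm f Pf V c κ) (T : IsTract (gN f Pf c κ) φ a τ) (ha : a ∈ SN V c κ)
    (sep : ∀ a ∈ SN V c κ, ∀ b ∈ SN V c κ, a ≠ b → 2 * Real.exp τ ≤ ‖a - b‖) :
    AsymptoticPath f Pf (BN c κ a) (pth φ τ) := by
  have hre : ∀ t : ℝ, 0 ≤ t → (((τ - 1 - t : ℝ) : ℂ)).re < τ := fun t ht => by rw [Complex.ofReal_re]; linarith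
  refine ⟨T.diff.continuousOn.comp (by fun_prop) hre, tendsto_atTop.2 fun R => ?_, ?_⟩
  · obtain ⟨s, hs⟩ := T.inf R
    filter_upwards [eventually_gt_atTop (τ - 1 - s)] with t ht
    exact (hs _ (by rw [Complex.ofReal_re]; linarith)).le
  · have h1 : Tendsto (fun t : ℝ => a + Complex.exp ((τ - 1 - t : ℝ) : ℂ)) atTop (𝓝 a) := by
      have : Tendsto (fun t : ℝ => ((Real.exp (τ - 1 - t) : ℝ) : ℂ)) atTop (𝓝 ((0 : ℝ) : ℂ)) :=
        (Complex.continuous_ofReal.tendsto 0).comp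
          (Real.tendsto_exp_atBot.comp (tendsto_atBot_add_const_left _ (τ - 1) tendsto_neg_atTop_atBot))
      simpa using this.const_add a
    refine (chord_tend (c := c) h.κ0 h1).congr' ?_
    filter_upwards [eventually_ge_atTop 0] with t ht
    rw [pth, vB h.κ0 (T.reg h.gL ha sep (hre t ht)).1, ← T.val _ (hre t ht)]

lemma Nm.comp (h : Nm f Pf V c κ) (T : IsTract (gN f Pf c κ) φ a τ) (ha : a ∈ SN V c κ)
    (sep : ∀ a ∈ SN V c κ, ∀ b ∈ SN V c κ, a ≠ b → 2 * Real.exp τ ≤ ‖a - b‖) {t : ℝ} (ht : 0 < t)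
    (hY : ∀ z, chordal (valueAt f Pf z) (BN c κ a) < t → z ∉ PN f Pf c ∧ ‖gN f Pf c κ z - a‖ < Real.exp τ) :
    ∃ C, IsComponentOf C {z | chordal (valueAt f Pf z) (BN c κ a) < t} ∧ C ⊆ φ '' {w | w.re < τ} ∧
      IsBounded (pth φ τ '' Ici 0 \ C) := by
  obtain ⟨p1, p2, p3⟩ := h.path T ha sep
  obtain ⟨s, hs⟩ := eventually_atTop.1 (p3.eventually_lt_const ht)
  set s' := max s 0
  have hsY : ∀ u, s' ≤ u → pth φ τ u ∈ {z | chordal (valueAt f Pf z) (BN c κ a) < t} := fun u hu =>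
    hs u ((le_max_left _ _).trans hu)
  have B : Br (gN f Pf c κ) (PN f Pf c) (SN V c κ) φ a τ := ⟨T.diff, fun w hw => T.reg h.gL ha sep hw, T.val⟩
  refine ⟨_, ⟨pth φ τ s', hsY _ le_rfl, rfl⟩, ?_, ?_⟩
  · refine isPreconnected_connectedComponentIn.subset_of_closure_inter_subset (B.open_image h.gL (isOpen_reLt τ) subset_rfl)
      ⟨_, mem_connectedComponentIn (hsY _ le_rfl), ⟨_, ?_, rfl⟩⟩ ?_
    · have := le_max_right s 0
      rw [mem_ofPred_eq, Complex.ofReal_re]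
      linarith
    · rintro z ⟨h1, h2⟩
      obtain ⟨h3, h4⟩ := hY z (show z ∈ {z | chordal (valueAt f Pf z) (BN c κ a) < t} from connectedComponentIn_subset _ _ h2)
      exact T.clopen h.gL ha sep h3 h4 h1
  · refine ((isCompact_Icc (a := 0) (b := s')).image_of_continuousOn (p1.mono Icc_subset_Ici_self)).isBounded.subset ?_
    rintro _ ⟨⟨u, hu, rfl⟩, h2⟩
    refine ⟨u, ⟨hu, ?_⟩, rfl⟩
    by_contra hlt
    push Not at hlt
    refine h2 ((isPreconnected_Ici.image _ (p1.mono (Ici_subset_Ici.2 (le_max_right s 0)))).subset_connectedComponentIn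
      (mem_image_of_mem _ self_mem_Ici) (by rintro _ ⟨u, hu, rfl⟩; exact hsY u hu) (mem_image_of_mem _ hlt.le))

end JSec

theorem main_schw (f : ℂ → ℂ) (Pf : Set ℂ)
    (hf : TranscMeroPlane f Pf)
    (hmp : {z : ℂ | MultiplePoint f z}.Finite)
    (hsing : FinitelyManyTranscSing f Pf) :
    ∃ p q : Polynomial ℂ, q ≠ 0 ∧
      ∀ z, z ∉ Pf → deriv f z ≠ 0 → q.eval z ≠ 0 →
        schwarzian f z = p.eval z / q.eval z := by
  obtain ⟨V, c, κ, h⟩ := exists_Nm hf hmp hsing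
  refine h.alt.resolve_right ?_
  rintro ⟨τ, sep, H⟩
  obtain ⟨n, hn⟩ := hsing
  obtain ⟨a, φ, h1, h2⟩ := H (n + 1)
  have hi : ∀ i : Fin (n + 1), (i : ℕ) + 1 ≤ n + 1 := fun i => i.2
  have dj : ∀ i j : Fin (n + 1), i ≠ j → Disjoint (φ (i + 1) '' {w | w.re < τ}) (φ (j + 1) '' {w | w.re < τ}) := by
    intro i j hij
    rw [Set.disjoint_left]
    rintro _ ⟨w, hw, rfl⟩ ⟨v, hv, he⟩
    rcases lt_or_gt_of_ne hij with hl | hl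
    · exact h2 _ _ (by omega) (Nat.succ_lt_succ hl) (hi j) w v hw hv he.symm
    · exact h2 _ _ (by omega) (Nat.succ_lt_succ hl) (hi i) v w hv hw he
  have := hn (n + 1) (fun i => BN c κ (a (i + 1))) (fun i => pth (φ (i + 1)) τ)
    (fun i => h.path (h1 _ (hi i)).2 (h1 _ (hi i)).1 sep) (fun i j hij => by
      by_cases hab : a (i + 1) = a (j + 1)
      · right
        obtain ⟨t, ht, hY⟩ := chord_small (f := f) (Pf := Pf) (c := c) h.κ0 (a (i + 1)) (Real.exp_pos τ)
        obtain ⟨C₁, c1, c2, c3⟩ := h.comp (h1 _ (hi i)).2 (h1 _ (hi i)).1 sep ht hY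
        obtain ⟨C₂, d1, d2, d3⟩ := h.comp (h1 _ (hi j)).2 (h1 _ (hi j)).1 sep ht (hab ▸ hY)
        exact ⟨t, ht, C₁, C₂, c1, d1, (dj i j hij).mono c2 d2, c3, d3⟩
      · exact Or.inl fun h' => hab (BN_inj h.κ0 h'))
  omega

end PartJ

/-- Theorem 1.1, Elfving–Nevanlinna: if `f` is transcendental meromorphic in
the plane with finitely many multiple points and finitely many transcendental singularities
of the inverse, then the Schwarzian derivative `S_f` is a rational function. -/
theorem schwarzian_is_rational_of_finitely_many_singularities
    (f : ℂ → ℂ) (Pf : Set ℂ)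
    (hf : TranscMeroPlane f Pf)
    (hmp : {z : ℂ | MultiplePoint f z}.Finite)
    (hsing : FinitelyManyTranscSing f Pf) :
    ∃ p q : Polynomial ℂ, q ≠ 0 ∧
      ∀ z, z ∉ Pf → deriv f z ≠ 0 → q.eval z ≠ 0 →
        schwarzian f z = p.eval z / q.eval z := by
  exact main_schw f Pf hf hmp hsing

end
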